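/- Let n ≥ 3, 0 ≤ ρ < 1, and α ∈ [0,π]. With e₁, e₂ the first two standard basis vectors of ℝ^n and ℓ_α := e₁ cos α + e₂ sin α, the sharp directional derivative constant satisfies C(ρe₁, ℓ_α) = (c_n/(1-ρ²)) { ∫_{-1}^{1} |((n-2)/n)ρ cos α − x| (1-x²)^{(n-3)/2} dx + (n-2)ρ cos α ∫_{-1}^{1} |((n-2)/n)ρ cos α − x| (1-x²)^{(n-3)/2} x dx + (2/(n²-1))[1 − ((n-2)²/n²)ρ² cos²α]^{(n+1)/2} Σ_{k=2}^{∞} ((k-2)!/(n+2)_{k-2}) C_{k-2}^{(n+2)/2}(((n-2)/n)ρ cos α) C_k^{(n-2)/2}(cos α) ρ^k }, where c_n = 2Γ((n+2)/2)/(Γ(1/2)Γ((n-1)/2)). -/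

import Mathlib

open scoped Real BigOperators

/-- Pochhammer symbol `(lam)_m`. -/
noncomputable def poch (lam : ℝ) (m : ℕ) : ℝ := (ascPochhammer ℝ m).eval lam

/-- Gegenbauer polynomial `C_k^lam(x)`, via its explicit representation. -/
noncomputable def gegen (lam : ℝ) (k : ℕ) (x : ℝ) : ℝ :=
  ∑ j ∈ Finset.range (k / 2 + 1),
    (-1 : ℝ) ^ j * poch lam (k - j) / ((Nat.factorial j : ℝ) * (Nat.factorial (k - 2 * j) : ℝ))
      * (2 * x) ^ (k - 2 * j)

/-- `u` is harmonic on the open unit ball of `ℝⁿ`: twice continuously differentiable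
with vanishing Laplacian. -/
def IsHarmonicOnBall (n : ℕ) (u : EuclideanSpace ℝ (Fin n) → ℝ) : Prop :=
  ContDiffOn ℝ 2 u (Metric.ball 0 1) ∧
  ∀ x ∈ Metric.ball (0 : EuclideanSpace ℝ (Fin n)) 1,
    ∑ i : Fin n, iteratedFDeriv ℝ 2 u x
      ![EuclideanSpace.single i 1, EuclideanSpace.single i 1] = 0

/-- The sup of `|u|` over the open unit ball. -/
noncomputable def supAbs (n : ℕ) (u : EuclideanSpace ℝ (Fin n) → ℝ) : ℝ :=
  ⨆ y : Metric.ball (0 : EuclideanSpace ℝ (Fin n)) 1, |u y.1|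

open scoped RealInnerProductSpace

/-- The sharp constant for the directional derivative estimate at `x` in direction `ℓ`. -/
noncomputable def dirConst (n : ℕ) (x ℓ : EuclideanSpace ℝ (Fin n)) : ℝ :=
  sInf {c : ℝ | ∀ u : EuclideanSpace ℝ (Fin n) → ℝ, IsHarmonicOnBall n u →
    (∃ M : ℝ, ∀ y ∈ Metric.ball (0 : EuclideanSpace ℝ (Fin n)) 1, |u y| ≤ M) →
    |⟪gradient u x, ℓ⟫| ≤ c * supAbs n u}

/-- The sharp constant for the gradient estimate at `x`. -/
noncomputable def gradConst (n : ℕ) (x : EuclideanSpace ℝ (Fin n)) : ℝ :=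
  sInf {c : ℝ | ∀ u : EuclideanSpace ℝ (Fin n) → ℝ, IsHarmonicOnBall n u →
    (∃ M : ℝ, ∀ y ∈ Metric.ball (0 : EuclideanSpace ℝ (Fin n)) 1, |u y| ≤ M) →
    ‖gradient u x‖ ≤ c * supAbs n u}

open Polynomial in
/-- The Gegenbauer polynomial `C_k^μ` as a formal polynomial. -/
noncomputable def gegenPoly (μ : ℝ) (k : ℕ) : Polynomial ℝ :=
  ∑ j ∈ Finset.range (k / 2 + 1),
    C ((-1 : ℝ) ^ j * poch μ (k - j) / ((Nat.factorial j : ℝ) * (Nat.factorial (k - 2 * j) : ℝ))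
      * 2 ^ (k - 2 * j)) * X ^ (k - 2 * j)

lemma eval_gegenPoly (μ : ℝ) (k : ℕ) (x : ℝ) : (gegenPoly μ k).eval x = gegen μ k x := by
  simp [gegenPoly, gegen, Polynomial.eval_finsetSum, mul_pow, mul_assoc]

lemma poch_succ (μ : ℝ) (k : ℕ) : poch μ (k + 1) = poch μ k * (μ + k) := by
  simp [poch, ascPochhammer_succ_right]

lemma poch_zero (μ : ℝ) : poch μ 0 = 1 := by simp [poch]

lemma poch_succ_left (μ : ℝ) (k : ℕ) : poch μ (k + 1) = μ * poch (μ + 1) k := by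
  simp [poch, ascPochhammer_succ_left, Polynomial.eval_comp]

lemma poch_pos {μ : ℝ} (hμ : 0 < μ) (k : ℕ) : 0 < poch μ k := ascPochhammer_pos k μ hμ

lemma coeff_gegenPoly (μ : ℝ) (i j : ℕ) :
    (gegenPoly μ (i + 2 * j)).coeff i
      = (-1 : ℝ) ^ j * poch μ (i + j) / ((Nat.factorial j : ℝ) * (Nat.factorial i : ℝ)) * 2 ^ i := by
  rw [gegenPoly, Polynomial.finsetSum_coeff, Finset.sum_eq_single j]
  · have h1 : i + 2 * j - 2 * j = i := by omega
    have h2 : i + 2 * j - j = i + j := by omega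
    rw [h1, h2, Polynomial.coeff_C_mul_X_pow, if_pos rfl]
  · intro b hb hbj
    rw [Finset.mem_range] at hb
    rw [Polynomial.coeff_C_mul_X_pow, if_neg]
    omega
  · intro h
    exact absurd (Finset.mem_range.2 (by omega)) h

lemma coeff_gegenPoly_eq_zero (μ : ℝ) {i k : ℕ} (h : ∀ j, k ≠ i + 2 * j) :
    (gegenPoly μ k).coeff i = 0 := by
  rw [gegenPoly, Polynomial.finsetSum_coeff]
  refine Finset.sum_eq_zero fun b hb => ?_
  rw [Finset.mem_range] at hb
  rw [Polynomial.coeff_C_mul_X_pow, if_neg]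
  intro hi
  exact h b (by omega)

lemma gegenPoly_zero (μ : ℝ) : gegenPoly μ 0 = 1 := by simp [gegenPoly, poch_zero]

lemma gegenPoly_one (μ : ℝ) : gegenPoly μ 1 = Polynomial.C (2 * μ) * Polynomial.X := by
  simp [gegenPoly, poch_succ, poch_zero, mul_comm]

lemma natDegree_gegenPoly_le (μ : ℝ) (k : ℕ) : (gegenPoly μ k).natDegree ≤ k := by
  rw [Polynomial.natDegree_le_iff_coeff_eq_zero]
  intro N hN
  exact coeff_gegenPoly_eq_zero μ fun j => by omega

lemma coeff_gegenPoly_self_pos {μ : ℝ} (hμ : 0 < μ) (k : ℕ) : 0 < (gegenPoly μ k).coeff k := by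
  have := coeff_gegenPoly μ k 0
  simp only [mul_zero, add_zero] at this
  rw [this]
  have := poch_pos hμ k
  positivity

lemma derivative_gegenPoly (μ : ℝ) (k : ℕ) :
    Polynomial.derivative (gegenPoly μ (k + 1)) = Polynomial.C (2 * μ) * gegenPoly (μ + 1) k := by
  ext i
  rw [Polynomial.coeff_derivative, Polynomial.coeff_C_mul]
  by_cases h : ∃ j, k = i + 2 * j
  · obtain ⟨j, rfl⟩ := h
    rw [show i + 2 * j + 1 = (i + 1) + 2 * j by ring, coeff_gegenPoly, coeff_gegenPoly,
      show i + 1 + j = (i + j) + 1 by ring, poch_succ_left, Nat.factorial_succ]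
    push_cast
    field_simp
    ring
  · push Not at h
    rw [coeff_gegenPoly_eq_zero _ h, coeff_gegenPoly_eq_zero]
    · simp
    · intro j hj
      exact h j (by omega)

open Polynomial in
lemma gegenPoly_ode (μ : ℝ) (k : ℕ) :
    (1 - X ^ 2) * derivative (derivative (gegenPoly μ k))
      = C (2 * μ + 1) * (X * derivative (gegenPoly μ k))
        - C ((k : ℝ) * (k + 2 * μ)) * gegenPoly μ k := by
  have key : ∀ i : ℕ, ((i : ℝ) + 2) * (i + 1) * (gegenPoly μ k).coeff (i + 2)
      = (i * (i - 1) + (2 * μ + 1) * i - k * (k + 2 * μ)) * (gegenPoly μ k).coeff i := by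
    intro i
    by_cases h : ∃ j, k = i + 2 * j
    · obtain ⟨j, rfl⟩ := h
      rcases j with _ | j
      · rw [coeff_gegenPoly_eq_zero _ (i := i + 2) (by intro j; omega)]
        push_cast
        ring
      · rw [coeff_gegenPoly, show i + 2 * (j + 1) = (i + 2) + 2 * j by ring, coeff_gegenPoly,
          show i + (j + 1) = (i + j) + 1 by ring, show i + 2 + j = (i + j) + 1 + 1 by ring,
          poch_succ _ (i + j + 1), Nat.factorial_succ (i + 1), Nat.factorial_succ i,
          Nat.factorial_succ j]
        push_cast
        field_simp
        ring
    · push Not at h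
      rw [coeff_gegenPoly_eq_zero _ h, coeff_gegenPoly_eq_zero]
      · simp
      · intro j hj
        exact h (j + 1) (by omega)
  ext i
  rw [sub_mul, one_mul]
  simp only [coeff_sub, coeff_C_mul, coeff_derivative]
  rcases i with _ | _ | i
  · have := key 0
    simp at this ⊢
    linarith
  · have := key 1
    simp [coeff_X_pow_mul', coeff_X_mul, coeff_derivative] at this ⊢
    linarith
  · have := key (i + 2)
    simp only [coeff_X_mul, coeff_X_pow_mul, coeff_derivative] at this ⊢
    push_cast at this ⊢
    linarith

lemma gegen_one_right {μ : ℝ} (hμ : 0 < μ) (k : ℕ) :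
    gegen μ k 1 = poch (2 * μ) k / (Nat.factorial k : ℝ) := by
  induction k generalizing μ with
  | zero => simp [← eval_gegenPoly, gegenPoly_zero, poch_zero]
  | succ k ih =>
    have h := congrArg (Polynomial.eval 1) (gegenPoly_ode μ (k + 1))
    rw [derivative_gegenPoly] at h
    simp only [Polynomial.eval_mul, Polynomial.eval_sub, Polynomial.eval_pow, Polynomial.eval_X,
      Polynomial.eval_one, Polynomial.eval_C, one_pow, sub_self, zero_mul, one_mul,
      eval_gegenPoly] at h
    rw [ih (by linarith)] at h
    have h2 : poch (2 * μ) (k + 1) * (2 * μ + (k + 1 : ℕ))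
        = 2 * μ * ((2 * μ + 1) * poch (2 * (μ + 1)) k) := by
      rw [← poch_succ, poch_succ_left, poch_succ_left]
      ring_nf
    have h3 : (0:ℝ) < (k + 1 : ℕ) + 2 * μ := by positivity
    have hk : (0:ℝ) < (k + 1 : ℕ) := by positivity
    have hf : (0:ℝ) < (Nat.factorial k : ℝ) := by positivity
    rw [Nat.factorial_succ]
    push_cast at *
    rw [eq_div_iff (by positivity)]
    field_simp at h
    have h4 : ((k:ℝ) + 1 + 2 * μ) * (gegen μ (k+1) 1 * ((k + 1) * (Nat.factorial k : ℝ)))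
      = ((k:ℝ) + 1 + 2 * μ) * poch (2*μ) (k+1) := by linarith
    exact mul_left_cancel₀ h3.ne' h4

open Polynomial in
lemma gegenPoly_succ_eq (μ : ℝ) (k : ℕ) :
    C ((k : ℝ) + 2) * gegenPoly μ (k + 2)
      = C (2 * μ) * (X * gegenPoly (μ + 1) (k + 1) - gegenPoly (μ + 1) k) := by
  have key : ∀ i j : ℕ, i + 2 * j = k + 2 → ((k : ℝ) + 2) * (gegenPoly μ (k + 2)).coeff i
      = 2 * μ * ((X * gegenPoly (μ + 1) (k + 1)).coeff i - (gegenPoly (μ + 1) k).coeff i) := by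
    intro i j hij
    have hk : (k : ℝ) + 2 = i + 2 * j := by exact_mod_cast hij.symm
    rcases i with _ | i
    · rcases j with _ | j
      · omega
      have e1 : k = 0 + 2 * j := by omega
      rw [hk, e1, show 0 + 2 * j + 2 = 0 + 2 * (j + 1) by ring, coeff_gegenPoly, coeff_gegenPoly,
        show 0 + (j + 1) = (0 + j) + 1 by ring, poch_succ_left, Nat.factorial_succ j]
      simp
      field_simp
      ring
    · rw [coeff_X_mul, hk, ← hij, coeff_gegenPoly,
        show k + 1 = i + 2 * j by omega, coeff_gegenPoly,
        show i + 1 + j = (i + j) + 1 by ring, poch_succ_left]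
      rcases j with _ | j
      · rw [coeff_gegenPoly_eq_zero _ (fun j => by omega), Nat.factorial_succ i]
        push_cast
        field_simp
        ring
      · rw [show k = i + 1 + 2 * j by omega, coeff_gegenPoly, Nat.factorial_succ i,
          Nat.factorial_succ j, show i + (j + 1) = i + 1 + j by ring]
        push_cast
        field_simp
        ring
  ext i
  simp only [coeff_C_mul, coeff_sub]
  by_cases h : ∃ j, i + 2 * j = k + 2
  · obtain ⟨j, hj⟩ := h
    exact key i j hj
  · push Not at h
    rw [coeff_gegenPoly_eq_zero _ (i := i) (k := k + 2) fun j hj => h j hj.symm,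
      coeff_gegenPoly_eq_zero _ (i := i) (k := k) fun j hj => h (j + 1) (by omega)]
    rcases i with _ | i
    · simp
    · rw [coeff_X_mul, coeff_gegenPoly_eq_zero _ fun j hj => h j (by omega)]
      simp

lemma gegen_gf_mem_slitPlane {x : ℝ} (hx : |x| ≤ 1) {z : ℂ} (hz : ‖z‖ < 1) :
    1 - 2 * x * z + z ^ 2 ∈ Complex.slitPlane := by
  have hn : z.re ^ 2 + z.im ^ 2 < 1 := by
    have h := Complex.sq_norm z
    rw [Complex.normSq_apply] at h
    nlinarith [norm_nonneg z]
  rw [Complex.mem_slitPlane_iff]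
  have hre : (1 - 2 * x * z + z ^ 2 : ℂ).re = 1 - 2 * x * z.re + z.re ^ 2 - z.im ^ 2 := by
    simp [pow_two]; ring
  have him : (1 - 2 * x * z + z ^ 2 : ℂ).im = 2 * z.im * (z.re - x) := by
    simp [pow_two]; ring
  rw [hre, him]
  by_cases h : 2 * z.im * (z.re - x) = 0
  · left
    rcases mul_eq_zero.1 h with h | h
    · have h0 : z.im = 0 := by linarith
      rw [h0] at hn ⊢
      have h1 : |z.re| < 1 := by rw [← sq_lt_one_iff_abs_lt_one]; linarith
      have h2 : x * z.re ≤ |z.re| := by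
        calc x * z.re ≤ |x * z.re| := le_abs_self _
          _ = |x| * |z.re| := abs_mul _ _
          _ ≤ 1 * |z.re| := by gcongr
          _ = |z.re| := one_mul _
      nlinarith [sq_abs z.re]
    · have h0 : z.re = x := by linarith
      rw [h0] at hn ⊢
      nlinarith
  · right; exact h

lemma le_norm_gegen_gf {x : ℝ} (hx : |x| ≤ 1) {z : ℂ} (hz : ‖z‖ < 1) :
    (1 - ‖z‖) ^ 2 ≤ ‖1 - 2 * x * z + z ^ 2‖ := by
  have hx2 : x ^ 2 ≤ 1 := by rw [sq_le_one_iff_abs_le_one]; exact hx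
  set s := Real.sqrt (1 - x ^ 2) with hs
  have hs2 : s ^ 2 = 1 - x ^ 2 := Real.sq_sqrt (by linarith)
  have hs2c : (s : ℂ) ^ 2 = 1 - x ^ 2 := by exact_mod_cast hs2
  have hfac : (1 - 2 * x * z + z ^ 2 : ℂ)
      = (1 - (x + s * Complex.I) * z) * (1 - (x + (-s : ℝ) * Complex.I) * z) := by
    push_cast
    linear_combination (-z ^ 2) * hs2c + s ^ 2 * z ^ 2 * Complex.I_sq
  have hnorm : ∀ t : ℝ, t ^ 2 = 1 - x ^ 2 → ‖(x + t * Complex.I : ℂ)‖ = 1 := by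
    intro t ht
    rw [Complex.norm_add_mul_I, ht]
    simp
  have hle : ∀ t : ℝ, t ^ 2 = 1 - x ^ 2 → 1 - ‖z‖ ≤ ‖1 - (x + t * Complex.I) * z‖ := by
    intro t ht
    have := norm_sub_norm_le (1 : ℂ) ((x + t * Complex.I) * z)
    rwa [norm_mul, hnorm t ht, one_mul, norm_one] at this
  rw [hfac, norm_mul, pow_two]
  exact mul_le_mul (hle s hs2) (hle (-s) (by rw [neg_sq, hs2])) (by linarith) (norm_nonneg _)

/-- The complexified generating function of the Gegenbauer polynomials. -/
noncomputable def gegenGF (μ x : ℝ) (z : ℂ) : ℂ := (1 - 2 * x * z + z ^ 2) ^ ((-μ : ℝ) : ℂ)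

lemma hasDerivAt_gegenGF (μ : ℝ) {x : ℝ} (hx : |x| ≤ 1) {z : ℂ} (hz : ‖z‖ < 1) :
    HasDerivAt (gegenGF μ x) (2 * μ * ((x - z) * gegenGF (μ + 1) x z)) z := by
  have h1 : HasDerivAt (fun z : ℂ => 1 - 2 * x * z + z ^ 2) (-(2 * x) + 2 * z) z := by
    have := (((hasDerivAt_id z).const_mul (2 * x : ℂ)).const_sub 1).add (hasDerivAt_pow 2 z)
    convert! this using 1
    simp
  have h2 := h1.cpow_const (c := ((-μ : ℝ) : ℂ)) (gegen_gf_mem_slitPlane hx hz)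
  convert! h2 using 1
  rw [gegenGF, show ((-(μ + 1) : ℝ) : ℂ) = ((-μ : ℝ) : ℂ) - 1 by push_cast; ring]
  push_cast
  ring

lemma differentiableOn_gegenGF (μ : ℝ) {x : ℝ} (hx : |x| ≤ 1) :
    DifferentiableOn ℂ (gegenGF μ x) (Metric.ball 0 1) := fun _ hz =>
  (hasDerivAt_gegenGF μ hx (by simpa using hz)).differentiableAt.differentiableWithinAt

lemma contDiffAt_gegenGF (μ : ℝ) {x : ℝ} (hx : |x| ≤ 1) (n : ℕ) :
    ContDiffAt ℂ n (gegenGF μ x) 0 :=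
  ((differentiableOn_gegenGF μ hx).analyticAt
    (Metric.ball_mem_nhds 0 one_pos)).contDiffAt

lemma iteratedDeriv_gegenGF (μ : ℝ) {x : ℝ} (hx : |x| ≤ 1) (k : ℕ) :
    iteratedDeriv k (gegenGF μ x) 0 = (Nat.factorial k : ℂ) * gegen μ k x := by
  have hd : ∀ μ : ℝ, deriv (gegenGF μ x) =ᶠ[nhds 0]
      fun z => 2 * μ * ((x - z) * gegenGF (μ + 1) x z) := by
    intro μ
    filter_upwards [Metric.ball_mem_nhds (0 : ℂ) one_pos] with z hz
    exact (hasDerivAt_gegenGF μ hx (by simpa using hz)).deriv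
  have hstep : ∀ (μ : ℝ) (k : ℕ), iteratedDeriv (k + 1) (gegenGF μ x) 0
      = 2 * μ * (x * iteratedDeriv k (gegenGF (μ + 1) x) 0
        - k * iteratedDeriv (k - 1) (gegenGF (μ + 1) x) 0) := by
    intro μ k
    rw [iteratedDeriv_succ', (hd μ).iteratedDeriv_eq, iteratedDeriv_const_mul_field,
      iteratedDeriv_fun_mul (f := fun z : ℂ => (x : ℂ) - z)
        (contDiffAt_const.sub contDiffAt_fun_id) (contDiffAt_gegenGF (μ + 1) hx k)]
    congr 1
    have h0 : ∀ i : ℕ, iteratedDeriv i (fun z : ℂ => (x : ℂ) - z) 0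
        = if i = 0 then (x : ℂ) else if i = 1 then -1 else 0 := by
      intro i
      rcases i with _ | _ | i
      · simp
      · simp [iteratedDeriv_succ', iteratedDeriv_const]
      · simp [iteratedDeriv_succ', iteratedDeriv_const]
    rcases k with _ | k
    · simp
    · rw [Finset.sum_range_succ', Finset.sum_range_succ']
      rw [Finset.sum_eq_zero]
      · simp [h0]; ring
      · intro i _
        simp [h0]
  induction k using Nat.strong_induction_on generalizing μ with
  | _ k ih =>
    rcases k with _ | _ | k
    · simp [gegenGF, ← eval_gegenPoly, gegenPoly_zero]
    · rw [hstep, ih 0 (by omega)]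
      simp [← eval_gegenPoly, gegenPoly_zero, gegenPoly_one]
    · rw [hstep, ih (k + 1) (by omega), Nat.add_sub_cancel, ih k (by omega)]
      have h := congrArg (Polynomial.eval x) (gegenPoly_succ_eq μ k)
      simp only [Polynomial.eval_mul, Polynomial.eval_C, Polynomial.eval_sub, Polynomial.eval_X,
        eval_gegenPoly] at h
      have hc : ((k : ℂ) + 2) * gegen μ (k + 2) x
          = 2 * μ * (x * gegen (μ + 1) (k + 1) x - gegen (μ + 1) k x) := by exact_mod_cast h
      rw [Nat.factorial_succ (k + 1), Nat.factorial_succ k]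
      push_cast
      linear_combination (-((k : ℂ) + 1) * (Nat.factorial k : ℂ)) * hc

lemma abs_gegen_le {μ : ℝ} (hμ : 0 < μ) {x : ℝ} (hx : |x| ≤ 1) {R : ℝ} (hR : 0 < R) (hR' : R < 1)
    (k : ℕ) : |gegen μ k x| ≤ ((1 - R) ^ 2) ^ (-μ) / R ^ k := by
  have hcl : DiffContOnCl ℂ (gegenGF μ x) (Metric.ball 0 R) := by
    refine DifferentiableOn.diffContOnCl ?_
    rw [closure_ball _ hR.ne']
    exact (differentiableOn_gegenGF μ hx).mono (Metric.closedBall_subset_ball hR')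
  have := Complex.norm_iteratedDeriv_le_of_forall_mem_sphere_norm_le k hR hcl
    (C := ((1 - R) ^ 2) ^ (-μ)) (fun z hz => by
      have hz' : ‖z‖ = R := by simpa using hz
      have hlt : ‖z‖ < 1 := by linarith
      rw [gegenGF, Complex.norm_cpow_of_ne_zero
        (Complex.slitPlane_ne_zero (gegen_gf_mem_slitPlane hx hlt))]
      simp only [Complex.ofReal_re, Complex.ofReal_im, mul_zero, Real.exp_zero, div_one]
      have hle := le_norm_gegen_gf hx hlt
      rw [hz'] at hle
      exact Real.rpow_le_rpow_of_nonpos (by nlinarith) hle (by linarith))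
  rw [iteratedDeriv_gegenGF μ hx, norm_mul, Complex.norm_natCast, Complex.norm_real,
    Real.norm_eq_abs, mul_div_assoc] at this
  exact le_of_mul_le_mul_left this (by positivity)

lemma hasSum_gegen (μ : ℝ) {x : ℝ} (hx : |x| ≤ 1) {t : ℝ} (ht : |t| < 1) :
    HasSum (fun k => gegen μ k x * t ^ k) ((1 - 2 * x * t + t ^ 2) ^ (-μ)) := by
  have h := Complex.hasSum_taylorSeries_on_ball (f := gegenGF μ x) (c := 0) (r := 1)
    (by simpa using differentiableOn_gegenGF μ hx) (z := t) (by simpa using ht)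
  have hpos : 0 ≤ 1 - 2 * x * t + t ^ 2 := by
    have : x ^ 2 ≤ 1 := by rw [sq_le_one_iff_abs_le_one]; exact hx
    nlinarith [sq_nonneg (t - x)]
  have h3 : gegenGF μ x t = (((1 - 2 * x * t + t ^ 2) ^ (-μ) : ℝ) : ℂ) := by
    rw [gegenGF, Complex.ofReal_cpow hpos]
    push_cast
    ring_nf
  rw [h3] at h
  rw [← Complex.hasSum_ofReal]
  convert! h using 2 with k
  have hk : (Nat.factorial k : ℂ) ≠ 0 := by exact_mod_cast Nat.factorial_ne_zero k
  rw [iteratedDeriv_gegenGF μ hx, sub_zero, smul_eq_mul, smul_eq_mul]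
  push_cast
  field_simp

lemma exists_summable_bound_gegen {μ : ℝ} (hμ : 0 < μ) {t : ℝ} (ht : |t| < 1) :
    ∃ b : ℕ → ℝ, Summable b ∧ ∀ x : ℝ, |x| ≤ 1 → ∀ k, |gegen μ k x * t ^ k| ≤ b k := by
  obtain ⟨R, hR, hR'⟩ := exists_between ht
  have hR0 : 0 < R := (abs_nonneg t).trans_lt hR
  refine ⟨fun k => ((1 - R) ^ 2) ^ (-μ) * (|t| / R) ^ k, ?_, fun x hx k => ?_⟩
  · refine (summable_geometric_of_lt_one (by positivity) ?_).mul_left _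
    rwa [div_lt_one hR0]
  · beta_reduce
    rw [abs_mul, abs_pow, div_pow, mul_div_assoc', mul_comm (((1 - R) ^ 2) ^ (-μ)),
      ← mul_div_assoc', mul_comm]
    exact mul_le_mul_of_nonneg_left (abs_gegen_le hμ hx hR0 hR' k) (by positivity)

/-- The Gegenbauer weight `(1 - t²)^(μ - 1/2)`. -/
noncomputable def gegenWeight (μ t : ℝ) : ℝ := (1 - t ^ 2) ^ (μ - 1 / 2)

lemma continuous_gegenWeight {μ : ℝ} (hμ : 1 / 2 ≤ μ) : Continuous (gegenWeight μ) :=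
  (by fun_prop : Continuous fun t : ℝ => 1 - t ^ 2).rpow_const fun _ => Or.inr (by linarith)

lemma gegenWeight_nonneg {μ t : ℝ} (ht : t ∈ Set.Icc (-1 : ℝ) 1) : 0 ≤ gegenWeight μ t :=
  Real.rpow_nonneg (by nlinarith [ht.1, ht.2]) _

lemma gegenWeight_pos {μ t : ℝ} (ht : t ∈ Set.Ioo (-1 : ℝ) 1) : 0 < gegenWeight μ t :=
  Real.rpow_pos_of_pos (by nlinarith [ht.1, ht.2]) _

lemma gegenWeight_add_one {μ t : ℝ} (hμ : 1 / 2 ≤ μ) (ht : t ∈ Set.Icc (-1 : ℝ) 1) :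
    gegenWeight (μ + 1) t = (1 - t ^ 2) * gegenWeight μ t := by
  have h0 : 0 ≤ 1 - t ^ 2 := by nlinarith [ht.1, ht.2]
  rw [gegenWeight, gegenWeight, show μ + 1 - 1 / 2 = 1 + (μ - 1 / 2) by ring,
    Real.rpow_add_of_nonneg h0 zero_le_one (by linarith), Real.rpow_one]

lemma gegenWeight_one {μ : ℝ} (hμ : 1 / 2 < μ) : gegenWeight μ 1 = 0 := by
  simp only [gegenWeight, one_pow, sub_self]
  exact Real.zero_rpow (by linarith)

lemma gegenWeight_neg_one {μ : ℝ} (hμ : 1 / 2 < μ) : gegenWeight μ (-1) = 0 := by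
  simp only [gegenWeight, neg_sq, one_pow, sub_self]
  exact Real.zero_rpow (by linarith)

lemma continuous_gegen (μ : ℝ) (k : ℕ) : Continuous (gegen μ k) := by
  simp_rw [← funext (eval_gegenPoly μ k)]
  exact Polynomial.continuous _

lemma hasDerivAt_gegen (μ : ℝ) (k : ℕ) (t : ℝ) :
    HasDerivAt (gegen μ k) ((gegenPoly μ k).derivative.eval t) t := by
  have := (gegenPoly μ k).hasDerivAt t
  simpa only [eval_gegenPoly] using this

/-- The ratio relating consecutive Rodrigues-type derivatives. -/
noncomputable def gegenRatio (μ : ℝ) (k : ℕ) : ℝ := 2 * μ / ((k + 1) * (k + 1 + 2 * μ))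

lemma hasDerivAt_weight_mul_gegen {μ : ℝ} (hμ : 1 / 2 ≤ μ) (k : ℕ) {t : ℝ}
    (ht : t ∈ Set.Ioo (-1 : ℝ) 1) :
    HasDerivAt (fun t => -gegenRatio μ k * (gegenWeight (μ + 1) t * gegen (μ + 1) k t))
      (gegenWeight μ t * gegen μ (k + 1) t) t := by
  have hpos : 0 < 1 - t ^ 2 := by nlinarith [ht.1, ht.2]
  have h1 : HasDerivAt (fun t : ℝ => 1 - t ^ 2) (-(2 * t)) t := by
    simpa using (hasDerivAt_pow 2 t).const_sub 1
  have h2 : HasDerivAt (gegenWeight (μ + 1)) (-(2 * t) * (μ + 1 / 2) * gegenWeight μ t) t := by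
    have := h1.rpow_const (p := μ + 1 - 1 / 2) (Or.inl hpos.ne')
    convert! this using 1
    rw [gegenWeight]
    ring_nf
  have h3 := ((h2.mul (hasDerivAt_gegen (μ + 1) k t)).const_mul (-gegenRatio μ k))
  convert! h3 using 1
  have hode := congrArg (Polynomial.eval t) (gegenPoly_ode μ (k + 1))
  rw [derivative_gegenPoly] at hode
  simp only [Polynomial.derivative_C_mul, Polynomial.eval_mul, Polynomial.eval_sub,
    Polynomial.eval_pow, Polynomial.eval_X, Polynomial.eval_one, Polynomial.eval_C,
    eval_gegenPoly] at hode
  rw [gegenWeight_add_one hμ (Set.Ioo_subset_Icc_self ht), gegenRatio]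
  have hk : (0 : ℝ) < k + 1 + 2 * μ := by positivity
  have hk' : (0 : ℝ) < k + 1 := by positivity
  field_simp
  push_cast at hode
  linear_combination gegenWeight μ t * hode

lemma integral_mul_gegen_succ {μ : ℝ} (hμ : 1 / 2 ≤ μ) (k : ℕ) (p : Polynomial ℝ) :
    ∫ t in (-1 : ℝ)..1, p.eval t * gegen μ (k + 1) t * gegenWeight μ t
      = gegenRatio μ k * ∫ t in (-1 : ℝ)..1,
          p.derivative.eval t * gegen (μ + 1) k t * gegenWeight (μ + 1) t := by
  have hc0 := continuous_gegenWeight hμ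
  have hc1 := continuous_gegenWeight (show 1 / 2 ≤ μ + 1 by linarith)
  have hg0 := continuous_gegen μ (k + 1)
  have hg1 := continuous_gegen (μ + 1) k
  have hF := intervalIntegral.integral_eq_sub_of_hasDerivAt_of_le (a := -1) (b := 1)
    (f := fun t => p.eval t * (-gegenRatio μ k * (gegenWeight (μ + 1) t * gegen (μ + 1) k t)))
    (f' := fun t => p.derivative.eval t
        * (-gegenRatio μ k * (gegenWeight (μ + 1) t * gegen (μ + 1) k t))
      + p.eval t * (gegenWeight μ t * gegen μ (k + 1) t)) (by norm_num)
    (Continuous.continuousOn (by fun_prop))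
    (fun t ht => (p.hasDerivAt t).mul (hasDerivAt_weight_mul_gegen hμ k ht))
    (Continuous.intervalIntegrable (by fun_prop) _ _)
  rw [intervalIntegral.integral_add (Continuous.intervalIntegrable (by fun_prop) _ _)
    (Continuous.intervalIntegrable (by fun_prop) _ _), gegenWeight_one (by linarith),
    gegenWeight_neg_one (by linarith)] at hF
  rw [← intervalIntegral.integral_const_mul]
  have e1 : ∀ t, p.derivative.eval t
      * (-gegenRatio μ k * (gegenWeight (μ + 1) t * gegen (μ + 1) k t))
      = -(gegenRatio μ k * (p.derivative.eval t * gegen (μ + 1) k t * gegenWeight (μ + 1) t)) :=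
    fun t => by ring
  have e2 : ∀ t, p.eval t * gegen μ (k + 1) t * gegenWeight μ t
    = p.eval t * (gegenWeight μ t * gegen μ (k + 1) t) := fun t => by ring
  simp_rw [e1, intervalIntegral.integral_neg] at hF
  simp_rw [e2]
  linarith

lemma integral_mul_gegen_eq_zero {μ : ℝ} (hμ : 1 / 2 ≤ μ) {k : ℕ} {p : Polynomial ℝ}
    (hp : p.natDegree < k) :
    ∫ t in (-1 : ℝ)..1, p.eval t * gegen μ k t * gegenWeight μ t = 0 := by
  induction k generalizing μ p with
  | zero => omega
  | succ k ih =>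
    rw [integral_mul_gegen_succ hμ]
    by_cases h : p.natDegree = 0
    · rw [Polynomial.eq_C_of_natDegree_eq_zero h]
      simp
    · rw [ih (by linarith), mul_zero]
      have := Polynomial.natDegree_derivative_lt h
      omega

lemma eq_zero_of_integral_sq_gegenWeight {μ : ℝ} (hμ : 1 / 2 ≤ μ) {p : Polynomial ℝ}
    (h : ∫ t in (-1 : ℝ)..1, p.eval t * p.eval t * gegenWeight μ t = 0) : p = 0 := by
  have hc0 := continuous_gegenWeight hμ
  by_contra hne
  obtain ⟨t, ht, hpt⟩ : ∃ t ∈ Set.Ioo (-1 : ℝ) 1, p.eval t ≠ 0 := by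
    by_contra hcon
    push Not at hcon
    exact hne (Polynomial.eq_zero_of_infinite_isRoot p
      ((Set.Ioo_infinite (by norm_num : (-1 : ℝ) < 1)).mono fun t ht => hcon t ht))
  have := intervalIntegral.integral_pos (a := -1) (b := 1)
    (f := fun t => p.eval t * p.eval t * gegenWeight μ t) (by norm_num)
    (Continuous.continuousOn (by fun_prop))
    (fun t ht => mul_nonneg (mul_self_nonneg _) (gegenWeight_nonneg (Set.Ioc_subset_Icc_self ht)))
    ⟨t, Set.Ioo_subset_Icc_self ht, mul_pos (mul_self_pos.2 hpt) (gegenWeight_pos ht)⟩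
  linarith

lemma integral_sq_mul_gegenWeight {μ : ℝ} (hμ : 1 / 2 ≤ μ) :
    (2 * μ + 2) * ∫ t in (-1 : ℝ)..1, t ^ 2 * gegenWeight μ t
      = ∫ t in (-1 : ℝ)..1, gegenWeight μ t := by
  have hc0 := continuous_gegenWeight hμ
  have h := integral_mul_gegen_succ hμ 0 Polynomial.X
  simp only [zero_add, Polynomial.derivative_X, Polynomial.eval_one, Polynomial.eval_X, one_mul,
    ← eval_gegenPoly, gegenPoly_zero, gegenPoly_one, Polynomial.eval_mul, Polynomial.eval_C] at h
  have e1 : ∫ t in (-1 : ℝ)..1, gegenWeight (μ + 1) t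
      = (∫ t in (-1 : ℝ)..1, gegenWeight μ t) - ∫ t in (-1 : ℝ)..1, t ^ 2 * gegenWeight μ t := by
    rw [← intervalIntegral.integral_sub (hc0.intervalIntegrable _ _)
      (Continuous.intervalIntegrable (by fun_prop) _ _)]
    refine intervalIntegral.integral_congr fun t ht => ?_
    rw [Set.uIcc_of_le (by norm_num)] at ht
    simp only [gegenWeight_add_one hμ ht]
    ring
  have e2 : ∀ t, t * (2 * μ * t) * gegenWeight μ t = 2 * μ * (t ^ 2 * gegenWeight μ t) :=
    fun t => by ring
  simp_rw [e2, intervalIntegral.integral_const_mul] at h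
  rw [e1, gegenRatio] at h
  have hk : (0 : ℝ) < 1 + 2 * μ := by linarith
  have hm : (0 : ℝ) < μ := by linarith
  push_cast at h
  field_simp at h
  simp at h
  linarith

lemma integral_abs_sub_mul_gegen {μ : ℝ} (hμ : 1 / 2 ≤ μ) (k : ℕ) {a : ℝ}
    (ha : a ∈ Set.Ioo (-1 : ℝ) 1) :
    ∫ t in (-1 : ℝ)..1, |a - t| * gegen μ (k + 2) t * gegenWeight μ t
      = 2 * (gegenRatio μ (k + 1) * gegenRatio (μ + 1) k)
          * (gegenWeight (μ + 2) a * gegen (μ + 2) k a) := by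
  have hμ1 : 1 / 2 ≤ μ + 1 := by linarith
  have hμ2 : 1 / 2 ≤ μ + 2 := by linarith
  have hc0 := continuous_gegenWeight hμ
  have hc1 := continuous_gegenWeight hμ1
  have hc2 := continuous_gegenWeight hμ2
  have hg0 := continuous_gegen μ (k + 2)
  have hg1 := continuous_gegen (μ + 1) (k + 1)
  have hg2 := continuous_gegen (μ + 2) k
  set r := gegenRatio μ (k + 1)
  set r' := gegenRatio (μ + 1) k
  let B' : ℝ → ℝ := fun t => -r * (gegenWeight (μ + 1) t * gegen (μ + 1) (k + 1) t)
  let B : ℝ → ℝ := fun t => r * r' * (gegenWeight (μ + 2) t * gegen (μ + 2) k t)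
  have hB' : ∀ t ∈ Set.Ioo (-1 : ℝ) 1, HasDerivAt B' (gegenWeight μ t * gegen μ (k + 2) t) t :=
    fun t ht => hasDerivAt_weight_mul_gegen hμ (k + 1) ht
  have hB : ∀ t ∈ Set.Ioo (-1 : ℝ) 1, HasDerivAt B (B' t) t := by
    intro t ht
    have := (hasDerivAt_weight_mul_gegen hμ1 k ht).const_mul (-r)
    rw [show μ + 1 + 1 = μ + 2 by ring] at this
    convert! this using 1
    ext s
    simp only [B, r']
    ring
  have hF : ∀ t ∈ Set.Ioo (-1 : ℝ) 1, HasDerivAt (fun t => (a - t) * B' t + B t)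
      ((a - t) * gegen μ (k + 2) t * gegenWeight μ t) t := by
    intro t ht
    convert! (((hasDerivAt_id t).const_sub a).mul (hB' t ht)).add (hB t ht) using 1
    simp
    ring
  have hcF : Continuous fun t => (a - t) * B' t + B t := by fun_prop
  have hcf : Continuous fun t => (a - t) * gegen μ (k + 2) t * gegenWeight μ t := by fun_prop
  have hcf' : Continuous fun t => |a - t| * gegen μ (k + 2) t * gegenWeight μ t := by fun_prop
  have i1 := intervalIntegral.integral_eq_sub_of_hasDerivAt_of_le ha.1.le hcF.continuousOn
    (fun t ht => hF t ⟨ht.1, ht.2.trans ha.2⟩) (hcf.intervalIntegrable _ _)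
  have i2 := intervalIntegral.integral_eq_sub_of_hasDerivAt_of_le ha.2.le hcF.continuousOn
    (fun t ht => hF t ⟨ha.1.trans ht.1, ht.2⟩) (hcf.intervalIntegrable _ _)
  rw [← intervalIntegral.integral_add_adjacent_intervals (hcf'.intervalIntegrable (-1) a)
    (hcf'.intervalIntegrable a 1)]
  have j1 : ∫ t in (-1 : ℝ)..a, |a - t| * gegen μ (k + 2) t * gegenWeight μ t
      = ∫ t in (-1 : ℝ)..a, (a - t) * gegen μ (k + 2) t * gegenWeight μ t := by
    refine intervalIntegral.integral_congr fun t ht => ?_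
    rw [Set.uIcc_of_le ha.1.le] at ht
    simp only [abs_of_nonneg (sub_nonneg.2 ht.2)]
  have j2 : ∫ t in a..(1 : ℝ), |a - t| * gegen μ (k + 2) t * gegenWeight μ t
      = -∫ t in a..(1 : ℝ), (a - t) * gegen μ (k + 2) t * gegenWeight μ t := by
    rw [← intervalIntegral.integral_neg]
    refine intervalIntegral.integral_congr fun t ht => ?_
    rw [Set.uIcc_of_le ha.2.le] at ht
    simp only [abs_of_nonpos (sub_nonpos.2 ht.1)]
    ring
  rw [j1, j2, i1, i2]
  simp only [B, B', gegenWeight_one (show 1 / 2 < μ + 1 by linarith),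
    gegenWeight_one (show 1 / 2 < μ + 2 by linarith),
    gegenWeight_neg_one (show 1 / 2 < μ + 1 by linarith),
    gegenWeight_neg_one (show 1 / 2 < μ + 2 by linarith)]
  ring

/-- The surface measure on the unit sphere of `ℝⁿ`. -/
noncomputable abbrev sphMeasure (n : ℕ) :
    MeasureTheory.Measure (Metric.sphere (0 : EuclideanSpace ℝ (Fin n)) 1) :=
  (MeasureTheory.volume : MeasureTheory.Measure (EuclideanSpace ℝ (Fin n))).toSphere

/-- The mean of `F` over the unit sphere of `ℝⁿ`. -/
noncomputable def sphMean (n : ℕ) (F : EuclideanSpace ℝ (Fin n) → ℝ) : ℝ :=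
  ((sphMeasure n).real Set.univ)⁻¹ * ∫ η, F η ∂(sphMeasure n)

open MeasureTheory in
lemma integral_homogeneous_mul_norm {n : ℕ} (hn : 0 < n) (m : ℕ)
    (G : EuclideanSpace ℝ (Fin n) → ℝ)
    (hG : ∀ r : ℝ, 0 < r → ∀ y, G (r • y) = r ^ m * G y) (f : ℝ → ℝ) :
    ∫ y, G y * f ‖y‖ = (∫ η, G η ∂(sphMeasure n)) *
      ∫ r in Set.Ioi (0 : ℝ), r ^ (n - 1) * (r ^ m * f r) := by
  have : Nonempty (Fin n) := ⟨⟨0, hn⟩⟩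
  have hd : Module.finrank ℝ (EuclideanSpace ℝ (Fin n)) = n := by simp
  calc
    ∫ y, G y * f ‖y‖ = ∫ x : ({(0)}ᶜ : Set (EuclideanSpace ℝ (Fin n))), G x.1 *
      f ‖x.1‖ ∂(volume.comap Subtype.val) := by
      rw [integral_subtype_comap (measurableSet_singleton _).compl fun x ↦ G x * f (‖x‖),
        restrict_compl_singleton]
    _ = ∫ z : Metric.sphere (0 : EuclideanSpace ℝ (Fin n)) 1 × Set.Ioi (0 : ℝ), G z.1 * (z.2.1 ^ m * f z.2)
          ∂(sphMeasure n).prod (.volumeIoiPow (n - 1)) := by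
      have h := (volume : Measure (EuclideanSpace ℝ (Fin n))).measurePreserving_homeomorphUnitSphereProd.integral_comp
        (Homeomorph.measurableEmbedding _)
        (fun z : Metric.sphere (0 : EuclideanSpace ℝ (Fin n)) 1 × Set.Ioi (0 : ℝ) => G z.1 * (z.2.1 ^ m * f z.2))
      rw [hd] at h
      rw [← h]
      refine integral_congr_ae (.of_forall fun x => ?_)
      have hx : 0 < ‖x.1‖ := norm_pos_iff.2 x.2
      simp only [homeomorphUnitSphereProd_apply_fst_coe, homeomorphUnitSphereProd_apply_snd_coe]
      rw [hG _ (inv_pos.2 hx), inv_pow]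
      field_simp
    _ = (∫ η, G η ∂(sphMeasure n)) *
        ∫ x : Set.Ioi (0 : ℝ), (x.1 ^ m * f x) ∂.volumeIoiPow (n - 1) :=
      integral_prod_mul (fun η : Metric.sphere (0 : EuclideanSpace ℝ (Fin n)) 1 => G η)
        (fun x : Set.Ioi (0 : ℝ) => x.1 ^ m * f x)
    _ = _ := by
      congr 1
      simp only [Measure.volumeIoiPow, ENNReal.ofReal]
      rw [integral_withDensity_eq_integral_smul,
        integral_subtype_comap measurableSet_Ioi
          fun a ↦ Real.toNNReal (a ^ (n - 1)) • (a ^ m * f a)]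
      · refine setIntegral_congr_fun measurableSet_Ioi fun x hx ↦ ?_
        simp only [NNReal.smul_def, Real.coe_toNNReal _ (pow_nonneg hx.out.le _), smul_eq_mul]
      · exact (measurable_subtype_coe.pow_const _).real_toNNReal

lemma integral_Ioi_pow_mul_exp_neg_sq (m : ℕ) :
    ∫ r in Set.Ioi (0 : ℝ), r ^ m * Real.exp (-r ^ 2) = 1 / 2 * Real.Gamma ((m + 1) / 2) := by
  have h := integral_rpow_mul_exp_neg_rpow (p := 2) (q := m) (by norm_num)
    (by have : (0 : ℝ) ≤ m := by positivity
        linarith)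
  rw [← h]
  refine MeasureTheory.setIntegral_congr_fun measurableSet_Ioi fun x _ => ?_
  simp

lemma integral_odd_pow_mul {m : ℕ} (hm : Odd m) {f : ℝ → ℝ} (hf : ∀ x, f (-x) = f x) :
    ∫ x : ℝ, x ^ m * f x = 0 := by
  have h := MeasureTheory.integral_neg_eq_self (fun x : ℝ => x ^ m * f x) MeasureTheory.volume
  simp only [hf, hm.neg_pow, neg_mul, MeasureTheory.integral_neg] at h
  linarith

lemma integral_even_pow_mul_exp_neg_sq (p : ℕ) :
    ∫ x : ℝ, x ^ (2 * p) * Real.exp (-x ^ 2) = Real.Gamma (p + 1 / 2) := by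
  have h := integral_comp_abs (f := fun x => x ^ (2 * p) * Real.exp (-x ^ 2))
  simp only [(even_two_mul p).pow_abs, even_two.pow_abs] at h
  rw [h, integral_Ioi_pow_mul_exp_neg_sq, ← mul_assoc]
  norm_num
  congr 1
  ring

open MeasureTheory in
lemma integral_inner_pow_mul_exp {n : ℕ} {i j : Fin n} (hij : i ≠ j)
    (B : OrthonormalBasis (Fin n) ℝ (EuclideanSpace ℝ (Fin n))) (a b : ℕ) :
    ∫ y, (⟪B i, y⟫ ^ a * ⟪B j, y⟫ ^ b) * Real.exp (-‖y‖ ^ 2) =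
      (∫ x : ℝ, x ^ a * Real.exp (-x ^ 2)) * (∫ x : ℝ, x ^ b * Real.exp (-x ^ 2)) *
        (∫ x : ℝ, Real.exp (-x ^ 2)) ^ (n - 2) := by
  classical
  set e : Fin n → ℕ := fun k => if k = i then a else if k = j then b else 0 with he
  have h1 : ∫ y, (⟪B i, y⟫ ^ a * ⟪B j, y⟫ ^ b) * Real.exp (-‖y‖ ^ 2) =
      ∫ z : EuclideanSpace ℝ (Fin n), (z i ^ a * z j ^ b) * Real.exp (-‖z‖ ^ 2) := by
    rw [← (B.measurePreserving_repr).integral_comp B.repr.toHomeomorph.measurableEmbedding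
      (fun z => (z i ^ a * z j ^ b) * Real.exp (-‖z‖ ^ 2))]
    refine integral_congr_ae (.of_forall fun y => ?_)
    simp [B.repr_apply_apply]
  have h2 : ∫ z : EuclideanSpace ℝ (Fin n), (z i ^ a * z j ^ b) * Real.exp (-‖z‖ ^ 2) =
      ∫ z : Fin n → ℝ, ∏ k, (z k ^ e k * Real.exp (-z k ^ 2)) := by
    rw [← (PiLp.volume_preserving_ofLp (Fin n)).integral_comp
      (MeasurableEquiv.toLp 2 (Fin n → ℝ)).symm.measurableEmbedding]
    refine integral_congr_ae (.of_forall fun z => ?_)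
    have hE : ‖z‖ ^ 2 = ∑ k, z k ^ 2 := by
      rw [EuclideanSpace.norm_sq_eq]; simp
    simp only [Finset.prod_mul_distrib, ← Real.exp_sum, Finset.sum_neg_distrib, hE]
    congr 1
    rw [← Finset.mul_prod_erase _ _ (Finset.mem_univ i),
      ← Finset.mul_prod_erase _ _ (Finset.mem_erase.2 ⟨hij.symm, Finset.mem_univ j⟩),
      Finset.prod_eq_one]
    · simp [he, hij.symm]
    · intro k hk
      simp only [Finset.mem_erase] at hk
      simp [he, hk.1, hk.2.1]
  rw [h1, h2, integral_fintype_prod_volume_eq_prod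
    (f := fun k (x : ℝ) => x ^ e k * Real.exp (-x ^ 2)),
    ← Finset.mul_prod_erase _ _ (Finset.mem_univ i),
    ← Finset.mul_prod_erase _ _ (Finset.mem_erase.2 ⟨hij.symm, Finset.mem_univ j⟩),
    Finset.prod_congr rfl (g := fun _ => ∫ x : ℝ, Real.exp (-x ^ 2)), Finset.prod_const]
  · simp only [he, hij.symm, if_true, if_false]
    rw [mul_assoc, Finset.card_erase_of_mem (Finset.mem_erase.2 ⟨hij.symm, Finset.mem_univ j⟩),
      Finset.card_erase_of_mem (Finset.mem_univ i)]
    simp [Nat.sub_sub]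
  · intro k hk
    simp only [Finset.mem_erase] at hk
    simp [he, hk.1, hk.2.1]

lemma integral_even_pow_mul_rpow (p : ℕ) {β : ℝ} (hβ : 0 < β) :
    ∫ t in (-1 : ℝ)..1, t ^ (2 * p) * (1 - t ^ 2) ^ (β - 1) =
      Real.Gamma (p + 1 / 2) * Real.Gamma β / Real.Gamma (p + 1 / 2 + β) := by
  have hp : (0 : ℝ) < p + 1 / 2 := by positivity
  have h1 : ∫ u in Set.Ioo (0 : ℝ) 1, u ^ ((p + 1 / 2 : ℝ) - 1) * (1 - u) ^ (β - 1) =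
      Real.Gamma (p + 1 / 2) * Real.Gamma β / Real.Gamma (p + 1 / 2 + β) := by
    have h := ProbabilityTheory.beta_eq_betaIntegralReal _ β hp hβ
    rw [ProbabilityTheory.beta] at h
    rw [h, Complex.betaIntegral, intervalIntegral.integral_of_le (by norm_num),
      ← MeasureTheory.integral_Ioc_eq_integral_Ioo, ← RCLike.re_to_complex, ← integral_re]
    · refine MeasureTheory.setIntegral_congr_fun measurableSet_Ioc fun x ⟨hx1, hx₂⟩ ↦ ?_
      norm_cast
      rw [← Complex.ofReal_cpow, ← Complex.ofReal_cpow, RCLike.re_to_complex,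
        Complex.re_mul_ofReal, Complex.ofReal_re]
      all_goals linarith
    convert! Complex.betaIntegral_convergent (u := (p + 1 / 2 : ℝ)) (v := β) (by simpa using hp)
      (by simpa)
    rw [intervalIntegrable_iff_integrableOn_Ioc_of_le (by simp), MeasureTheory.IntegrableOn]
  have him : (fun t : ℝ => t ^ 2) '' Set.Ioo (0 : ℝ) 1 = Set.Ioo 0 1 := by
    ext u
    constructor
    · rintro ⟨t, ht, rfl⟩
      exact ⟨pow_pos ht.1 2, pow_lt_one₀ ht.1.le ht.2 two_ne_zero⟩
    · intro hu
      exact ⟨√u, ⟨Real.sqrt_pos.2 hu.1, by rw [Real.sqrt_lt' one_pos]; simpa using hu.2⟩,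
        Real.sq_sqrt hu.1.le⟩
  have h2 : ∫ u in Set.Ioo (0 : ℝ) 1, u ^ ((p + 1 / 2 : ℝ) - 1) * (1 - u) ^ (β - 1) =
      2 * ∫ t in Set.Ioo (0 : ℝ) 1, t ^ (2 * p) * (1 - t ^ 2) ^ (β - 1) := by
    have h := MeasureTheory.integral_image_eq_integral_abs_deriv_smul
      (measurableSet_Ioo (a := (0 : ℝ)) (b := 1)) (f := fun t => t ^ 2) (f' := fun t => 2 * t)
      (fun x _ => by simpa using (hasDerivAt_pow 2 x).hasDerivWithinAt)
      (fun x hx y hy hxy => (pow_left_inj₀ hx.1.le hy.1.le two_ne_zero).1 hxy)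
      (fun u : ℝ => u ^ ((p + 1 / 2 : ℝ) - 1) * (1 - u) ^ (β - 1))
    rw [him] at h
    rw [h, ← MeasureTheory.integral_const_mul]
    refine MeasureTheory.setIntegral_congr_fun measurableSet_Ioo fun t ht => ?_
    have ht0 : 0 < t := ht.1
    have : (t ^ 2) ^ ((p + 1 / 2 : ℝ) - 1) * t = t ^ (2 * p) := by
      rw [← Real.rpow_natCast, ← Real.rpow_natCast, ← Real.rpow_mul ht0.le]
      nth_rewrite 2 [← Real.rpow_one t]
      rw [← Real.rpow_add ht0]
      congr 1
      push_cast
      ring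
    simp only [smul_eq_mul]
    rw [abs_of_pos (by positivity), ← this]
    ring
  rw [← h1, h2]
  have h3 := integral_comp_abs (f := fun t : ℝ => (Set.Ioo (-1 : ℝ) 1).indicator
    (fun t => t ^ (2 * p) * (1 - t ^ 2) ^ (β - 1)) t)
  have h4 : (fun t : ℝ => (Set.Ioo (-1 : ℝ) 1).indicator
      (fun t => t ^ (2 * p) * (1 - t ^ 2) ^ (β - 1)) |t|) = (Set.Ioo (-1 : ℝ) 1).indicator
      (fun t => t ^ (2 * p) * (1 - t ^ 2) ^ (β - 1)) := by
    ext t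
    have hm : |t| ∈ Set.Ioo (-1 : ℝ) 1 ↔ t ∈ Set.Ioo (-1 : ℝ) 1 := by
      rw [Set.mem_Ioo, Set.mem_Ioo, ← abs_lt, ← abs_lt, abs_abs]
    simp only [Set.indicator, hm, (even_two_mul p).pow_abs, even_two.pow_abs]
  rw [h4, MeasureTheory.integral_indicator measurableSet_Ioo,
    MeasureTheory.setIntegral_indicator measurableSet_Ioo] at h3
  rw [intervalIntegral.integral_of_le (by norm_num), MeasureTheory.integral_Ioc_eq_integral_Ioo,
    h3]
  congr 3
  ext t
  simp only [Set.mem_inter_iff, Set.mem_Ioi, Set.mem_Ioo]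
  exact ⟨fun h => ⟨h.1, h.2.2⟩, fun h => ⟨h.1, by linarith [h.1], h.2⟩⟩

lemma exists_orthonormalBasis_of_pair {n : ℕ} (hn : 2 ≤ n) {e f : EuclideanSpace ℝ (Fin n)}
    (he : ‖e‖ = 1) (hf : ‖f‖ = 1) (hef : ⟪e, f⟫ = 0) :
    ∃ (B : OrthonormalBasis (Fin n) ℝ (EuclideanSpace ℝ (Fin n))) (i j : Fin n),
      i ≠ j ∧ B i = e ∧ B j = f := by
  classical
  set i : Fin n := ⟨0, by omega⟩
  set j : Fin n := ⟨1, by omega⟩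
  have hij : i ≠ j := by simp [i, j]
  obtain ⟨B, hB⟩ := Orthonormal.exists_orthonormalBasis_extension_of_card_eq (𝕜 := ℝ)
    (E := EuclideanSpace ℝ (Fin n)) (ι := Fin n) (by simp)
    (v := fun k => if k = i then e else f) (s := {i, j}) (by
      rw [orthonormal_iff_ite]
      rintro ⟨k, hk⟩ ⟨l, hl⟩
      simp only [Set.mem_insert_iff, Set.mem_singleton_iff] at hk hl
      rcases hk with rfl | rfl <;> rcases hl with rfl | rfl <;>
        simp [Set.domRestrict, hij, hij.symm, he, hf, hef, real_inner_comm])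
  exact ⟨B, i, j, hij, by simpa using hB i (by simp), by simpa [hij.symm] using hB j (by simp)⟩

lemma sphMeasure_real_univ_pos {n : ℕ} (hn : 0 < n) : 0 < (sphMeasure n).real Set.univ := by
  have : Nonempty (Fin n) := ⟨⟨0, hn⟩⟩
  exact ENNReal.toReal_pos (by
    rw [Ne, MeasureTheory.Measure.measure_univ_eq_zero]
    exact MeasureTheory.Measure.toSphere_ne_zero _)
    (MeasureTheory.measure_ne_top _ _)

lemma integrable_sphMeasure {n : ℕ} {F : EuclideanSpace ℝ (Fin n) → ℝ}
    (hF : ContinuousOn F (Metric.sphere 0 1)) :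
    MeasureTheory.Integrable (fun η : Metric.sphere (0 : EuclideanSpace ℝ (Fin n)) 1 => F η)
      (sphMeasure n) :=
  (continuousOn_iff_continuous_domRestrict.1 hF).integrable_of_hasCompactSupport
    (HasCompactSupport.of_compactSpace _)

lemma sphMean_congr {n : ℕ} {F G : EuclideanSpace ℝ (Fin n) → ℝ}
    (h : ∀ η ∈ Metric.sphere (0 : EuclideanSpace ℝ (Fin n)) 1, F η = G η) :
    sphMean n F = sphMean n G := by
  unfold sphMean
  congr 1
  exact MeasureTheory.integral_congr_ae (.of_forall fun η => h η η.2)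

lemma sphMean_add {n : ℕ} {F G : EuclideanSpace ℝ (Fin n) → ℝ}
    (hF : ContinuousOn F (Metric.sphere 0 1)) (hG : ContinuousOn G (Metric.sphere 0 1)) :
    sphMean n (fun η => F η + G η) = sphMean n F + sphMean n G := by
  unfold sphMean
  rw [MeasureTheory.integral_add (integrable_sphMeasure hF) (integrable_sphMeasure hG), mul_add]

lemma sphMean_const_mul {n : ℕ} (c : ℝ) (F : EuclideanSpace ℝ (Fin n) → ℝ) :
    sphMean n (fun η => c * F η) = c * sphMean n F := by
  unfold sphMean
  rw [MeasureTheory.integral_const_mul, mul_left_comm]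

lemma sphMean_sub {n : ℕ} {F G : EuclideanSpace ℝ (Fin n) → ℝ}
    (hF : ContinuousOn F (Metric.sphere 0 1)) (hG : ContinuousOn G (Metric.sphere 0 1)) :
    sphMean n (fun η => F η - G η) = sphMean n F - sphMean n G := by
  unfold sphMean
  rw [MeasureTheory.integral_sub (integrable_sphMeasure hF) (integrable_sphMeasure hG), mul_sub]

lemma sphMean_sum {n : ℕ} {ι : Type*} (s : Finset ι) {F : ι → EuclideanSpace ℝ (Fin n) → ℝ}
    (hF : ∀ i ∈ s, ContinuousOn (F i) (Metric.sphere 0 1)) :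
    sphMean n (fun η => ∑ i ∈ s, F i η) = ∑ i ∈ s, sphMean n (F i) := by
  unfold sphMean
  rw [MeasureTheory.integral_finsetSum s fun i hi => integrable_sphMeasure (hF i hi),
    Finset.mul_sum]

lemma sphMean_const {n : ℕ} (hn : 0 < n) (c : ℝ) : sphMean n (fun _ => c) = c := by
  have := (sphMeasure_real_univ_pos hn).ne'
  unfold sphMean
  rw [MeasureTheory.integral_const, smul_eq_mul]
  field_simp

lemma sphMean_mono {n : ℕ} {F G : EuclideanSpace ℝ (Fin n) → ℝ}
    (hF : ContinuousOn F (Metric.sphere 0 1)) (hG : ContinuousOn G (Metric.sphere 0 1))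
    (h : ∀ η ∈ Metric.sphere (0 : EuclideanSpace ℝ (Fin n)) 1, F η ≤ G η) :
    sphMean n F ≤ sphMean n G :=
  mul_le_mul_of_nonneg_left (MeasureTheory.integral_mono (integrable_sphMeasure hF)
    (integrable_sphMeasure hG) fun η => h η η.2) (by positivity)

lemma abs_sphMean_le {n : ℕ} (F : EuclideanSpace ℝ (Fin n) → ℝ) :
    |sphMean n F| ≤ sphMean n (fun η => |F η|) := by
  unfold sphMean
  rw [abs_mul, abs_of_nonneg (by positivity : 0 ≤ ((sphMeasure n).real Set.univ)⁻¹)]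
  exact mul_le_mul_of_nonneg_left MeasureTheory.abs_integral_le_integral_abs (by positivity)

lemma abs_sphMean_le_of_le {n : ℕ} (hn : 0 < n) {F : EuclideanSpace ℝ (Fin n) → ℝ}
    (hF : ContinuousOn F (Metric.sphere 0 1)) {M : ℝ}
    (h : ∀ η ∈ Metric.sphere (0 : EuclideanSpace ℝ (Fin n)) 1, |F η| ≤ M) :
    |sphMean n F| ≤ M :=
  (abs_sphMean_le F).trans <| (sphMean_mono hF.abs continuousOn_const h).trans_eq
    (sphMean_const hn M)

lemma hasSum_sphMean {n : ℕ} {F : ℕ → EuclideanSpace ℝ (Fin n) → ℝ}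
    {G : EuclideanSpace ℝ (Fin n) → ℝ} {b : ℕ → ℝ}
    (hF : ∀ k, ContinuousOn (F k) (Metric.sphere 0 1)) (hb : Summable b)
    (hFb : ∀ k, ∀ η ∈ Metric.sphere (0 : EuclideanSpace ℝ (Fin n)) 1, |F k η| ≤ b k)
    (hFG : ∀ η ∈ Metric.sphere (0 : EuclideanSpace ℝ (Fin n)) 1,
      HasSum (fun k => F k η) (G η)) :
    HasSum (fun k => sphMean n (F k)) (sphMean n G) := by
  refine HasSum.mul_left _ ?_
  exact MeasureTheory.hasSum_integral_of_dominated_convergence (fun k _ => b k)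
    (fun k => (integrable_sphMeasure (hF k)).1) (fun k => .of_forall fun η => hFb k η η.2)
    (.of_forall fun _ => hb) (MeasureTheory.integrable_const _)
    (.of_forall fun η => hFG η η.2)

/-- The normalising constant in the formula for the moments of the sphere. -/
noncomputable def sphKappa (n q : ℕ) : ℝ :=
  Real.Gamma (q + 1 / 2) * Real.Gamma (n / 2) /
    (Real.Gamma (1 / 2) ^ 2 * Real.Gamma (q + ((n : ℝ) - 1) / 2))

lemma integral_inner_pow_sphMeasure {n : ℕ} {i j : Fin n} (hij : i ≠ j)
    (B : OrthonormalBasis (Fin n) ℝ (EuclideanSpace ℝ (Fin n))) (a b : ℕ) :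
    (∫ η, ⟪B i, η⟫ ^ a * ⟪B j, η⟫ ^ b ∂(sphMeasure n)) *
        (1 / 2 * Real.Gamma ((n + a + b : ℝ) / 2)) =
      (∫ x : ℝ, x ^ a * Real.exp (-x ^ 2)) * (∫ x : ℝ, x ^ b * Real.exp (-x ^ 2)) *
        (∫ x : ℝ, Real.exp (-x ^ 2)) ^ (n - 2) := by
  have hn : 0 < n := i.pos
  have h := integral_homogeneous_mul_norm hn (a + b) (fun y => ⟪B i, y⟫ ^ a * ⟪B j, y⟫ ^ b)
    (fun r _ y => by simp only [inner_smul_right]; ring) (fun t => Real.exp (-t ^ 2))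
  rw [integral_inner_pow_mul_exp hij] at h
  rw [h]
  congr 1
  have h2 := integral_Ioi_pow_mul_exp_neg_sq (n - 1 + (a + b))
  simp only [pow_add, mul_assoc] at h2 ⊢
  rw [h2]
  congr 3
  push_cast [Nat.cast_sub hn]
  ring

lemma sphMean_moment_odd {n : ℕ} (hn : 2 ≤ n) {e f : EuclideanSpace ℝ (Fin n)}
    (he : ‖e‖ = 1) (hf : ‖f‖ = 1) (hef : ⟪e, f⟫ = 0) (a : ℕ) {b : ℕ} (hb : Odd b) :
    sphMean n (fun η => ⟪e, η⟫ ^ a * ⟪f, η⟫ ^ b) = 0 := by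
  obtain ⟨B, i, j, hij, rfl, rfl⟩ := exists_orthonormalBasis_of_pair hn he hf hef
  have h := integral_inner_pow_sphMeasure hij B a b
  rw [integral_odd_pow_mul hb (fun x => by simp)] at h
  have hG : 0 < Real.Gamma ((n + a + b : ℝ) / 2) := Real.Gamma_pos_of_pos (by positivity)
  simp only [mul_zero, zero_mul, mul_eq_zero, one_div, inv_eq_zero, OfNat.ofNat_ne_zero,
    hG.ne', or_false] at h
  simp [sphMean, h]

lemma sphMean_moment_even {n : ℕ} (hn : 2 ≤ n) {e f : EuclideanSpace ℝ (Fin n)}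
    (he : ‖e‖ = 1) (hf : ‖f‖ = 1) (hef : ⟪e, f⟫ = 0) (a q : ℕ) :
    sphMean n (fun η => ⟪e, η⟫ ^ a * ⟪f, η⟫ ^ (2 * q)) =
      sphKappa n q * ∫ t in (-1 : ℝ)..1, t ^ a * ((1 - t ^ 2) ^ q *
        gegenWeight (((n : ℝ) - 2) / 2) t) := by
  have hn' : (2 : ℝ) ≤ n := by exact_mod_cast hn
  have hw : ∫ t in (-1 : ℝ)..1, t ^ a * ((1 - t ^ 2) ^ q * gegenWeight (((n : ℝ) - 2) / 2) t) =
      ∫ t in (-1 : ℝ)..1, t ^ a * (1 - t ^ 2) ^ ((q + ((n : ℝ) - 1) / 2) - 1) := by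
    rw [intervalIntegral.integral_of_le (by norm_num), intervalIntegral.integral_of_le
      (by norm_num), MeasureTheory.integral_Ioc_eq_integral_Ioo,
      MeasureTheory.integral_Ioc_eq_integral_Ioo]
    refine MeasureTheory.setIntegral_congr_fun measurableSet_Ioo fun t ht => ?_
    have : 0 < 1 - t ^ 2 := by nlinarith [ht.1, ht.2]
    simp only [gegenWeight]
    rw [← Real.rpow_natCast (1 - t ^ 2) q, ← Real.rpow_add this]
    congr 2
    ring
  rw [hw]
  rcases Nat.even_or_odd' a with ⟨p, rfl | rfl⟩
  · obtain ⟨B, i, j, hij, rfl, rfl⟩ := exists_orthonormalBasis_of_pair hn he hf hef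
    have h := integral_inner_pow_sphMeasure hij B (2 * p) (2 * q)
    have h0 := integral_inner_pow_sphMeasure hij B (2 * 0) (2 * 0)
    have hg : ∫ x : ℝ, Real.exp (-x ^ 2) = Real.Gamma (1 / 2) := by
      simpa using integral_even_pow_mul_exp_neg_sq 0
    simp only [integral_even_pow_mul_exp_neg_sq, hg] at h h0
    rw [integral_even_pow_mul_rpow p (by
      have : (0 : ℝ) ≤ q := by positivity
      linarith)]
    simp only [mul_zero, pow_zero, mul_one, MeasureTheory.integral_const, smul_eq_mul,
      Nat.cast_zero, add_zero, zero_add] at h0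
    have hG : 0 < Real.Gamma ((n : ℝ) / 2) := Real.Gamma_pos_of_pos (by positivity)
    have hG1 : 0 < Real.Gamma (1 / 2) := Real.Gamma_pos_of_pos (by positivity)
    have hG2 : 0 < Real.Gamma (q + ((n : ℝ) - 1) / 2) := Real.Gamma_pos_of_pos (by
      have : (0 : ℝ) ≤ q := by positivity
      linarith)
    have e1 : ((n : ℝ) + (2 * p : ℕ) + (2 * q : ℕ)) / 2 = n / 2 + p + q := by
      push_cast; ring
    have e2 : (p : ℝ) + 1 / 2 + (q + ((n : ℝ) - 1) / 2) = n / 2 + p + q := by ring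
    rw [e1] at h
    rw [e2]
    have hG3 : 0 < Real.Gamma ((n : ℝ) / 2 + p + q) := Real.Gamma_pos_of_pos (by positivity)
    have hs := sphMeasure_real_univ_pos (n := n) (by omega)
    unfold sphMean sphKappa
    rw [eq_div_of_mul_eq (by positivity) h, eq_div_of_mul_eq (by positivity) h0]
    generalize Real.Gamma (q + ((n : ℝ) - 1) / 2) = G at hG2
    field_simp
  · have hz : ∫ t in (-1 : ℝ)..1, t ^ (2 * p + 1) *
        (1 - t ^ 2) ^ ((q + ((n : ℝ) - 1) / 2) - 1) = 0 := by
      have h := intervalIntegral.integral_comp_neg (a := -1) (b := 1) (fun t : ℝ => t ^ (2 * p + 1) *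
        (1 - t ^ 2) ^ ((q + ((n : ℝ) - 1) / 2) - 1))
      simp only [Odd.neg_pow ⟨p, rfl⟩, neg_sq, neg_mul, intervalIntegral.integral_neg, neg_neg] at h
      linarith
    rw [hz, mul_zero]
    have h := sphMean_moment_odd hn hf he (by rwa [real_inner_comm]) (2 * q)
      (b := 2 * p + 1) ⟨p, rfl⟩
    simpa only [mul_comm] using h

lemma sphKappa_zero {n : ℕ} :
    sphKappa n 0 = Real.Gamma (n / 2) / (Real.Gamma (1 / 2) * Real.Gamma (((n : ℝ) - 1) / 2)) := by
  have hG1 : 0 < Real.Gamma (1 / 2) := Real.Gamma_pos_of_pos (by positivity)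
  simp only [sphKappa, Nat.cast_zero, zero_add]
  rw [pow_two, mul_assoc, mul_div_mul_left _ _ hG1.ne']

lemma exists_norm_one_inner_eq_zero {n : ℕ} (hn : 2 ≤ n) {e : EuclideanSpace ℝ (Fin n)}
    (he : ‖e‖ = 1) : ∃ f : EuclideanSpace ℝ (Fin n), ‖f‖ = 1 ∧ ⟪e, f⟫ = 0 := by
  classical
  set i : Fin n := ⟨0, by omega⟩
  set j : Fin n := ⟨1, by omega⟩
  have hij : i ≠ j := by simp [i, j]
  obtain ⟨B, hB⟩ := Orthonormal.exists_orthonormalBasis_extension_of_card_eq (𝕜 := ℝ)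
    (E := EuclideanSpace ℝ (Fin n)) (ι := Fin n) (by simp)
    (v := fun _ => e) (s := {i}) (by
      rw [orthonormal_iff_ite]
      rintro ⟨k, hk⟩ ⟨l, hl⟩
      simp only [Set.mem_singleton_iff] at hk hl
      subst hk hl
      simp [Set.domRestrict, he])
  refine ⟨B j, B.orthonormal.1 j, ?_⟩
  rw [← hB i rfl]
  exact B.orthonormal.2 hij

lemma inner_mem_Icc_of_mem_sphere {n : ℕ} {e η : EuclideanSpace ℝ (Fin n)} (he : ‖e‖ = 1)
    (hη : η ∈ Metric.sphere (0 : EuclideanSpace ℝ (Fin n)) 1) : ⟪e, η⟫ ∈ Set.Icc (-1 : ℝ) 1 := by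
  have h := abs_real_inner_le_norm e η
  rw [he, mem_sphere_zero_iff_norm.1 hη, one_mul] at h
  exact abs_le.1 h

lemma continuousOn_comp_inner {n : ℕ} {e : EuclideanSpace ℝ (Fin n)} (he : ‖e‖ = 1) {g : ℝ → ℝ}
    (hg : ContinuousOn g (Set.Icc (-1) 1)) :
    ContinuousOn (fun η : EuclideanSpace ℝ (Fin n) => g ⟪e, η⟫) (Metric.sphere 0 1) :=
  hg.comp (by fun_prop) fun _ hη => inner_mem_Icc_of_mem_sphere he hη

lemma sphMean_comp_inner_mul {n : ℕ} (hn : 0 < n) {e : EuclideanSpace ℝ (Fin n)} (he : ‖e‖ = 1)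
    {K : EuclideanSpace ℝ (Fin n) → ℝ} {k : ℝ → ℝ} (hK : ContinuousOn K (Metric.sphere 0 1))
    (hk : ContinuousOn k (Set.Icc (-1) 1))
    (h : ∀ m : ℕ, sphMean n (fun η => ⟪e, η⟫ ^ m * K η) = ∫ t in (-1 : ℝ)..1, t ^ m * k t)
    {g : ℝ → ℝ} (hg : ContinuousOn g (Set.Icc (-1) 1)) :
    sphMean n (fun η => g ⟪e, η⟫ * K η) = ∫ t in (-1 : ℝ)..1, g t * k t := by
  have hu : Set.uIcc (-1 : ℝ) 1 = Set.Icc (-1) 1 := Set.uIcc_of_le (by norm_num)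
  obtain ⟨M, hM⟩ := (isCompact_sphere (0 : EuclideanSpace ℝ (Fin n)) 1).exists_bound_of_continuousOn
    hK
  obtain ⟨M', hM'⟩ := isCompact_Icc.exists_bound_of_continuousOn hk
  have hpoly : ∀ p : Polynomial ℝ, sphMean n (fun η => p.eval ⟪e, η⟫ * K η) =
      ∫ t in (-1 : ℝ)..1, p.eval t * k t := by
    intro p
    simp only [Polynomial.eval_eq_sum_range, Finset.sum_mul, mul_assoc]
    rw [sphMean_sum _ (fun i _ => by fun_prop), intervalIntegral.integral_finsetSum]
    · refine Finset.sum_congr rfl fun i _ => ?_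
      rw [sphMean_const_mul, h, intervalIntegral.integral_const_mul]
    · intro i _
      apply ContinuousOn.intervalIntegrable
      rw [hu]
      fun_prop
  have hM0 : 0 ≤ M' := (norm_nonneg _).trans (hM' 0 (by norm_num))
  refine eq_of_forall_dist_le fun ε hε => ?_
  rw [Real.dist_eq]
  set δ := ε / (|M| + 2 * M' + 1) with hδ
  have hδ0 : 0 < δ := by positivity
  obtain ⟨p, hp⟩ := exists_polynomial_near_of_continuousOn (-1) 1 g hg δ hδ0
  have hgK : ContinuousOn (fun η : EuclideanSpace ℝ (Fin n) => g ⟪e, η⟫) (Metric.sphere 0 1) :=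
    continuousOn_comp_inner he hg
  have h1 : |sphMean n (fun η => g ⟪e, η⟫ * K η) - sphMean n (fun η => p.eval ⟪e, η⟫ * K η)|
      ≤ δ * |M| := by
    have hpc : ContinuousOn (fun η : EuclideanSpace ℝ (Fin n) => p.eval ⟪e, η⟫)
        (Metric.sphere 0 1) := continuousOn_comp_inner he p.continuousOn
    have hgK' : ContinuousOn (fun η : EuclideanSpace ℝ (Fin n) => g ⟪e, η⟫ * K η)
        (Metric.sphere 0 1) := hgK.mul hK
    have hpc' : ContinuousOn (fun η : EuclideanSpace ℝ (Fin n) => p.eval ⟪e, η⟫ * K η)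
        (Metric.sphere 0 1) := hpc.mul hK
    rw [← sphMean_sub hgK' hpc']
    refine abs_sphMean_le_of_le hn (hgK'.sub hpc') fun η hη => ?_
    rw [Pi.sub_apply, ← sub_mul, abs_mul, abs_sub_comm]
    exact mul_le_mul (hp _ (inner_mem_Icc_of_mem_sphere he hη)).le
      ((hM η hη).trans (le_abs_self M)) (abs_nonneg _) hδ0.le
  have h2 : |(∫ t in (-1 : ℝ)..1, g t * k t) - ∫ t in (-1 : ℝ)..1, p.eval t * k t|
      ≤ δ * M' * |1 - (-1)| := by
    rw [← intervalIntegral.integral_sub]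
    · rw [← Real.norm_eq_abs]
      refine intervalIntegral.norm_integral_le_of_norm_le_const fun t ht => ?_
      rw [Set.uIoc_of_le (by norm_num)] at ht
      have ht' := Set.Ioc_subset_Icc_self ht
      rw [Real.norm_eq_abs, ← sub_mul, abs_mul, abs_sub_comm]
      exact mul_le_mul (hp _ ht').le (hM' t ht') (abs_nonneg _) hδ0.le
    · apply ContinuousOn.intervalIntegrable
      rw [hu]
      fun_prop
    · apply ContinuousOn.intervalIntegrable
      rw [hu]
      exact p.continuousOn.mul hk
  rw [hpoly] at h1
  rw [show |(1 : ℝ) - (-1)| = 2 by norm_num] at h2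
  have h3 : δ * (|M| + 2 * M' + 1) = ε := by rw [hδ]; field_simp
  rw [abs_le] at h1 h2 ⊢
  constructor <;> nlinarith

/-- The polynomial `k` for which `sphMean n (g ⟪e, ·⟫ * P ⟪c e + s f, ·⟫) = ∫ g k w`. -/
noncomputable def sphKernel (n : ℕ) (c s : ℝ) (P : Polynomial ℝ) : Polynomial ℝ :=
  ∑ b ∈ Finset.range (P.natDegree + 1), if Even b then
    Polynomial.C (s ^ b * sphKappa n (b / 2)) *
      ((Polynomial.hasseDeriv b P).comp (Polynomial.C c * Polynomial.X) *
        (1 - Polynomial.X ^ 2) ^ (b / 2)) else 0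

lemma natDegree_sphKernel_le (n : ℕ) (c s : ℝ) (P : Polynomial ℝ) :
    (sphKernel n c s P).natDegree ≤ P.natDegree := by
  refine Polynomial.natDegree_sum_le_of_forall_le _ _ fun b hb => ?_
  split_ifs with h
  · obtain ⟨q, rfl⟩ := even_iff_exists_two_mul.1 h
    have hb' : 2 * q ≤ P.natDegree := by simpa using Finset.mem_range_succ_iff.1 hb
    refine (Polynomial.natDegree_C_mul_le _ _).trans (Polynomial.natDegree_mul_le.trans ?_)
    have h1 : ((Polynomial.hasseDeriv (2 * q) P).comp
        (Polynomial.C c * Polynomial.X)).natDegree ≤ P.natDegree - 2 * q := by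
      refine Polynomial.natDegree_comp_le.trans ?_
      have h2 := Polynomial.natDegree_hasseDeriv_le P (2 * q)
      have h3 : (Polynomial.C c * Polynomial.X : Polynomial ℝ).natDegree ≤ 1 :=
        by compute_degree
      calc _ ≤ (P.natDegree - 2 * q) * 1 := Nat.mul_le_mul h2 h3
        _ = _ := mul_one _
    have h4 : ((1 - Polynomial.X ^ 2 : Polynomial ℝ) ^ (2 * q / 2)).natDegree ≤ 2 * q := by
      rw [Nat.mul_div_cancel_left _ two_pos]
      refine Polynomial.natDegree_pow_le.trans ?_
      have : (1 - Polynomial.X ^ 2 : Polynomial ℝ).natDegree ≤ 2 := by compute_degree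
      nlinarith
    omega
  · simp

lemma eval_one_sphKernel (n : ℕ) (c s : ℝ) (P : Polynomial ℝ) :
    (sphKernel n c s P).eval 1 = sphKappa n 0 * P.eval c := by
  rw [sphKernel, Polynomial.eval_finsetSum, Finset.sum_eq_single 0]
  · simp
  · intro b _ hb
    split_ifs with h
    · obtain ⟨q, rfl⟩ := even_iff_exists_two_mul.1 h
      have : q ≠ 0 := by rintro rfl; simp at hb
      simp [this]
    · simp
  · simp

lemma sphMean_comp_inner_mul_polynomial {n : ℕ} (hn : 3 ≤ n) {e f : EuclideanSpace ℝ (Fin n)}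
    (he : ‖e‖ = 1) (hf : ‖f‖ = 1) (hef : ⟪e, f⟫ = 0) (c s : ℝ) (P : Polynomial ℝ) {g : ℝ → ℝ}
    (hg : ContinuousOn g (Set.Icc (-1) 1)) :
    sphMean n (fun η => g ⟪e, η⟫ * P.eval ⟪c • e + s • f, η⟫) =
      ∫ t in (-1 : ℝ)..1, g t * ((sphKernel n c s P).eval t *
        gegenWeight (((n : ℝ) - 2) / 2) t) := by
  have hn' : (3 : ℝ) ≤ n := by exact_mod_cast hn
  have hw : Continuous (gegenWeight (((n : ℝ) - 2) / 2)) := continuous_gegenWeight (by linarith)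
  refine sphMean_comp_inner_mul (by omega) he (by fun_prop) (by fun_prop) (fun m => ?_) hg
  have hexp : ∀ η : EuclideanSpace ℝ (Fin n), ⟪e, η⟫ ^ m * P.eval ⟪c • e + s • f, η⟫ =
      ∑ b ∈ Finset.range (P.natDegree + 1),
        s ^ b * ((⟪e, η⟫ ^ m * (Polynomial.hasseDeriv b P).eval (c * ⟪e, η⟫)) * ⟪f, η⟫ ^ b) := by
    intro η
    rw [inner_add_left, inner_smul_left, inner_smul_left]
    simp only [conj_trivial]
    rw [add_comm, ← Polynomial.taylor_eval, Polynomial.eval_eq_sum_range,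
      Polynomial.natDegree_taylor, Finset.mul_sum]
    refine Finset.sum_congr rfl fun b _ => ?_
    rw [Polynomial.taylor_coeff, mul_pow]
    ring
  simp only [hexp]
  rw [sphMean_sum _ (fun i _ => by fun_prop)]
  simp only [sphKernel, Polynomial.eval_finsetSum, Finset.sum_mul, Finset.mul_sum]
  rw [intervalIntegral.integral_finsetSum (fun b _ => Continuous.intervalIntegrable (by fun_prop) _ _)]
  refine Finset.sum_congr rfl fun b _ => ?_
  rw [sphMean_const_mul]
  split_ifs with h
  · obtain ⟨q, rfl⟩ := even_iff_exists_two_mul.1 h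
    rw [Nat.mul_div_cancel_left _ two_pos]
    have h1 := sphMean_comp_inner_mul (n := n) (by omega) he (K := fun η => ⟪f, η⟫ ^ (2 * q))
      (k := fun t => sphKappa n q * ((1 - t ^ 2) ^ q * gegenWeight (((n : ℝ) - 2) / 2) t))
      (by fun_prop) (by fun_prop) (fun m => by
        rw [sphMean_moment_even (by omega) he hf hef, ← intervalIntegral.integral_const_mul]
        congr 1
        ext t
        ring)
      (g := fun t => t ^ m * (Polynomial.hasseDeriv (2 * q) P).eval (c * t)) (by fun_prop)
    rw [h1, ← intervalIntegral.integral_const_mul]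
    congr 1
    ext t
    simp only [Polynomial.eval_mul, Polynomial.eval_C, Polynomial.eval_comp, Polynomial.eval_X,
      Polynomial.eval_pow, Polynomial.eval_sub, Polynomial.eval_one]
    ring
  · have h1 := sphMean_comp_inner_mul (n := n) (by omega) he (K := fun η => ⟪f, η⟫ ^ b)
      (k := fun t => 0) (by fun_prop) (by fun_prop) (fun m => by
        rw [sphMean_moment_odd (by omega) he hf hef _ (Nat.not_even_iff_odd.1 h)]
        simp)
      (g := fun t => t ^ m * (Polynomial.hasseDeriv b P).eval (c * t)) (by fun_prop)
    rw [h1]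
    simp

lemma sphMean_comp_inner {n : ℕ} (hn : 3 ≤ n) {e : EuclideanSpace ℝ (Fin n)}
    (he : ‖e‖ = 1) {g : ℝ → ℝ} (hg : ContinuousOn g (Set.Icc (-1) 1)) :
    sphMean n (fun η => g ⟪e, η⟫) =
      sphKappa n 0 * ∫ t in (-1 : ℝ)..1, g t * gegenWeight (((n : ℝ) - 2) / 2) t := by
  obtain ⟨f, hf, hef⟩ := exists_norm_one_inner_eq_zero (by omega) he
  have h := sphMean_comp_inner_mul_polynomial hn he hf hef 1 0 1 hg
  rw [← intervalIntegral.integral_const_mul]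
  simp only [Polynomial.eval_one, mul_one] at h
  rw [h]
  simp only [sphKernel, Polynomial.natDegree_one, zero_add, Finset.range_one,
    Finset.sum_singleton, if_pos Even.zero]
  congr 1
  ext t
  simp
  ring

/-- The Funk–Hecke formula, for Gegenbauer polynomials as zonal harmonics. -/
lemma sphMean_comp_inner_mul_gegen {n : ℕ} (hn : 3 ≤ n) {e f : EuclideanSpace ℝ (Fin n)}
    (he : ‖e‖ = 1) (hf : ‖f‖ = 1) (hef : ⟪e, f⟫ = 0) {c s : ℝ} (hcs : c ^ 2 + s ^ 2 = 1) (k : ℕ)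
    {g : ℝ → ℝ} (hg : ContinuousOn g (Set.Icc (-1) 1)) :
    sphMean n (fun η => g ⟪e, η⟫ * gegen (((n : ℝ) - 2) / 2) k ⟪c • e + s • f, η⟫) =
      sphKappa n 0 * (gegen (((n : ℝ) - 2) / 2) k c / gegen (((n : ℝ) - 2) / 2) k 1) *
      ∫ t in (-1 : ℝ)..1, g t * (gegen (((n : ℝ) - 2) / 2) k t *
        gegenWeight (((n : ℝ) - 2) / 2) t) := by
  have hn' : (3 : ℝ) ≤ n := by exact_mod_cast hn
  set μ := ((n : ℝ) - 2) / 2 with hμ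
  have hμ' : 1 / 2 ≤ μ := by rw [hμ]; linarith
  have hμ0 : 0 < μ := by linarith
  have hw : Continuous (gegenWeight μ) := continuous_gegenWeight hμ'
  set G := gegenPoly μ k with hG
  set K := sphKernel n c s G with hK
  have hlead : 0 < G.coeff k := coeff_gegenPoly_self_pos hμ0 k
  have hdG : G.natDegree ≤ k := natDegree_gegenPoly_le μ k
  have hdK : K.natDegree ≤ k := (natDegree_sphKernel_le n c s G).trans hdG
  have key := fun {g : ℝ → ℝ} (hg : ContinuousOn g (Set.Icc (-1) 1)) =>
    sphMean_comp_inner_mul_polynomial hn he hf hef c s G hg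
  have horth : ∀ p : Polynomial ℝ, p.natDegree < k →
      ∫ t in (-1 : ℝ)..1, p.eval t * (K.eval t * gegenWeight μ t) = 0 := by
    intro p hp
    rw [← key p.continuousOn]
    have he' : ‖c • e + s • f‖ = 1 := by
      rw [← sq_eq_sq₀ (norm_nonneg _) zero_le_one, norm_add_sq_real, norm_smul, norm_smul,
        inner_smul_left, inner_smul_right, hef, he, hf]
      simpa using hcs
    have hf' : ‖s • e + (-c) • f‖ = 1 := by
      rw [← sq_eq_sq₀ (norm_nonneg _) zero_le_one, norm_add_sq_real, norm_smul, norm_smul,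
        inner_smul_left, inner_smul_right, hef, he, hf]
      simpa [add_comm] using hcs
    have hef' : ⟪c • e + s • f, s • e + (-c) • f⟫ = 0 := by
      simp only [inner_add_left, inner_add_right, inner_smul_left, inner_smul_right, hef,
        real_inner_comm e f ▸ hef, real_inner_self_eq_norm_sq, he, hf, conj_trivial]
      ring
    have h := sphMean_comp_inner_mul_polynomial hn he' hf' hef' c s p (g := G.eval) G.continuousOn
    have hT : c • (c • e + s • f) + s • (s • e + (-c) • f) = e := by
      calc _ = (c ^ 2 + s ^ 2) • e := by module
        _ = e := by rw [hcs, one_smul]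
    rw [hT] at h
    have h0 := integral_mul_gegen_eq_zero hμ' ((natDegree_sphKernel_le n c s p).trans_lt hp)
    simp only [mul_comm (p.eval _)]
    rw [h, ← h0]
    congr 1
    ext t
    rw [hG, eval_gegenPoly]
    ring
  have hKG : K = Polynomial.C (K.coeff k / G.coeff k) * G := by
    set q := K - Polynomial.C (K.coeff k / G.coeff k) * G with hq
    have hqk : q.coeff k = 0 := by
      rw [hq, Polynomial.coeff_sub, Polynomial.coeff_C_mul]
      field_simp
      ring
    have hqd : q.natDegree ≤ k := (Polynomial.natDegree_sub_le _ _).trans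
      (max_le hdK ((Polynomial.natDegree_C_mul_le _ _).trans hdG))
    rw [← sub_eq_zero, ← hq]
    by_contra hq0
    have hqlt : q.natDegree < k := lt_of_le_of_ne hqd fun h => hq0 <| by
      rw [← Polynomial.leadingCoeff_eq_zero, Polynomial.leadingCoeff, h, hqk]
    refine hq0 (eq_zero_of_integral_sq_gegenWeight hμ' ?_)
    have h1 := horth q hqlt
    have h2 := integral_mul_gegen_eq_zero hμ' hqlt
    have h3 : ∀ t, q.eval t * q.eval t * gegenWeight μ t =
        q.eval t * (K.eval t * gegenWeight μ t) -
          (K.coeff k / G.coeff k) * (q.eval t * gegen μ k t * gegenWeight μ t) := by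
      intro t
      nth_rewrite 2 [hq]
      rw [Polynomial.eval_sub, Polynomial.eval_mul, Polynomial.eval_C, hG, eval_gegenPoly]
      ring
    have hgc : Continuous (gegen μ k) := continuous_gegen μ k
    simp only [h3]
    rw [intervalIntegral.integral_sub (Continuous.intervalIntegrable (by fun_prop) _ _)
      (Continuous.intervalIntegrable (by fun_prop) _ _), h1, intervalIntegral.integral_const_mul,
      h2]
    simp
  have h1 : K.eval 1 = sphKappa n 0 * gegen μ k c := by
    rw [hK, eval_one_sphKernel, hG, eval_gegenPoly]
  have hG1 : gegen μ k 1 ≠ 0 := by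
    rw [gegen_one_right hμ0]
    have := poch_pos (μ := 2 * μ) (by positivity) k
    positivity
  have hh : K.coeff k / G.coeff k = sphKappa n 0 * (gegen μ k c / gegen μ k 1) := by
    rw [hKG, Polynomial.eval_mul, Polynomial.eval_C, hG, eval_gegenPoly, ← hG] at h1
    rw [← mul_div_assoc, eq_div_iff hG1, ← h1]
  have hfin := key hg
  simp only [hG, eval_gegenPoly] at hfin
  rw [hfin, ← hG, ← hK, hKG, hh, ← intervalIntegral.integral_const_mul]
  congr 1
  ext t
  rw [Polynomial.eval_mul, Polynomial.eval_C, hG, eval_gegenPoly]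
  ring

lemma hasSum_of_forall_ne {f : ℕ → ℝ} {a : ℝ} (b : ℕ) (h : f b = a) (h' : ∀ k ≠ b, f k = 0) :
    HasSum f a :=
  h ▸ hasSum_single b h'

lemma norm_sub_smul_sq {n : ℕ} {e η : EuclideanSpace ℝ (Fin n)} (he : ‖e‖ = 1)
    (hη : η ∈ Metric.sphere (0 : EuclideanSpace ℝ (Fin n)) 1) (r : ℝ) :
    ‖η - r • e‖ ^ 2 = 1 - 2 * ⟪e, η⟫ * r + r ^ 2 := by
  rw [norm_sub_sq_real, norm_smul, he, mem_sphere_zero_iff_norm.1 hη, inner_smul_right,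
    real_inner_comm, mul_one, Real.norm_eq_abs, sq_abs]
  ring

lemma hasSum_sphMean_mul_gegen {n : ℕ} (hn : 3 ≤ n) {e : EuclideanSpace ℝ (Fin n)}
    (he : ‖e‖ = 1) {r : ℝ} (hr : |r| < 1) {h : EuclideanSpace ℝ (Fin n) → ℝ}
    (hh : ContinuousOn h (Metric.sphere 0 1)) :
    HasSum (fun k => sphMean n (fun η => h η * gegen (((n : ℝ) - 2) / 2) k ⟪e, η⟫) * r ^ k)
      (sphMean n fun η => h η * (‖η - r • e‖ ^ 2) ^ (-(((n : ℝ) - 2) / 2))) := by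
  have hn' : (3 : ℝ) ≤ n := by exact_mod_cast hn
  have hμ0 : 0 < ((n : ℝ) - 2) / 2 := by linarith
  obtain ⟨b, hb, hb'⟩ := exists_summable_bound_gegen hμ0 hr
  obtain ⟨M, hM⟩ := (isCompact_sphere (0 : EuclideanSpace ℝ (Fin n)) 1).exists_bound_of_continuousOn
    hh
  have hc : ∀ k, Continuous (gegen (((n : ℝ) - 2) / 2) k) := continuous_gegen _
  have hs := hasSum_sphMean (n := n)
    (F := fun k η => r ^ k * (h η * gegen (((n : ℝ) - 2) / 2) k ⟪e, η⟫))
    (G := fun η => h η * (‖η - r • e‖ ^ 2) ^ (-(((n : ℝ) - 2) / 2))) (b := fun k => M * b k)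
    (fun k => by have := hc k; fun_prop) (hb.mul_left M) (fun k η hη => by
      have h1 := hb' ⟪e, η⟫ (abs_le.2 (inner_mem_Icc_of_mem_sphere he hη)) k
      rw [mul_left_comm, abs_mul, mul_comm (r ^ k)]
      exact mul_le_mul (hM η hη) h1 (abs_nonneg _) ((norm_nonneg _).trans (hM η hη)))
    (fun η hη => by
      have h1 := hasSum_gegen (((n : ℝ) - 2) / 2)
        (abs_le.2 (inner_mem_Icc_of_mem_sphere he hη)) hr
      rw [norm_sub_smul_sq he hη]
      convert! h1.mul_left (h η) using 2
      ring)
  simp only [sphMean_const_mul] at hs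
  simpa only [mul_comm (r ^ _)] using hs

lemma sphKappa_zero_mul_integral {n : ℕ} (hn : 3 ≤ n) :
    sphKappa n 0 * ∫ t in (-1 : ℝ)..1, gegenWeight (((n : ℝ) - 2) / 2) t = 1 := by
  have h := sphMean_comp_inner hn (e := EuclideanSpace.single (⟨0, by omega⟩ : Fin n) 1) (by simp)
    (g := fun _ => 1) continuousOn_const
  rw [sphMean_const (by omega)] at h
  simpa using h.symm

lemma exists_smul_eq_of_norm {n : ℕ} (hn : 0 < n) (w : EuclideanSpace ℝ (Fin n)) :
    ∃ e : EuclideanSpace ℝ (Fin n), ‖e‖ = 1 ∧ w = ‖w‖ • e := by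
  rcases eq_or_ne w 0 with rfl | hw
  · exact ⟨EuclideanSpace.single ⟨0, hn⟩ 1, by simp, by simp⟩
  · refine ⟨‖w‖⁻¹ • w, norm_smul_inv_norm (𝕜 := ℝ) hw, ?_⟩
    rw [smul_smul, mul_inv_cancel₀ (norm_ne_zero_iff.2 hw), one_smul]

lemma sphMean_norm_sub_rpow {n : ℕ} (hn : 3 ≤ n) {w : EuclideanSpace ℝ (Fin n)} (hw : ‖w‖ < 1) :
    sphMean n (fun η => (‖η - w‖ ^ 2) ^ (-(((n : ℝ) - 2) / 2))) = 1 := by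
  have hn' : (3 : ℝ) ≤ n := by exact_mod_cast hn
  obtain ⟨e, he, hwe⟩ := exists_smul_eq_of_norm (by omega) w
  have h := hasSum_sphMean_mul_gegen hn he (r := ‖w‖) (by simpa using hw) (h := fun _ => 1)
    continuousOn_const
  rw [← hwe] at h
  simp only [one_mul] at h
  refine h.unique ?_
  refine hasSum_of_forall_ne 0 ?_ ?_
  · simp [← eval_gegenPoly, gegenPoly_zero, sphMean_const (show 0 < n by omega)]
  · intro k hk
    have h0 := integral_mul_gegen_eq_zero (μ := ((n : ℝ) - 2) / 2) (by linarith) (k := k) (p := 1)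
      (by simpa using Nat.pos_of_ne_zero hk)
    rw [sphMean_comp_inner hn he (continuous_gegen _ k).continuousOn]
    simp only [Polynomial.eval_one, one_mul] at h0
    rw [h0]
    simp

lemma sphMean_inner_mul_comp_inner {n : ℕ} (hn : 3 ≤ n) {e ℓ : EuclideanSpace ℝ (Fin n)}
    (he : ‖e‖ = 1) {g : ℝ → ℝ} (hg : ContinuousOn g (Set.Icc (-1) 1)) :
    sphMean n (fun η => ⟪η, ℓ⟫ * g ⟪e, η⟫) =
      ⟪e, ℓ⟫ * (sphKappa n 0 * ∫ t in (-1 : ℝ)..1, t * g t * gegenWeight (((n : ℝ) - 2) / 2) t) := by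
  have hgc := continuousOn_comp_inner he hg
  obtain ⟨f, hf, hef, hℓ⟩ : ∃ f : EuclideanSpace ℝ (Fin n), ‖f‖ = 1 ∧ ⟪e, f⟫ = 0 ∧
      ∃ d : ℝ, ℓ = ⟪e, ℓ⟫ • e + d • f := by
    by_cases h : ℓ - ⟪e, ℓ⟫ • e = 0
    · obtain ⟨f, hf, hef⟩ := exists_norm_one_inner_eq_zero (by omega) he
      exact ⟨f, hf, hef, 0, by rw [zero_smul, add_zero, ← sub_eq_zero, h]⟩
    · refine ⟨‖ℓ - ⟪e, ℓ⟫ • e‖⁻¹ • (ℓ - ⟪e, ℓ⟫ • e), norm_smul_inv_norm (𝕜 := ℝ) h, ?_,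
        ‖ℓ - ⟪e, ℓ⟫ • e‖, ?_⟩
      · rw [inner_smul_right, inner_sub_right, inner_smul_right, real_inner_self_eq_norm_sq, he]
        ring
      · rw [smul_smul, mul_inv_cancel₀ (norm_ne_zero_iff.2 h), one_smul]
        abel
  obtain ⟨d, hd⟩ := hℓ
  have h0 : sphMean n (fun η => g ⟪e, η⟫ * ⟪f, η⟫) = 0 := by
    rw [sphMean_comp_inner_mul (by omega) he (K := fun η => ⟪f, η⟫) (k := fun _ => 0) (by fun_prop)
      (by fun_prop) (fun m => ?_) hg]
    · simp
    · simpa using sphMean_moment_odd (by omega) he hf hef m odd_one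
  have h1 : sphMean n (fun η => ⟪e, η⟫ * g ⟪e, η⟫) = sphKappa n 0 * ∫ t in (-1 : ℝ)..1,
      t * g t * gegenWeight (((n : ℝ) - 2) / 2) t :=
    sphMean_comp_inner hn he (g := fun t => t * g t) (by fun_prop)
  have h2 : ∀ η, ⟪η, ℓ⟫ * g ⟪e, η⟫ = ⟪e, ℓ⟫ * (⟪e, η⟫ * g ⟪e, η⟫) + d * (g ⟪e, η⟫ * ⟪f, η⟫) := by
    intro η
    nth_rewrite 1 [hd]
    rw [inner_add_right, inner_smul_right, inner_smul_right, real_inner_comm e η,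
      real_inner_comm f η]
    ring
  simp only [h2]
  have h3 : ContinuousOn (fun η : EuclideanSpace ℝ (Fin n) => ⟪e, ℓ⟫ * (⟪e, η⟫ * g ⟪e, η⟫))
      (Metric.sphere 0 1) := continuousOn_const.mul (ContinuousOn.mul (by fun_prop) hgc)
  have h4 : ContinuousOn (fun η : EuclideanSpace ℝ (Fin n) => d * (g ⟪e, η⟫ * ⟪f, η⟫))
      (Metric.sphere 0 1) := continuousOn_const.mul (hgc.mul (by fun_prop))
  rw [sphMean_add h3 h4, sphMean_const_mul, sphMean_const_mul, h0, h1]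
  ring

lemma sphMean_inner_mul_norm_sub_rpow {n : ℕ} (hn : 3 ≤ n) {w : EuclideanSpace ℝ (Fin n)}
    (hw : ‖w‖ < 1) (ℓ : EuclideanSpace ℝ (Fin n)) :
    sphMean n (fun η => ⟪η, ℓ⟫ * (‖η - w‖ ^ 2) ^ (-(((n : ℝ) - 2) / 2))) =
      ((n : ℝ) - 2) / n * ⟪w, ℓ⟫ := by
  have hn' : (3 : ℝ) ≤ n := by exact_mod_cast hn
  set μ := ((n : ℝ) - 2) / 2 with hμ
  have hμ' : 1 / 2 ≤ μ := by rw [hμ]; linarith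
  obtain ⟨e, he, hwe⟩ := exists_smul_eq_of_norm (by omega) w
  have h := hasSum_sphMean_mul_gegen hn he (r := ‖w‖) (by simpa using hw) (h := fun η => ⟪η, ℓ⟫)
    (by fun_prop)
  rw [← hwe] at h
  refine h.unique ?_
  simp only [sphMean_inner_mul_comp_inner hn he (continuous_gegen _ _).continuousOn]
  refine hasSum_of_forall_ne 1 ?_ ?_
  · have h1 := integral_sq_mul_gegenWeight hμ'
    have h2 := sphKappa_zero_mul_integral hn
    rw [← hμ] at h2 ⊢
    rw [← h1] at h2
    have h3 : ∫ t in (-1 : ℝ)..1, t * gegen μ 1 t * gegenWeight μ t =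
        2 * μ * ∫ t in (-1 : ℝ)..1, t ^ 2 * gegenWeight μ t := by
      rw [← intervalIntegral.integral_const_mul]
      congr 1
      ext t
      rw [← eval_gegenPoly, gegenPoly_one]
      simp only [Polynomial.eval_mul, Polynomial.eval_C, Polynomial.eval_X]
      ring
    rw [h3]
    have h4 : ⟪w, ℓ⟫ = ‖w‖ * ⟪e, ℓ⟫ := by
      nth_rewrite 1 [hwe]
      rw [inner_smul_left, conj_trivial]
    rw [h4, pow_one]
    have e1 : ((n : ℝ) - 2) = 2 * μ := by rw [hμ]; ring
    have e2 : (n : ℝ) = 2 * μ + 2 := by rw [hμ]; ring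
    rw [e1, e2, div_mul_eq_mul_div, eq_div_iff (by positivity)]
    linear_combination (2 * μ * ‖w‖ * ⟪e, ℓ⟫) * h2
  · intro k hk
    have h0 : ∫ t in (-1 : ℝ)..1, t * gegen μ k t * gegenWeight μ t = 0 := by
      rcases Nat.lt_or_gt_of_ne hk with hk | hk
      · obtain rfl : k = 0 := by omega
        have h1 := integral_mul_gegen_eq_zero hμ' (k := 1) (p := 1) (by simp)
        simp only [← eval_gegenPoly, gegenPoly_one, gegenPoly_zero, Polynomial.eval_one, one_mul,
          Polynomial.eval_mul, Polynomial.eval_C, Polynomial.eval_X, mul_assoc,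
          intervalIntegral.integral_const_mul] at h1 ⊢
        have : μ ≠ 0 := by positivity
        simpa [this] using h1
      · simpa using integral_mul_gegen_eq_zero hμ' (k := k) (p := Polynomial.X) (by simpa using hk)
    rw [h0]
    simp

lemma iteratedFDeriv_two_eq_of_hasDerivAt {E : Type*} [NormedAddCommGroup E] [NormedSpace ℝ E]
    {u : E → ℝ} {z v : E} (hu : ContDiffAt ℝ 2 u z) {g : ℝ → ℝ} {c : ℝ}
    (hg : ∀ᶠ t in nhds (0 : ℝ), HasDerivAt (fun t : ℝ => u (z + t • v)) (g t) t)
    (hg' : HasDerivAt g c 0) : iteratedFDeriv ℝ 2 u z ![v, v] = c := by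
  have hline : ∀ t : ℝ, HasDerivAt (fun t : ℝ => z + t • v) v t := fun t => by
    simpa using ((hasDerivAt_id t).smul_const v).const_add z
  have hd : ∀ᶠ w in nhds z, DifferentiableAt ℝ u w :=
    (hu.eventually (by simp)).mono fun w hw => hw.differentiableAt (by simp)
  have htend : Filter.Tendsto (fun t : ℝ => z + t • v) (nhds 0) (nhds z) := by
    simpa using (hline 0).continuousAt.tendsto
  have hd2 : DifferentiableAt ℝ (fderiv ℝ u) z :=
    (hu.fderiv_right (m := 1) (by norm_num)).differentiableAt (by simp)
  have h1 : (fun t : ℝ => fderiv ℝ u (z + t • v) v) =ᶠ[nhds 0] g := by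
    filter_upwards [htend.eventually hd, hg] with t ht hgt
    exact (ht.hasFDerivAt.comp_hasDerivAt t (hline t)).unique hgt
  have h2 : HasDerivAt (fun t : ℝ => fderiv ℝ u (z + t • v)) (fderiv ℝ (fderiv ℝ u) z v) 0 := by
    have h3 : HasFDerivAt (fderiv ℝ u) (fderiv ℝ (fderiv ℝ u) z) (z + (0 : ℝ) • v) := by
      simpa using hd2.hasFDerivAt
    exact h3.comp_hasDerivAt 0 (hline 0)
  have h4 := (h2.clm_apply (hasDerivAt_const (0 : ℝ) v)).congr_of_eventuallyEq h1.symm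
  rw [iteratedFDeriv_two_apply]
  simpa using h4.unique hg'

/-- A multiple of the Newton kernel with pole `y`. -/
noncomputable def newton (n : ℕ) (y z : EuclideanSpace ℝ (Fin n)) : ℝ :=
  (‖z - y‖ ^ 2) ^ (-(((n : ℝ) - 2) / 2))

lemma contDiffAt_newton {n : ℕ} {y z : EuclideanSpace ℝ (Fin n)} (h : z ≠ y) :
    ContDiffAt ℝ 2 (newton n y) z := by
  have h0 : ‖z - y‖ ^ 2 ≠ 0 := by simpa [sub_eq_zero] using h
  unfold newton
  refine ContDiffAt.rpow_const_of_ne ?_ h0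
  exact ((contDiff_norm_sq ℝ).comp (contDiff_id.sub contDiff_const)).contDiffAt

lemma hasDerivAt_newton {n : ℕ} {y z : EuclideanSpace ℝ (Fin n)} (v : EuclideanSpace ℝ (Fin n))
    {t : ℝ} (h : z + t • v ≠ y) :
    HasDerivAt (fun t : ℝ => newton n y (z + t • v)) ((2 * ⟪z + t • v - y, v⟫) *
      (-(((n : ℝ) - 2) / 2)) * (‖z + t • v - y‖ ^ 2) ^ (-(((n : ℝ) - 2) / 2) - 1)) t := by
  have hline : HasDerivAt (fun t : ℝ => z + t • v - y) v t := by
    simpa using (((hasDerivAt_id t).smul_const v).const_add z).sub_const y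
  have h0 : ‖z + t • v - y‖ ^ 2 ≠ 0 := by simpa [sub_eq_zero] using h
  exact hline.norm_sq.rpow_const (Or.inl h0)

lemma inner_gradient_newton {n : ℕ} {y z : EuclideanSpace ℝ (Fin n)} (h : z ≠ y)
    (v : EuclideanSpace ℝ (Fin n)) : ⟪gradient (newton n y) z, v⟫ =
      ((n : ℝ) - 2) * ⟪y - z, v⟫ * (‖z - y‖ ^ 2) ^ (-(((n : ℝ) - 2) / 2) - 1) := by
  rw [inner_gradient_left]
  have hline : HasDerivAt (fun t : ℝ => z + t • v) v 0 := by
    simpa using ((hasDerivAt_id (0 : ℝ)).smul_const v).const_add z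
  have h1 : HasFDerivAt (newton n y) (fderiv ℝ (newton n y) z) (z + (0 : ℝ) • v) := by
    simpa using ((contDiffAt_newton h).differentiableAt (by simp)).hasFDerivAt
  have h2 : HasDerivAt (fun t : ℝ => newton n y (z + t • v)) (fderiv ℝ (newton n y) z v) 0 :=
    (h1.comp_hasDerivAt (0 : ℝ) hline :)
  rw [h2.unique (hasDerivAt_newton v (by simpa using h)), zero_smul,
    add_zero, ← neg_sub y z, inner_neg_left, norm_neg]
  ring

lemma sum_iteratedFDeriv_newton {n : ℕ} {y z : EuclideanSpace ℝ (Fin n)} (h : z ≠ y) :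
    ∑ i : Fin n, iteratedFDeriv ℝ 2 (newton n y) z
      ![EuclideanSpace.single i 1, EuclideanSpace.single i 1] = 0 := by
  have hD : 0 < ‖z - y‖ ^ 2 := pow_pos (norm_pos_iff.2 (sub_ne_zero.2 h)) 2
  have key : ∀ v : EuclideanSpace ℝ (Fin n), iteratedFDeriv ℝ 2 (newton n y) z ![v, v] =
      -(((n : ℝ) - 2) / 2) * (2 * ‖v‖ ^ 2 * (‖z - y‖ ^ 2) ^ (-(((n : ℝ) - 2) / 2) - 1) -
        2 * n * ⟪z - y, v⟫ ^ 2 * (‖z - y‖ ^ 2) ^ (-(((n : ℝ) - 2) / 2) - 1 - 1)) := by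
    intro v
    refine iteratedFDeriv_two_eq_of_hasDerivAt (contDiffAt_newton h) (g := fun t =>
      (2 * ⟪z + t • v - y, v⟫) * (-(((n : ℝ) - 2) / 2)) *
        (‖z + t • v - y‖ ^ 2) ^ (-(((n : ℝ) - 2) / 2) - 1)) ?_ ?_
    · have hc : Filter.Tendsto (fun t : ℝ => z + t • v) (nhds 0) (nhds z) := by
        have : Continuous fun t : ℝ => z + t • v := by fun_prop
        simpa using this.tendsto 0
      filter_upwards [hc.eventually_ne h] with t ht using hasDerivAt_newton v ht
    · have hline : HasDerivAt (fun t : ℝ => z + t • v - y) v 0 := by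
        simpa using (((hasDerivAt_id (0 : ℝ)).smul_const v).const_add z).sub_const y
      have h1 := hline.norm_sq.rpow_const (p := -(((n : ℝ) - 2) / 2) - 1)
        (Or.inl (by simpa using hD.ne'))
      have h2 := hline.inner ℝ (hasDerivAt_const (0 : ℝ) v)
      have h3 := ((h2.const_mul 2).mul_const (-(((n : ℝ) - 2) / 2))).mul h1
      convert! h3 using 1
      simp only [zero_smul, add_zero, inner_zero_right, zero_add, real_inner_self_eq_norm_sq]
      ring
  have hsum : ∑ i : Fin n, ⟪z - y, EuclideanSpace.single i (1 : ℝ)⟫ ^ 2 = ‖z - y‖ ^ 2 := by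
    rw [EuclideanSpace.norm_sq_eq]
    simp [EuclideanSpace.inner_single_right]
  simp only [key, PiLp.norm_single, norm_one, ← Finset.mul_sum, Finset.sum_sub_distrib,
    ← Finset.sum_mul, hsum, Finset.sum_const, Finset.card_univ, Fintype.card_fin, nsmul_eq_mul]
  rw [Real.rpow_sub_one hD.ne' (-(((n : ℝ) - 2) / 2) - 1)]
  generalize ‖z - y‖ ^ 2 = D at *
  field_simp
  ring

/-- The involution of the unit sphere that sends `y` to the second intersection of the line
through `x` and `y` with the sphere. -/
noncomputable def kelvin {n : ℕ} (x y : EuclideanSpace ℝ (Fin n)) : EuclideanSpace ℝ (Fin n) :=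
  x - ((1 - ‖x‖ ^ 2) / ‖y - x‖ ^ 2) • (y - x)

lemma norm_kelvin_sq {n : ℕ} {x y : EuclideanSpace ℝ (Fin n)} (h : y ≠ x) :
    ‖kelvin x y‖ ^ 2 = 1 + (1 - ‖x‖ ^ 2) / ‖y - x‖ ^ 2 * (1 - ‖y‖ ^ 2) := by
  have hD : ‖y - x‖ ^ 2 ≠ 0 := by simpa [sub_eq_zero] using h
  obtain ⟨q, rfl⟩ : ∃ q, y = x + q := ⟨y - x, by abel⟩
  rw [kelvin, norm_sub_sq_real, norm_add_sq_real, norm_smul, mul_pow, Real.norm_eq_abs, sq_abs,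
    inner_smul_right]
  simp only [add_sub_cancel_left] at hD ⊢
  generalize ‖q‖ ^ 2 = D at *
  field_simp
  ring

lemma kelvin_mem_sphere {n : ℕ} {x y : EuclideanSpace ℝ (Fin n)} (h : y ≠ x)
    (hy : y ∈ Metric.sphere (0 : EuclideanSpace ℝ (Fin n)) 1) :
    kelvin x y ∈ Metric.sphere (0 : EuclideanSpace ℝ (Fin n)) 1 := by
  have h1 := norm_kelvin_sq h
  rw [mem_sphere_zero_iff_norm] at *
  rw [hy, one_pow, sub_self, mul_zero, add_zero] at h1
  exact (pow_eq_one_iff_of_nonneg (norm_nonneg _) two_ne_zero).1 h1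

lemma kelvin_sub_self {n : ℕ} (x y : EuclideanSpace ℝ (Fin n)) :
    kelvin x y - x = -(((1 - ‖x‖ ^ 2) / ‖y - x‖ ^ 2) • (y - x)) := by
  rw [kelvin]
  abel

lemma kelvin_kelvin {n : ℕ} {x y : EuclideanSpace ℝ (Fin n)} (h : y ≠ x) (hx : ‖x‖ < 1) :
    kelvin x (kelvin x y) = y := by
  have hD : ‖y - x‖ ^ 2 ≠ 0 := by simpa [sub_eq_zero] using h
  have hs : 1 - ‖x‖ ^ 2 ≠ 0 := by nlinarith [norm_nonneg x]
  rw [kelvin, kelvin_sub_self, norm_neg, norm_smul, smul_neg, sub_neg_eq_add, smul_smul,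
    mul_pow, Real.norm_eq_abs, sq_abs]
  have : (1 - ‖x‖ ^ 2) / (((1 - ‖x‖ ^ 2) / ‖y - x‖ ^ 2) ^ 2 * ‖y - x‖ ^ 2) *
      ((1 - ‖x‖ ^ 2) / ‖y - x‖ ^ 2) = 1 := by
    generalize ‖y - x‖ ^ 2 = D at *
    field_simp
  rw [this, one_smul]
  abel

lemma norm_kelvin_sub_mul {n : ℕ} {x y η : EuclideanSpace ℝ (Fin n)} (h : y ≠ x) (h' : η ≠ x) :
    ‖kelvin x η - y‖ ^ 2 * ‖η - x‖ ^ 2 = ‖y - x‖ ^ 2 * ‖η - kelvin x y‖ ^ 2 := by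
  have hD : ‖y - x‖ ^ 2 ≠ 0 := by simpa [sub_eq_zero] using h
  have hD' : ‖η - x‖ ^ 2 ≠ 0 := by simpa [sub_eq_zero] using h'
  have h1 : kelvin x η - y = -(((1 - ‖x‖ ^ 2) / ‖η - x‖ ^ 2) • (η - x) + (y - x)) := by
    rw [kelvin]; abel
  have h2 : η - kelvin x y = ((1 - ‖x‖ ^ 2) / ‖y - x‖ ^ 2) • (y - x) + (η - x) := by
    rw [kelvin]; abel
  rw [h1, h2, norm_neg, norm_add_sq_real, norm_add_sq_real, norm_smul, norm_smul, mul_pow, mul_pow,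
    Real.norm_eq_abs, Real.norm_eq_abs, sq_abs, sq_abs, inner_smul_left, inner_smul_left,
    real_inner_comm (y - x) (η - x)]
  generalize ‖y - x‖ ^ 2 = D at *
  generalize ‖η - x‖ ^ 2 = D' at *
  simp only [conj_trivial]
  field_simp

lemma ne_of_mem_sphere_of_norm_lt {n : ℕ} {x η : EuclideanSpace ℝ (Fin n)}
    (hη : η ∈ Metric.sphere (0 : EuclideanSpace ℝ (Fin n)) 1) (hx : ‖x‖ < 1) : η ≠ x := by
  rintro rfl
  exact hx.ne (mem_sphere_zero_iff_norm.1 hη)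

lemma newton_kelvin {n : ℕ} {x y η : EuclideanSpace ℝ (Fin n)} (h : y ≠ x) (h' : η ≠ x) :
    (‖η - x‖ ^ 2) ^ (-(((n : ℝ) - 2) / 2)) * newton n y (kelvin x η) =
      newton n y x * (‖η - kelvin x y‖ ^ 2) ^ (-(((n : ℝ) - 2) / 2)) := by
  rw [newton, newton, norm_sub_rev x y, ← Real.mul_rpow (by positivity) (by positivity),
    ← Real.mul_rpow (by positivity) (by positivity), mul_comm, norm_kelvin_sub_mul h h']

lemma continuousOn_kelvin {n : ℕ} {x : EuclideanSpace ℝ (Fin n)} (hx : ‖x‖ < 1) :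
    ContinuousOn (kelvin x) (Metric.sphere 0 1) := by
  unfold kelvin
  have h : ContinuousOn (fun η : EuclideanSpace ℝ (Fin n) => (1 - ‖x‖ ^ 2) / ‖η - x‖ ^ 2)
      (Metric.sphere 0 1) := by
    refine ContinuousOn.div₀ continuousOn_const (by fun_prop) fun η hη => ?_
    simpa [sub_eq_zero] using ne_of_mem_sphere_of_norm_lt hη hx
  exact continuousOn_const.sub (h.smul (by fun_prop))

lemma continuousOn_norm_sub_rpow {n : ℕ} {x : EuclideanSpace ℝ (Fin n)} (hx : ‖x‖ < 1) (p : ℝ) :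
    ContinuousOn (fun η : EuclideanSpace ℝ (Fin n) => (‖η - x‖ ^ 2) ^ p)
      (Metric.sphere 0 1) := by
  refine ContinuousOn.rpow_const (by fun_prop) fun η hη => Or.inl ?_
  simpa [sub_eq_zero] using ne_of_mem_sphere_of_norm_lt hη hx

/-- The functional on boundary values that represents the derivative at `x` in direction `ℓ`
of a harmonic function. -/
noncomputable def dirFunctional (n : ℕ) (x ℓ : EuclideanSpace ℝ (Fin n))
    (φ : EuclideanSpace ℝ (Fin n) → ℝ) : ℝ :=
  (1 - ‖x‖ ^ 2)⁻¹ * sphMean n fun η => (‖η - x‖ ^ 2) ^ (-(((n : ℝ) - 2) / 2)) *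
    (((n : ℝ) - 2) * ⟪x, ℓ⟫ - n * ⟪η, ℓ⟫) * φ (kelvin x η)

/-- The norm of `dirFunctional n x ℓ`. -/
noncomputable def dirBound (n : ℕ) (x ℓ : EuclideanSpace ℝ (Fin n)) : ℝ :=
  (1 - ‖x‖ ^ 2)⁻¹ * sphMean n fun η => (‖η - x‖ ^ 2) ^ (-(((n : ℝ) - 2) / 2)) *
    |((n : ℝ) - 2) * ⟪x, ℓ⟫ - n * ⟪η, ℓ⟫|

lemma norm_kelvin_lt_one {n : ℕ} {x y : EuclideanSpace ℝ (Fin n)} (hx : ‖x‖ < 1) (hy : 1 < ‖y‖) :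
    ‖kelvin x y‖ < 1 := by
  have hyx : y ≠ x := fun h => by rw [h] at hy; linarith
  have hD : 0 < ‖y - x‖ ^ 2 := pow_pos (norm_pos_iff.2 (sub_ne_zero.2 hyx)) 2
  have h2 : 0 < (1 - ‖x‖ ^ 2) / ‖y - x‖ ^ 2 := div_pos (by nlinarith [norm_nonneg x]) hD
  have h3 : 0 < (1 - ‖x‖ ^ 2) / ‖y - x‖ ^ 2 * (‖y‖ ^ 2 - 1) := mul_pos h2 (by nlinarith)
  nlinarith [norm_kelvin_sq hyx, norm_nonneg (kelvin x y)]

lemma inner_gradient_newton_eq_dirFunctional {n : ℕ} (hn : 3 ≤ n) {x y : EuclideanSpace ℝ (Fin n)}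
    (hx : ‖x‖ < 1) (hy : 1 < ‖y‖) (ℓ : EuclideanSpace ℝ (Fin n)) :
    ⟪gradient (newton n y) x, ℓ⟫ = dirFunctional n x ℓ (newton n y) := by
  have hyx : y ≠ x := fun h => by rw [h] at hy; linarith
  have hn0 : (n : ℝ) ≠ 0 := by positivity
  have hD : 0 < ‖y - x‖ ^ 2 := pow_pos (norm_pos_iff.2 (sub_ne_zero.2 hyx)) 2
  have hs : 1 - ‖x‖ ^ 2 ≠ 0 := by nlinarith [norm_nonneg x]
  have hw := norm_kelvin_lt_one hx hy
  set w := kelvin x y with hwdef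
  have h1 : sphMean n (fun η => (‖η - x‖ ^ 2) ^ (-(((n : ℝ) - 2) / 2)) *
      (((n : ℝ) - 2) * ⟪x, ℓ⟫ - n * ⟪η, ℓ⟫) * newton n y (kelvin x η)) =
      sphMean n (fun η =>
        (newton n y x * (((n : ℝ) - 2) * ⟪x, ℓ⟫)) * (‖η - w‖ ^ 2) ^ (-(((n : ℝ) - 2) / 2)) -
        (newton n y x * n) * (⟪η, ℓ⟫ * (‖η - w‖ ^ 2) ^ (-(((n : ℝ) - 2) / 2)))) := by
    refine sphMean_congr fun η hη => ?_
    have := newton_kelvin hyx (ne_of_mem_sphere_of_norm_lt hη hx)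
    rw [← hwdef] at this
    rw [mul_right_comm, this]
    ring
  have hc := continuousOn_norm_sub_rpow hw (-(((n : ℝ) - 2) / 2))
  have hc1 : ContinuousOn (fun η : EuclideanSpace ℝ (Fin n) =>
      (newton n y x * (((n : ℝ) - 2) * ⟪x, ℓ⟫)) * (‖η - w‖ ^ 2) ^ (-(((n : ℝ) - 2) / 2)))
      (Metric.sphere 0 1) := continuousOn_const.mul hc
  have hc2 : ContinuousOn (fun η : EuclideanSpace ℝ (Fin n) =>
      (newton n y x * n) * (⟪η, ℓ⟫ * (‖η - w‖ ^ 2) ^ (-(((n : ℝ) - 2) / 2))))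
      (Metric.sphere 0 1) := continuousOn_const.mul (ContinuousOn.mul (by fun_prop) hc)
  rw [dirFunctional, h1, sphMean_sub hc1 hc2, sphMean_const_mul, sphMean_const_mul,
    sphMean_norm_sub_rpow hn hw, sphMean_inner_mul_norm_sub_rpow hn hw,
    inner_gradient_newton hyx.symm, hwdef, kelvin, inner_sub_left x, inner_smul_left,
    inner_sub_left y, newton, norm_sub_rev x y, Real.rpow_sub_one hD.ne', conj_trivial]
  generalize ‖y - x‖ ^ 2 = D at *
  field_simp
  ring

lemma deriv_deriv_line_eq_iteratedFDeriv {E : Type*} [NormedAddCommGroup E] [NormedSpace ℝ E]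
    {u : E → ℝ} {z : E} (hu : ContDiffAt ℝ 2 u z) (v : E) :
    deriv (deriv fun t : ℝ => u (z + t • v)) 0 = iteratedFDeriv ℝ 2 u z ![v, v] := by
  have hl : ContDiff ℝ 2 fun t : ℝ => z + t • v := by fun_prop
  have hc : ContDiffAt ℝ 2 (fun t : ℝ => u (z + t • v)) 0 :=
    ContDiffAt.comp (0 : ℝ) (by simpa using hu) hl.contDiffAt
  symm
  refine iteratedFDeriv_two_eq_of_hasDerivAt hu
    ((hc.eventually (by simp)).mono fun t ht =>
      (ht.differentiableAt (by simp)).hasDerivAt) ?_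
  have h1 : ContDiffAt ℝ 1 (deriv fun t : ℝ => u (z + t • v)) 0 := by
    have := (hc.fderiv_right (m := 1) (by norm_num)).clm_apply
      (contDiffAt_const (c := (1 : ℝ)))
    simpa using this
  exact (h1.differentiableAt (by simp)).hasDerivAt

lemma IsLocalMax.iteratedFDeriv_two_nonpos {E : Type*} [NormedAddCommGroup E] [NormedSpace ℝ E]
    {u : E → ℝ} {z : E} (hm : IsLocalMax u z) (hu : ContDiffAt ℝ 2 u z) (v : E) :
    iteratedFDeriv ℝ 2 u z ![v, v] ≤ 0 := by
  rw [← deriv_deriv_line_eq_iteratedFDeriv hu]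
  by_contra! h
  have hl : Continuous fun t : ℝ => z + t • v := by fun_prop
  have hm' : IsLocalMax (fun t : ℝ => u (z + t • v)) 0 := by
    have ht : Filter.Tendsto (fun t : ℝ => z + t • v) (nhds 0) (nhds z) := by
      simpa using hl.tendsto 0
    simpa [IsLocalMax, IsMaxFilter] using ht.eventually hm
  have hc : ContinuousAt (fun t : ℝ => u (z + t • v)) 0 :=
    ContinuousAt.comp (by simpa using hu.continuousAt) hl.continuousAt
  have hmin := isLocalMin_of_deriv_deriv_pos h hm'.deriv_eq_zero hc
  have heq : (fun t : ℝ => u (z + t • v)) =ᶠ[nhds 0] fun _ => u (z + (0 : ℝ) • v) := by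
    filter_upwards [hm', hmin] with t h1 h2 using le_antisymm h1 h2
  have h0 : deriv (deriv fun t : ℝ => u (z + t • v)) 0 = 0 := by
    rw [heq.deriv.deriv_eq]
    simp
  exact h.ne' h0

lemma iteratedFDeriv_two_norm_sq {n : ℕ} (z v : EuclideanSpace ℝ (Fin n)) :
    iteratedFDeriv ℝ 2 (fun z : EuclideanSpace ℝ (Fin n) => ‖z‖ ^ 2) z ![v, v] = 2 * ‖v‖ ^ 2 := by
  have hline : ∀ t : ℝ, HasDerivAt (fun t : ℝ => z + t • v) v t := fun t => by
    simpa using ((hasDerivAt_id t).smul_const v).const_add z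
  refine iteratedFDeriv_two_eq_of_hasDerivAt (contDiff_norm_sq ℝ).contDiffAt
    (Filter.Eventually.of_forall fun t => (hline t).norm_sq) ?_
  have h := ((hline 0).inner ℝ (hasDerivAt_const (0 : ℝ) v)).const_mul 2
  convert! h using 1
  simp

lemma le_of_forall_sphere_le {n : ℕ} (hn : 0 < n) {u : EuclideanSpace ℝ (Fin n) → ℝ}
    (hu : IsHarmonicOnBall n u) (huc : ContinuousOn u (Metric.closedBall 0 1)) {m : ℝ}
    (hm : ∀ η ∈ Metric.sphere (0 : EuclideanSpace ℝ (Fin n)) 1, u η ≤ m)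
    {z : EuclideanSpace ℝ (Fin n)} (hz : z ∈ Metric.closedBall 0 1) : u z ≤ m := by
  by_contra! hlt
  obtain ⟨ε, hε, hεz⟩ : ∃ ε > 0, m + ε < u z := ⟨(u z - m) / 2, by linarith, by linarith⟩
  have hwc : ContinuousOn (fun y : EuclideanSpace ℝ (Fin n) => u y + ε * ‖y‖ ^ 2)
      (Metric.closedBall 0 1) := huc.add (by fun_prop)
  obtain ⟨p, hp, hpmax⟩ := (isCompact_closedBall (0 : EuclideanSpace ℝ (Fin n)) 1).exists_isMaxOn
    ⟨z, hz⟩ hwc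
  have hpz : m + ε < u p + ε * ‖p‖ ^ 2 := by
    have h1 : u z + ε * ‖z‖ ^ 2 ≤ u p + ε * ‖p‖ ^ 2 := hpmax hz
    have h2 : 0 ≤ ε * ‖z‖ ^ 2 := by positivity
    linarith
  have hpball : p ∈ Metric.ball (0 : EuclideanSpace ℝ (Fin n)) 1 := by
    rw [mem_ball_zero_iff]
    refine lt_of_le_of_ne (mem_closedBall_zero_iff.1 hp) fun h => ?_
    have := hm p (mem_sphere_zero_iff_norm.2 h)
    rw [h] at hpz
    linarith
  have hnhds := Metric.isOpen_ball.mem_nhds hpball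
  have hup : ContDiffAt ℝ 2 u p := hu.1.contDiffAt hnhds
  have hq : ContDiffAt ℝ 2 (fun y : EuclideanSpace ℝ (Fin n) => ε * ‖y‖ ^ 2) p :=
    contDiffAt_const.mul (contDiff_norm_sq ℝ).contDiffAt
  have hloc : IsLocalMax (u + fun y : EuclideanSpace ℝ (Fin n) => ε * ‖y‖ ^ 2) p :=
    (hpmax.on_subset Metric.ball_subset_closedBall).isLocalMax hnhds
  have h3 : ∀ i : Fin n, iteratedFDeriv ℝ 2 u p
      ![EuclideanSpace.single i 1, EuclideanSpace.single i 1] + 2 * ε ≤ 0 := by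
    intro i
    have h4 := hloc.iteratedFDeriv_two_nonpos (hup.add hq) (EuclideanSpace.single i 1)
    have h5 : iteratedFDeriv ℝ 2 (fun y : EuclideanSpace ℝ (Fin n) => ε * ‖y‖ ^ 2) p =
        ε • iteratedFDeriv ℝ 2 (fun y : EuclideanSpace ℝ (Fin n) => ‖y‖ ^ 2) p :=
      iteratedFDeriv_const_smul_apply (a := ε) (contDiff_norm_sq ℝ).contDiffAt
    rw [iteratedFDeriv_add_apply hup hq, _root_.add_apply, h5,
      _root_.smul_apply, iteratedFDeriv_two_norm_sq] at h4
    simp only [PiLp.norm_single, norm_one, smul_eq_mul] at h4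
    linarith
  have h6 := Finset.sum_nonpos fun i (_ : i ∈ Finset.univ) => h3 i
  rw [Finset.sum_add_distrib, hu.2 p hpball] at h6
  have hn' : (0 : ℝ) < n := by exact_mod_cast hn
  simp only [Finset.sum_const, Finset.card_univ, Fintype.card_fin, nsmul_eq_mul] at h6
  nlinarith [mul_pos hn' hε]

lemma continuousOn_dirKernel {n : ℕ} {x : EuclideanSpace ℝ (Fin n)} (hx : ‖x‖ < 1)
    (ℓ : EuclideanSpace ℝ (Fin n)) :
    ContinuousOn (fun η : EuclideanSpace ℝ (Fin n) => (‖η - x‖ ^ 2) ^ (-(((n : ℝ) - 2) / 2)) *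
      (((n : ℝ) - 2) * ⟪x, ℓ⟫ - n * ⟪η, ℓ⟫)) (Metric.sphere 0 1) :=
  (continuousOn_norm_sub_rpow hx _).mul (by fun_prop)

lemma continuousOn_comp_kelvin {n : ℕ} {x : EuclideanSpace ℝ (Fin n)} (hx : ‖x‖ < 1)
    {φ : EuclideanSpace ℝ (Fin n) → ℝ} (hφ : ContinuousOn φ (Metric.sphere 0 1)) :
    ContinuousOn (fun η => φ (kelvin x η)) (Metric.sphere 0 1) :=
  hφ.comp (continuousOn_kelvin hx) fun _ hη =>
    kelvin_mem_sphere (ne_of_mem_sphere_of_norm_lt hη hx) hη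

lemma continuousOn_dirKernel_mul {n : ℕ} {x : EuclideanSpace ℝ (Fin n)} (hx : ‖x‖ < 1)
    (ℓ : EuclideanSpace ℝ (Fin n)) {φ : EuclideanSpace ℝ (Fin n) → ℝ}
    (hφ : ContinuousOn φ (Metric.sphere 0 1)) :
    ContinuousOn (fun η : EuclideanSpace ℝ (Fin n) => (‖η - x‖ ^ 2) ^ (-(((n : ℝ) - 2) / 2)) *
      (((n : ℝ) - 2) * ⟪x, ℓ⟫ - n * ⟪η, ℓ⟫) * φ (kelvin x η)) (Metric.sphere 0 1) :=
  (continuousOn_dirKernel hx ℓ).mul (continuousOn_comp_kelvin hx hφ)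

lemma dirFunctional_add {n : ℕ} {x : EuclideanSpace ℝ (Fin n)} (hx : ‖x‖ < 1)
    (ℓ : EuclideanSpace ℝ (Fin n)) {φ ψ : EuclideanSpace ℝ (Fin n) → ℝ}
    (hφ : ContinuousOn φ (Metric.sphere 0 1)) (hψ : ContinuousOn ψ (Metric.sphere 0 1)) :
    dirFunctional n x ℓ (φ + ψ) = dirFunctional n x ℓ φ + dirFunctional n x ℓ ψ := by
  simp only [dirFunctional, Pi.add_apply, mul_add]
  rw [sphMean_add (continuousOn_dirKernel_mul hx ℓ hφ) (continuousOn_dirKernel_mul hx ℓ hψ),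
    mul_add]

lemma dirFunctional_smul {n : ℕ} (x ℓ : EuclideanSpace ℝ (Fin n)) (c : ℝ)
    (φ : EuclideanSpace ℝ (Fin n) → ℝ) :
    dirFunctional n x ℓ (c • φ) = c * dirFunctional n x ℓ φ := by
  simp only [dirFunctional, Pi.smul_apply, smul_eq_mul, mul_left_comm _ c, sphMean_const_mul]

lemma dirFunctional_sub {n : ℕ} {x : EuclideanSpace ℝ (Fin n)} (hx : ‖x‖ < 1)
    (ℓ : EuclideanSpace ℝ (Fin n)) {φ ψ : EuclideanSpace ℝ (Fin n) → ℝ}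
    (hφ : ContinuousOn φ (Metric.sphere 0 1)) (hψ : ContinuousOn ψ (Metric.sphere 0 1)) :
    dirFunctional n x ℓ (φ - ψ) = dirFunctional n x ℓ φ - dirFunctional n x ℓ ψ := by
  have h : φ - ψ = φ + (-1 : ℝ) • ψ := by ext; simp [sub_eq_add_neg]
  rw [h, dirFunctional_add hx ℓ hφ (hψ.const_smul (-1 : ℝ)), dirFunctional_smul]
  ring

lemma abs_dirFunctional_le {n : ℕ} {x : EuclideanSpace ℝ (Fin n)} (hx : ‖x‖ < 1)
    (ℓ : EuclideanSpace ℝ (Fin n)) {φ : EuclideanSpace ℝ (Fin n) → ℝ}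
    (hφ : ContinuousOn φ (Metric.sphere 0 1)) {M : ℝ} (hM : ∀ η ∈ Metric.sphere 0 1, |φ η| ≤ M) :
    |dirFunctional n x ℓ φ| ≤ dirBound n x ℓ * M := by
  have hs : 0 < 1 - ‖x‖ ^ 2 := by nlinarith [norm_nonneg x]
  rw [dirFunctional, dirBound, abs_mul, abs_of_pos (inv_pos.2 hs), mul_assoc,
    mul_comm (sphMean n _) M, ← sphMean_const_mul]
  refine mul_le_mul_of_nonneg_left ((abs_sphMean_le _).trans (sphMean_mono
    (continuousOn_dirKernel_mul hx ℓ hφ).abs ?_ fun η hη => ?_)) (inv_pos.2 hs).le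
  · exact continuousOn_const.mul ((continuousOn_norm_sub_rpow hx _).mul (by fun_prop))
  · rw [abs_mul, abs_mul, abs_of_nonneg (Real.rpow_nonneg (by positivity) _), mul_comm M]
    exact mul_le_mul_of_nonneg_left
      (hM _ (kelvin_mem_sphere (ne_of_mem_sphere_of_norm_lt hη hx) hη)) (by positivity)

/-- Linear combinations of Newton kernels with poles outside the closed unit ball. -/
noncomputable def newtonSpan (n : ℕ) : Submodule ℝ (EuclideanSpace ℝ (Fin n) → ℝ) :=
  Submodule.span ℝ {f | ∃ y, 1 < ‖y‖ ∧ f = newton n y}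

lemma contDiffAt_of_mem_newtonSpan {n : ℕ} {v : EuclideanSpace ℝ (Fin n) → ℝ}
    (hv : v ∈ newtonSpan n) {z : EuclideanSpace ℝ (Fin n)} (hz : ‖z‖ ≤ 1) :
    ContDiffAt ℝ 2 v z := by
  induction hv using Submodule.span_induction with
  | mem f hf =>
    obtain ⟨y, hy, rfl⟩ := hf
    exact contDiffAt_newton fun h => by rw [h] at hz; linarith
  | zero => exact contDiffAt_const
  | add f g _ _ hf hg => exact hf.add hg
  | smul c f _ hf => exact hf.const_smul c

lemma continuousOn_of_mem_newtonSpan {n : ℕ} {v : EuclideanSpace ℝ (Fin n) → ℝ}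
    (hv : v ∈ newtonSpan n) : ContinuousOn v (Metric.closedBall 0 1) := fun _ hz =>
  (contDiffAt_of_mem_newtonSpan hv (mem_closedBall_zero_iff.1 hz)).continuousAt.continuousWithinAt

lemma isHarmonicOnBall_of_mem_newtonSpan {n : ℕ} {v : EuclideanSpace ℝ (Fin n) → ℝ}
    (hv : v ∈ newtonSpan n) : IsHarmonicOnBall n v := by
  refine ⟨fun z hz => (contDiffAt_of_mem_newtonSpan hv
    (mem_ball_zero_iff.1 hz).le).contDiffWithinAt, fun z hz => ?_⟩
  have hz := mem_ball_zero_iff.1 hz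
  induction hv using Submodule.span_induction with
  | mem f hf =>
    obtain ⟨y, hy, rfl⟩ := hf
    exact sum_iteratedFDeriv_newton fun h => by rw [h] at hz; linarith
  | zero =>
    have h0 : iteratedFDeriv ℝ 2 (0 : EuclideanSpace ℝ (Fin n) → ℝ) z = 0 := by
      rw [iteratedFDeriv_zero]; rfl
    simp [h0]
  | add f g hfm hgm hf hg =>
    simp [iteratedFDeriv_add_apply (contDiffAt_of_mem_newtonSpan hfm hz.le)
      (contDiffAt_of_mem_newtonSpan hgm hz.le), Finset.sum_add_distrib, hf, hg]
  | smul c f hfm hf =>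
    simp [iteratedFDeriv_const_smul_apply (a := c) (contDiffAt_of_mem_newtonSpan hfm hz.le),
      ← Finset.mul_sum, hf]

lemma inner_gradient_of_mem_newtonSpan {n : ℕ} (hn : 3 ≤ n) {v : EuclideanSpace ℝ (Fin n) → ℝ}
    (hv : v ∈ newtonSpan n) {x : EuclideanSpace ℝ (Fin n)} (hx : ‖x‖ < 1)
    (ℓ : EuclideanSpace ℝ (Fin n)) : ⟪gradient v x, ℓ⟫ = dirFunctional n x ℓ v := by
  have hd : ∀ {f : EuclideanSpace ℝ (Fin n) → ℝ}, f ∈ newtonSpan n → DifferentiableAt ℝ f x :=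
    fun hf => (contDiffAt_of_mem_newtonSpan hf hx.le).differentiableAt (by simp)
  have hc : ∀ {f : EuclideanSpace ℝ (Fin n) → ℝ}, f ∈ newtonSpan n →
      ContinuousOn f (Metric.sphere 0 1) :=
    fun hf => (continuousOn_of_mem_newtonSpan hf).mono Metric.sphere_subset_closedBall
  induction hv using Submodule.span_induction with
  | mem f hf =>
    obtain ⟨y, hy, rfl⟩ := hf
    exact inner_gradient_newton_eq_dirFunctional hn hx hy ℓ
  | zero =>
    rw [inner_gradient_left, fderiv_zero]
    simpa using (dirFunctional_smul x ℓ 0 0).symm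
  | add f g hfm hgm hf hg =>
    rw [inner_gradient_left] at hf hg ⊢
    rw [fderiv_add (hd hfm) (hd hgm), dirFunctional_add hx ℓ (hc hfm) (hc hgm), ← hf, ← hg]
    rfl
  | smul c f hfm hf =>
    rw [inner_gradient_left] at hf ⊢
    rw [fderiv_const_smul (hd hfm), dirFunctional_smul, ← hf]
    rfl

/-- Functions that are uniform limits on the unit sphere of elements of `newtonSpan n`. -/
noncomputable def newtonClosure (n : ℕ) : Submodule ℝ (EuclideanSpace ℝ (Fin n) → ℝ) where
  carrier := {φ | ∀ ε > 0, ∃ v ∈ newtonSpan n, ∀ η ∈ Metric.sphere 0 1, |v η - φ η| ≤ ε}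
  zero_mem' := fun ε hε => ⟨0, Submodule.zero_mem _, fun η _ => by simpa using hε.le⟩
  add_mem' := by
    intro φ ψ hφ hψ ε hε
    obtain ⟨v, hv, hv'⟩ := hφ (ε / 2) (half_pos hε)
    obtain ⟨w, hw, hw'⟩ := hψ (ε / 2) (half_pos hε)
    refine ⟨v + w, Submodule.add_mem _ hv hw, fun η hη => ?_⟩
    calc |(v + w) η - (φ + ψ) η| = |(v η - φ η) + (w η - ψ η)| := by
          simp only [Pi.add_apply]; ring_nf
      _ ≤ ε / 2 + ε / 2 := (abs_add_le _ _).trans (add_le_add (hv' η hη) (hw' η hη))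
      _ = ε := add_halves ε
  smul_mem' := by
    intro c φ hφ ε hε
    have hc : 0 < |c| + 1 := by positivity
    obtain ⟨v, hv, hv'⟩ := hφ (ε / (|c| + 1)) (div_pos hε hc)
    refine ⟨c • v, Submodule.smul_mem _ c hv, fun η hη => ?_⟩
    calc |(c • v) η - (c • φ) η| = |c| * |v η - φ η| := by
          simp only [Pi.smul_apply, smul_eq_mul]; rw [← mul_sub, abs_mul]
      _ ≤ (|c| + 1) * (ε / (|c| + 1)) :=
          mul_le_mul (by linarith) (hv' η hη) (abs_nonneg _) hc.le
      _ = ε := mul_div_cancel₀ ε hc.ne'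

lemma mem_newtonClosure_of_forall_exists {n : ℕ} {φ : EuclideanSpace ℝ (Fin n) → ℝ}
    (h : ∀ ε > 0, ∃ ψ ∈ newtonClosure n, ∀ η ∈ Metric.sphere 0 1, |ψ η - φ η| ≤ ε) :
    φ ∈ newtonClosure n := by
  intro ε hε
  obtain ⟨ψ, hψ, hψ'⟩ := h (ε / 2) (half_pos hε)
  obtain ⟨v, hv, hv'⟩ := hψ (ε / 2) (half_pos hε)
  refine ⟨v, hv, fun η hη => ?_⟩
  have := abs_sub_le (v η) (ψ η) (φ η)
  linarith [hv' η hη, hψ' η hη]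

lemma exists_abs_rpow_sub_sum_gegen_le {μ : ℝ} (hμ : 0 < μ) (k : ℕ) :
    ∃ K : ℝ, ∀ x : ℝ, |x| ≤ 1 → ∀ t : ℝ, 0 < t → t ≤ 1 / 4 →
      |(1 - 2 * x * t + t ^ 2) ^ (-μ) - ∑ j ∈ Finset.range k, gegen μ j x * t ^ j| ≤ K * t ^ k := by
  refine ⟨((1 - (1 / 2 : ℝ)) ^ 2) ^ (-μ) * 2 ^ k * 2, fun x hx t ht ht' => ?_⟩
  have h1 := hasSum_gegen μ hx (t := t) (by rw [abs_of_pos ht]; linarith)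
  have h2 := (hasSum_nat_add_iff' k).2 h1
  rw [← h2.tsum_eq, ← Real.norm_eq_abs]
  refine tsum_of_norm_bounded (g := fun j : ℕ =>
    ((1 - (1 / 2 : ℝ)) ^ 2) ^ (-μ) * 2 ^ k * t ^ k * (1 / 2) ^ j) ?_ fun j => ?_
  · convert! hasSum_geometric_two.mul_left (((1 - (1 / 2 : ℝ)) ^ 2) ^ (-μ) * 2 ^ k * t ^ k) using 1
    ring
  · have h3 := abs_gegen_le hμ hx (R := 1 / 2) (by norm_num) (by norm_num) (j + k)
    rw [Real.norm_eq_abs, abs_mul, abs_pow, abs_of_pos ht]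
    have h0 : (0 : ℝ) ≤ ((1 - (1 / 2 : ℝ)) ^ 2) ^ (-μ) := by positivity
    have h4 : (2 * t) ^ j ≤ (1 / 2) ^ j := pow_le_pow_left₀ (by positivity) (by linarith) j
    calc |gegen μ (j + k) x| * t ^ (j + k)
        ≤ (((1 - (1 / 2 : ℝ)) ^ 2) ^ (-μ) / (1 / 2) ^ (j + k)) * t ^ (j + k) := by gcongr
      _ = ((1 - (1 / 2 : ℝ)) ^ 2) ^ (-μ) * 2 ^ k * t ^ k * (2 * t) ^ j := by
          rw [one_div_pow, div_div_eq_mul_div, div_one, mul_pow, pow_add, pow_add]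
          ring
      _ ≤ _ := by gcongr

lemma norm_sub_inv_smul_sq {n : ℕ} {e η : EuclideanSpace ℝ (Fin n)} (he : ‖e‖ = 1)
    (hη : η ∈ Metric.sphere (0 : EuclideanSpace ℝ (Fin n)) 1) {t : ℝ} (ht : t ≠ 0) :
    ‖η - t⁻¹ • e‖ ^ 2 = (t ^ 2)⁻¹ * (1 - 2 * ⟪e, η⟫ * t + t ^ 2) := by
  rw [norm_sub_smul_sq he hη]
  field_simp
  ring

lemma rpow_mem_newtonClosure {n : ℕ} {e : EuclideanSpace ℝ (Fin n)} (he : ‖e‖ = 1) {t : ℝ}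
    (ht : 0 < t) (ht' : t < 1) :
    (fun η => (1 - 2 * ⟪e, η⟫ * t + t ^ 2) ^ (-(((n : ℝ) - 2) / 2))) ∈ newtonClosure n := by
  intro ε hε
  refine ⟨((t ^ 2)⁻¹ ^ (-(((n : ℝ) - 2) / 2)))⁻¹ • newton n (t⁻¹ • e), Submodule.smul_mem _ _
    (Submodule.subset_span ⟨t⁻¹ • e, ?_, rfl⟩), fun η hη => ?_⟩
  · rw [norm_smul, he, mul_one, Real.norm_eq_abs, abs_of_pos (inv_pos.2 ht)]
    exact (one_lt_inv₀ ht).2 ht'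
  · have h0 : 0 ≤ 1 - 2 * ⟪e, η⟫ * t + t ^ 2 := by
      rw [← norm_sub_smul_sq he hη]; positivity
    have h1 : (0 : ℝ) < (t ^ 2)⁻¹ ^ (-(((n : ℝ) - 2) / 2)) := Real.rpow_pos_of_pos (by positivity) _
    rw [Pi.smul_apply, newton, norm_sub_inv_smul_sq he hη ht.ne',
      Real.mul_rpow (by positivity) h0, smul_eq_mul, inv_mul_cancel_left₀ h1.ne']
    simpa using hε.le

lemma gegen_mem_newtonClosure {n : ℕ} (hn : 3 ≤ n) {e : EuclideanSpace ℝ (Fin n)} (he : ‖e‖ = 1)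
    (k : ℕ) : (fun η => gegen (((n : ℝ) - 2) / 2) k ⟪e, η⟫) ∈ newtonClosure n := by
  have hn' : (3 : ℝ) ≤ n := by exact_mod_cast hn
  induction k using Nat.strong_induction_on with
  | _ k ih =>
    obtain ⟨K, hK⟩ := exists_abs_rpow_sub_sum_gegen_le (μ := ((n : ℝ) - 2) / 2) (by linarith) (k + 1)
    refine mem_newtonClosure_of_forall_exists fun ε hε => ?_
    obtain ⟨t, ht, ht', htK⟩ : ∃ t : ℝ, 0 < t ∧ t ≤ 1 / 4 ∧ K * t ≤ ε := by
      refine ⟨min (1 / 4) (ε / (|K| + 1)), by positivity, min_le_left _ _, ?_⟩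
      calc K * min (1 / 4) (ε / (|K| + 1)) ≤ (|K| + 1) * (ε / (|K| + 1)) := by
            refine mul_le_mul (by linarith [le_abs_self K]) (min_le_right _ _) (by positivity)
              (by positivity)
        _ = ε := mul_div_cancel₀ ε (by positivity)
    refine ⟨(t ^ k)⁻¹ • ((fun η => (1 - 2 * ⟪e, η⟫ * t + t ^ 2) ^ (-(((n : ℝ) - 2) / 2))) -
      ∑ j ∈ Finset.range k, t ^ j • fun η => gegen (((n : ℝ) - 2) / 2) j ⟪e, η⟫),
      Submodule.smul_mem _ _ (Submodule.sub_mem _ (rpow_mem_newtonClosure he ht (by linarith))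
        (Submodule.sum_mem _ fun j hj => Submodule.smul_mem _ _ (ih j (Finset.mem_range.1 hj)))),
      fun η hη => ?_⟩
    have h1 := hK ⟪e, η⟫ (abs_le.2 (inner_mem_Icc_of_mem_sphere he hη)) t ht ht'
    rw [Finset.sum_range_succ] at h1
    have htk : 0 < t ^ k := pow_pos ht k
    simp only [Pi.smul_apply, Pi.sub_apply, Finset.sum_apply, smul_eq_mul]
    simp only [mul_comm (t ^ _) (gegen _ _ _)]
    set A := (1 - 2 * ⟪e, η⟫ * t + t ^ 2) ^ (-(((n : ℝ) - 2) / 2)) with hA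
    set B := ∑ j ∈ Finset.range k, gegen (((n : ℝ) - 2) / 2) j ⟪e, η⟫ * t ^ j
    set C := gegen (((n : ℝ) - 2) / 2) k ⟪e, η⟫
    have h2 : (t ^ k)⁻¹ * (A - B) - C = (t ^ k)⁻¹ * (A - (B + C * t ^ k)) := by
      field_simp
      ring
    rw [h2, abs_mul, abs_of_pos (inv_pos.2 htk)]
    calc (t ^ k)⁻¹ * |A - (B + C * t ^ k)| ≤ (t ^ k)⁻¹ * (K * t ^ (k + 1)) := by gcongr
      _ = K * t := by field_simp; ring
      _ ≤ ε := htK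

lemma inner_pow_mem_newtonClosure {n : ℕ} (hn : 3 ≤ n) {e : EuclideanSpace ℝ (Fin n)}
    (he : ‖e‖ = 1) (k : ℕ) : (fun η => ⟪e, η⟫ ^ k) ∈ newtonClosure n := by
  have hn' : (3 : ℝ) ≤ n := by exact_mod_cast hn
  induction k using Nat.strong_induction_on with
  | _ k ih =>
    have hpos := coeff_gegenPoly_self_pos (μ := ((n : ℝ) - 2) / 2) (by linarith) k
    have h : (fun η : EuclideanSpace ℝ (Fin n) => ⟪e, η⟫ ^ k) =
        ((gegenPoly (((n : ℝ) - 2) / 2) k).coeff k)⁻¹ •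
          ((fun η => gegen (((n : ℝ) - 2) / 2) k ⟪e, η⟫) -
            ∑ j ∈ Finset.range k, (gegenPoly (((n : ℝ) - 2) / 2) k).coeff j •
              fun η => ⟪e, η⟫ ^ j) := by
      ext η
      simp only [Pi.smul_apply, Pi.sub_apply, Finset.sum_apply, smul_eq_mul]
      rw [← eval_gegenPoly, Polynomial.eval_eq_sum_range' (Nat.lt_succ_of_le
        (natDegree_gegenPoly_le _ k)), Finset.sum_range_succ, add_sub_cancel_left,
        inv_mul_cancel_left₀ hpos.ne']
    rw [h]
    exact Submodule.smul_mem _ _ (Submodule.sub_mem _ (gegen_mem_newtonClosure hn he k)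
      (Submodule.sum_mem _ fun j hj => Submodule.smul_mem _ _ (ih j (Finset.mem_range.1 hj))))

lemma exp_inner_mem_newtonClosure {n : ℕ} (hn : 3 ≤ n) (y : EuclideanSpace ℝ (Fin n)) :
    (fun η => Real.exp ⟪y, η⟫) ∈ newtonClosure n := by
  obtain ⟨e, he, hye⟩ := exists_smul_eq_of_norm (by omega) y
  refine mem_newtonClosure_of_forall_exists fun ε hε => ?_
  have hu : TendstoUniformlyOn
      (fun (N : ℕ) (x : ℝ) => ∑ j ∈ Finset.range N, (‖y‖ * x) ^ j / (Nat.factorial j : ℝ))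
      (fun x => ∑' j : ℕ, (‖y‖ * x) ^ j / (Nat.factorial j : ℝ)) Filter.atTop
      (Set.Icc (-1) 1) := by
    refine tendstoUniformlyOn_tsum_nat (Real.summable_pow_div_factorial ‖y‖) fun j x hx => ?_
    rw [norm_div, norm_pow, norm_mul, norm_norm, Real.norm_natCast, Real.norm_eq_abs]
    have : ‖y‖ * |x| ≤ ‖y‖ := mul_le_of_le_one_right (norm_nonneg y) (abs_le.2 hx)
    gcongr
  obtain ⟨N, hN⟩ := (Metric.tendstoUniformlyOn_iff.1 hu ε hε).exists
  refine ⟨∑ j ∈ Finset.range N, (‖y‖ ^ j / (Nat.factorial j : ℝ)) • fun η => ⟪e, η⟫ ^ j,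
    Submodule.sum_mem _ fun j _ => Submodule.smul_mem _ _ (inner_pow_mem_newtonClosure hn he j),
    fun η hη => ?_⟩
  have h1 := hN _ (inner_mem_Icc_of_mem_sphere he hη)
  rw [(NormedSpace.expSeries_div_hasSum_exp (‖y‖ * ⟪e, η⟫)).tsum_eq, ← Real.exp_eq_exp_ℝ,
    dist_comm, Real.dist_eq] at h1
  have h2 : ⟪y, η⟫ = ‖y‖ * ⟪e, η⟫ := by
    conv_lhs => rw [hye]
    rw [inner_smul_left, conj_trivial]
  rw [h2]
  refine le_of_eq_of_le ?_ h1.le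
  congr 2
  simp only [Finset.sum_apply, Pi.smul_apply, smul_eq_mul]
  exact Finset.sum_congr rfl fun j _ => by ring

/-- The multiplicative family of exponentials of linear forms on the unit sphere. -/
noncomputable def expInner (n : ℕ) : Multiplicative (EuclideanSpace ℝ (Fin n)) →*
    C(Metric.sphere (0 : EuclideanSpace ℝ (Fin n)) 1, ℝ) where
  toFun y := ⟨fun η => Real.exp ⟪y.toAdd, (η : EuclideanSpace ℝ (Fin n))⟫, by fun_prop⟩
  map_one' := by ext; simp
  map_mul' y z := by ext; simp [inner_add_left, Real.exp_add]

lemma mem_newtonClosure_of_continuousOn {n : ℕ} (hn : 3 ≤ n) {φ : EuclideanSpace ℝ (Fin n) → ℝ}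
    (hφ : ContinuousOn φ (Metric.sphere 0 1)) : φ ∈ newtonClosure n := by
  refine mem_newtonClosure_of_forall_exists fun ε hε => ?_
  have hsep : (Algebra.adjoin ℝ (Set.range (expInner n))).SeparatesPoints := by
    intro η ζ hηζ
    refine ⟨_, ⟨expInner n (Multiplicative.ofAdd (η - ζ : EuclideanSpace ℝ (Fin n))),
      Algebra.subset_adjoin ⟨_, rfl⟩, rfl⟩, fun h => hηζ (Subtype.ext ?_)⟩
    have h1 : ⟪(η - ζ : EuclideanSpace ℝ (Fin n)), η⟫ = ⟪(η - ζ : EuclideanSpace ℝ (Fin n)), ζ⟫ :=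
      Real.exp_injective h
    rw [← sub_eq_zero, ← inner_sub_right, inner_self_eq_zero, sub_eq_zero] at h1
    exact h1
  obtain ⟨⟨g, hga⟩, hg⟩ := ContinuousMap.exists_mem_subalgebra_near_continuous_of_separatesPoints _ hsep
    (fun η : Metric.sphere (0 : EuclideanSpace ℝ (Fin n)) 1 => φ η)
    (continuousOn_iff_continuous_domRestrict.1 hφ) ε hε
  have hgs : g ∈ Submodule.span ℝ (Set.range (expInner n)) := by
    rwa [← Subalgebra.mem_toSubmodule, Algebra.adjoin_eq_span, ← MonoidHom.coe_mrange,
      Submonoid.closure_eq] at hga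
  obtain ⟨ψ, hψ, hψg⟩ : ∃ ψ ∈ newtonClosure n,
      ∀ η : Metric.sphere (0 : EuclideanSpace ℝ (Fin n)) 1, ψ η = g η := by
    clear hg hga
    induction hgs using Submodule.span_induction with
    | mem f hf =>
      obtain ⟨y, rfl⟩ := hf
      exact ⟨_, exp_inner_mem_newtonClosure hn y.toAdd, fun η => rfl⟩
    | zero => exact ⟨0, Submodule.zero_mem _, fun η => rfl⟩
    | add f g _ _ hf hg =>
      obtain ⟨ψ, hψ, h⟩ := hf
      obtain ⟨ψ', hψ', h'⟩ := hg
      exact ⟨ψ + ψ', Submodule.add_mem _ hψ hψ', fun η => by simp [h, h']⟩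
    | smul c f _ hf =>
      obtain ⟨ψ, hψ, h⟩ := hf
      exact ⟨c • ψ, Submodule.smul_mem _ c hψ, fun η => by simp [h]⟩
  exact ⟨ψ, hψ, fun η hη => by simpa [hψg ⟨η, hη⟩] using (hg ⟨η, hη⟩).le⟩

lemma IsHarmonicOnBall.sub {n : ℕ} {u v : EuclideanSpace ℝ (Fin n) → ℝ}
    (hu : IsHarmonicOnBall n u) (hv : IsHarmonicOnBall n v) : IsHarmonicOnBall n (u - v) := by
  refine ⟨hu.1.sub hv.1, fun z hz => ?_⟩
  have hz' := Metric.isOpen_ball.mem_nhds hz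
  have h : ∀ w : Fin 2 → EuclideanSpace ℝ (Fin n), iteratedFDeriv ℝ 2 (u - v) z w =
      iteratedFDeriv ℝ 2 u z w - iteratedFDeriv ℝ 2 v z w := fun w => by
    rw [iteratedFDeriv_sub_apply (hu.1.contDiffAt hz') (hv.1.contDiffAt hz')]
    rfl
  simp only [h, Finset.sum_sub_distrib, hu.2 z hz, hv.2 z hz, sub_zero]

lemma abs_sub_le_of_forall_sphere {n : ℕ} (hn : 0 < n) {u v : EuclideanSpace ℝ (Fin n) → ℝ}
    (hu : IsHarmonicOnBall n u) (huc : ContinuousOn u (Metric.closedBall 0 1))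
    (hv : IsHarmonicOnBall n v) (hvc : ContinuousOn v (Metric.closedBall 0 1)) {m : ℝ}
    (hm : ∀ η ∈ Metric.sphere (0 : EuclideanSpace ℝ (Fin n)) 1, |u η - v η| ≤ m)
    {z : EuclideanSpace ℝ (Fin n)} (hz : z ∈ Metric.closedBall 0 1) : |u z - v z| ≤ m := by
  rw [abs_sub_le_iff]
  exact ⟨le_of_forall_sphere_le hn (hu.sub hv) (huc.sub hvc)
      (fun η hη => (abs_sub_le_iff.1 (hm η hη)).1) hz,
    le_of_forall_sphere_le hn (hv.sub hu) (hvc.sub huc)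
      (fun η hη => (abs_sub_le_iff.1 (hm η hη)).2) hz⟩

lemma isHarmonicOnBall_const (n : ℕ) (c : ℝ) : IsHarmonicOnBall n fun _ => c := by
  refine ⟨contDiffOn_const, fun z _ => ?_⟩
  rw [iteratedFDeriv_const_of_ne (by norm_num)]
  simp

lemma abs_le_supAbs {n : ℕ} {u : EuclideanSpace ℝ (Fin n) → ℝ} {M : ℝ}
    (hM : ∀ y ∈ Metric.ball (0 : EuclideanSpace ℝ (Fin n)) 1, |u y| ≤ M)
    {z : EuclideanSpace ℝ (Fin n)} (hz : z ∈ Metric.ball 0 1) : |u z| ≤ supAbs n u :=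
  le_ciSup (f := fun y : Metric.ball (0 : EuclideanSpace ℝ (Fin n)) 1 => |u y.1|)
    ⟨M, by rintro _ ⟨y, rfl⟩; exact hM y.1 y.2⟩ ⟨z, hz⟩

lemma supAbs_le {n : ℕ} {u : EuclideanSpace ℝ (Fin n) → ℝ} {M : ℝ}
    (hM : ∀ y ∈ Metric.ball (0 : EuclideanSpace ℝ (Fin n)) 1, |u y| ≤ M) : supAbs n u ≤ M := by
  have : Nonempty (Metric.ball (0 : EuclideanSpace ℝ (Fin n)) 1) :=
    ⟨⟨0, Metric.mem_ball_self one_pos⟩⟩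
  exact ciSup_le fun y => hM y.1 y.2

lemma dirBound_nonneg {n : ℕ} {x : EuclideanSpace ℝ (Fin n)} (hx : ‖x‖ < 1)
    (ℓ : EuclideanSpace ℝ (Fin n)) : 0 ≤ dirBound n x ℓ := by
  have := abs_dirFunctional_le hx ℓ (φ := fun _ => 1) continuousOn_const (M := 1) (by simp)
  linarith [abs_nonneg (dirFunctional n x ℓ fun _ => 1)]

lemma dirBound_le {n : ℕ} (hn : 3 ≤ n) {x : EuclideanSpace ℝ (Fin n)} {R : ℝ} (hx : ‖x‖ ≤ R)
    (hR : R < 1) (ℓ : EuclideanSpace ℝ (Fin n)) :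
    dirBound n x ℓ ≤ (1 - R ^ 2)⁻¹ * (2 * n * ‖ℓ‖) := by
  have hn' : (3 : ℝ) ≤ n := by exact_mod_cast hn
  have hx1 : ‖x‖ < 1 := hx.trans_lt hR
  have hR2 : 0 < 1 - R ^ 2 := by nlinarith [norm_nonneg x]
  have hxR : 1 - R ^ 2 ≤ 1 - ‖x‖ ^ 2 := by nlinarith [norm_nonneg x]
  have hc := continuousOn_norm_sub_rpow hx1 (-(((n : ℝ) - 2) / 2))
  have h1 : sphMean n (fun η => (‖η - x‖ ^ 2) ^ (-(((n : ℝ) - 2) / 2)) *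
      |((n : ℝ) - 2) * ⟪x, ℓ⟫ - n * ⟪η, ℓ⟫|) ≤ 2 * n * ‖ℓ‖ := by
    have h2 : sphMean n (fun η => 2 * n * ‖ℓ‖ * (‖η - x‖ ^ 2) ^ (-(((n : ℝ) - 2) / 2))) =
        2 * n * ‖ℓ‖ := by
      rw [sphMean_const_mul, sphMean_norm_sub_rpow hn hx1, mul_one]
    refine le_of_le_of_eq (sphMean_mono (hc.mul (by fun_prop)) (continuousOn_const.mul hc)
      fun η hη => ?_) h2
    rw [mul_comm]
    refine mul_le_mul_of_nonneg_right ?_ (by positivity)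
    have h3 : |⟪x, ℓ⟫| ≤ ‖ℓ‖ := (abs_real_inner_le_norm x ℓ).trans
      (mul_le_of_le_one_left (norm_nonneg _) hx1.le)
    have h4 : |⟪η, ℓ⟫| ≤ ‖ℓ‖ := (abs_real_inner_le_norm η ℓ).trans
      (by rw [mem_sphere_zero_iff_norm.1 hη, one_mul])
    refine (abs_sub _ _).trans ?_
    rw [abs_mul, abs_mul, abs_of_nonneg (by linarith : (0 : ℝ) ≤ (n : ℝ) - 2),
      abs_of_nonneg (by linarith : (0 : ℝ) ≤ (n : ℝ))]
    nlinarith [norm_nonneg ℓ, mul_le_mul_of_nonneg_left h3 (by linarith : (0 : ℝ) ≤ (n : ℝ) - 2),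
      mul_le_mul_of_nonneg_left h4 (by linarith : (0 : ℝ) ≤ (n : ℝ))]
  rw [dirBound]
  exact mul_le_mul (inv_anti₀ hR2 hxR) h1 (by
    have := dirBound_nonneg hx1 ℓ
    rw [dirBound] at this
    exact nonneg_of_mul_nonneg_right this (inv_pos.2 (hR2.trans_le hxR))) (inv_pos.2 hR2).le

lemma inner_gradient_eq_dirFunctional {n : ℕ} (hn : 3 ≤ n) {u : EuclideanSpace ℝ (Fin n) → ℝ}
    (hu : IsHarmonicOnBall n u) (huc : ContinuousOn u (Metric.closedBall 0 1))
    {x : EuclideanSpace ℝ (Fin n)} (hx : ‖x‖ < 1) (ℓ : EuclideanSpace ℝ (Fin n)) :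
    ⟪gradient u x, ℓ⟫ = dirFunctional n x ℓ u := by
  obtain ⟨R, hxR, hR⟩ := exists_between hx
  have hucS := huc.mono Metric.sphere_subset_closedBall
  choose v hv hvu using fun m : ℕ => mem_newtonClosure_of_continuousOn hn hucS (1 / ((m : ℝ) + 1))
    Nat.one_div_pos_of_nat
  have hball : ∀ h : ℝ, ‖x + h • ℓ‖ < R → x + h • ℓ ∈ Metric.ball (0 : EuclideanSpace ℝ (Fin n)) 1 :=
    fun h hh => mem_ball_zero_iff.2 (hh.trans hR)
  have hline : ∀ h : ℝ, HasDerivAt (fun h : ℝ => x + h • ℓ) ℓ h := fun h => by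
    simpa using ((hasDerivAt_id h).smul_const ℓ).const_add x
  have hvS : ∀ m, ContinuousOn (v m) (Metric.sphere 0 1) := fun m =>
    (continuousOn_of_mem_newtonSpan (hv m)).mono Metric.sphere_subset_closedBall
  have hlim := tendsto_one_div_add_atTop_nhds_zero_nat (𝕜 := ℝ)
  have hunif : TendstoUniformlyOn (fun (m : ℕ) (h : ℝ) => dirFunctional n (x + h • ℓ) ℓ (v m))
      (fun h => dirFunctional n (x + h • ℓ) ℓ u) Filter.atTop {h : ℝ | ‖x + h • ℓ‖ < R} := by
    rw [Metric.tendstoUniformlyOn_iff]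
    intro ε hε
    have hlim' := hlim.const_mul ((1 - R ^ 2)⁻¹ * (2 * n * ‖ℓ‖))
    rw [mul_zero] at hlim'
    filter_upwards [hlim'.eventually_lt_const hε] with m hm h hh
    have hh' : ‖x + h • ℓ‖ < 1 := lt_trans hh hR
    rw [dist_comm, Real.dist_eq, ← dirFunctional_sub hh' ℓ (hvS m) hucS]
    refine lt_of_le_of_lt ((abs_dirFunctional_le hh' ℓ ((hvS m).sub hucS)
      (M := 1 / ((m : ℝ) + 1)) (hvu m)).trans ?_) hm
    exact mul_le_mul_of_nonneg_right (dirBound_le hn (le_of_lt hh) hR ℓ) (by positivity)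
  have hder : HasDerivAt (fun h : ℝ => u (x + h • ℓ)) (dirFunctional n (x + (0 : ℝ) • ℓ) ℓ u) 0 := by
    refine hasDerivAt_of_tendstoUniformlyOn (f := fun m h => v m (x + h • ℓ))
      (isOpen_lt (by fun_prop) continuous_const) hunif
      (Filter.Eventually.of_forall fun m h hh => ?_) (fun h hh => ?_) (by simpa using hxR)
    · have hh' : ‖x + h • ℓ‖ < 1 := lt_trans hh hR
      rw [← inner_gradient_of_mem_newtonSpan hn (hv m) hh', inner_gradient_left]
      have h1 : HasFDerivAt (v m) (fderiv ℝ (v m) (x + h • ℓ)) (x + h • ℓ) :=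
        ((contDiffAt_of_mem_newtonSpan (hv m) hh'.le).differentiableAt (by simp)).hasFDerivAt
      exact h1.comp_hasDerivAt h (hline h)
    · rw [tendsto_iff_dist_tendsto_zero]
      refine squeeze_zero (fun _ => dist_nonneg) (fun m => ?_) hlim
      rw [Real.dist_eq]
      exact abs_sub_le_of_forall_sphere (by omega) (isHarmonicOnBall_of_mem_newtonSpan (hv m))
        (continuousOn_of_mem_newtonSpan (hv m)) hu huc (hvu m)
        (Metric.ball_subset_closedBall (hball h hh))
  rw [inner_gradient_left]
  have hd : HasFDerivAt u (fderiv ℝ u x) (x + (0 : ℝ) • ℓ) := by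
    simpa using ((hu.1.contDiffAt (Metric.isOpen_ball.mem_nhds
      (mem_ball_zero_iff.2 hx))).differentiableAt (by simp)).hasFDerivAt
  have h2 : HasDerivAt (fun h : ℝ => u (x + h • ℓ)) (fderiv ℝ u x ℓ) 0 :=
    (hd.comp_hasDerivAt (0 : ℝ) (hline 0) :)
  simpa using h2.unique hder

lemma smul_mem_ball_of_mem_closedBall {n : ℕ} {r : ℝ} (hr : 0 < r) (hr' : r < 1)
    {z : EuclideanSpace ℝ (Fin n)} (hz : z ∈ Metric.closedBall 0 1) :
    r • z ∈ Metric.ball (0 : EuclideanSpace ℝ (Fin n)) 1 := by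
  rw [mem_ball_zero_iff, norm_smul, Real.norm_eq_abs, abs_of_pos hr]
  exact (mul_le_of_le_one_right hr.le (mem_closedBall_zero_iff.1 hz)).trans_lt hr'

lemma IsHarmonicOnBall.comp_smul {n : ℕ} {u : EuclideanSpace ℝ (Fin n) → ℝ}
    (hu : IsHarmonicOnBall n u) {r : ℝ} (hr : 0 < r) (hr' : r < 1) :
    IsHarmonicOnBall n fun z => u (r • z) := by
  have hmem : ∀ z ∈ Metric.ball (0 : EuclideanSpace ℝ (Fin n)) 1,
      r • z ∈ Metric.ball (0 : EuclideanSpace ℝ (Fin n)) 1 := fun z hz =>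
    smul_mem_ball_of_mem_closedBall hr hr' (Metric.ball_subset_closedBall hz)
  have hcd : ContDiffOn ℝ 2 (fun z => u (r • z)) (Metric.ball 0 1) :=
    hu.1.comp (by fun_prop) hmem
  refine ⟨hcd, fun z hz => ?_⟩
  have h : ∀ v : EuclideanSpace ℝ (Fin n), iteratedFDeriv ℝ 2 (fun z => u (r • z)) z ![v, v] =
      r ^ 2 * iteratedFDeriv ℝ 2 u (r • z) ![v, v] := by
    intro v
    rw [← deriv_deriv_line_eq_iteratedFDeriv (hcd.contDiffAt (Metric.isOpen_ball.mem_nhds hz))]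
    simp only [smul_add, smul_comm r _ v]
    rw [deriv_deriv_line_eq_iteratedFDeriv (hu.1.contDiffAt
      (Metric.isOpen_ball.mem_nhds (hmem z hz)))]
    have h1 := (iteratedFDeriv ℝ 2 u (r • z)).map_smul_univ (fun _ => r) ![v, v]
    rw [← Fin.prod_const, ← smul_eq_mul, ← h1]
    congr 1
    ext i
    fin_cases i <;> rfl
  simp only [h, ← Finset.mul_sum, hu.2 _ (hmem z hz), mul_zero]

lemma abs_inner_gradient_le {n : ℕ} (hn : 3 ≤ n) {u : EuclideanSpace ℝ (Fin n) → ℝ}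
    (hu : IsHarmonicOnBall n u) {M : ℝ}
    (hM : ∀ y ∈ Metric.ball (0 : EuclideanSpace ℝ (Fin n)) 1, |u y| ≤ M)
    {x : EuclideanSpace ℝ (Fin n)} (hx : ‖x‖ < 1) (ℓ : EuclideanSpace ℝ (Fin n)) :
    |⟪gradient u x, ℓ⟫| ≤ dirBound n x ℓ * M := by
  have hxb : x ∈ Metric.ball (0 : EuclideanSpace ℝ (Fin n)) 1 := mem_ball_zero_iff.2 hx
  have hux : ContDiffAt ℝ 2 u x := hu.1.contDiffAt (Metric.isOpen_ball.mem_nhds hxb)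
  have hr : ∀ r ∈ Set.Ioo (0 : ℝ) 1, |r * fderiv ℝ u (r • x) ℓ| ≤ dirBound n x ℓ * M := by
    intro r hr
    have hc : ContinuousOn (fun z => u (r • z)) (Metric.closedBall 0 1) :=
      hu.1.continuousOn.comp (by fun_prop) fun z hz =>
        smul_mem_ball_of_mem_closedBall hr.1 hr.2 hz
    have hd : HasFDerivAt u (fderiv ℝ u (r • x)) (r • x) :=
      ((hu.1.contDiffAt (Metric.isOpen_ball.mem_nhds (smul_mem_ball_of_mem_closedBall hr.1 hr.2
        (Metric.ball_subset_closedBall hxb)))).differentiableAt (by simp)).hasFDerivAt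
    have h1 : fderiv ℝ (fun z => u (r • z)) x ℓ = r * fderiv ℝ u (r • x) ℓ := by
      have h2 : HasFDerivAt (fun z : EuclideanSpace ℝ (Fin n) => r • z)
          (r • ContinuousLinearMap.id ℝ _) x := (hasFDerivAt_id x).const_smul r
      have h3 : HasFDerivAt (fun z => u (r • z))
        ((fderiv ℝ u (r • x)).comp (r • ContinuousLinearMap.id ℝ _)) x := hd.comp x h2
      rw [h3.fderiv]
      simp
    rw [← h1, ← inner_gradient_left,
      inner_gradient_eq_dirFunctional hn (hu.comp_smul hr.1 hr.2) hc hx]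
    exact abs_dirFunctional_le hx ℓ (hc.mono Metric.sphere_subset_closedBall) fun η hη =>
      hM _ (smul_mem_ball_of_mem_closedBall hr.1 hr.2 (Metric.sphere_subset_closedBall hη))
  have hcf : ContinuousAt (fderiv ℝ u) x := (hux.fderiv_right (m := 1) (by norm_num)).continuousAt
  have hlim : Filter.Tendsto (fun r : ℝ => |r * fderiv ℝ u (r • x) ℓ|) (nhdsWithin 1 (Set.Iio 1))
      (nhds |fderiv ℝ u x ℓ|) := by
    have h1 : ContinuousAt (fun r : ℝ => |r * fderiv ℝ u (r • x) ℓ|) 1 := by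
      have h2 : ContinuousAt (fun r : ℝ => fderiv ℝ u (r • x)) 1 :=
        ContinuousAt.comp (by simpa using hcf) (by fun_prop)
      exact (continuousAt_id.mul (h2.clm_apply continuousAt_const)).abs
    have h3 := h1.tendsto
    simp only [one_smul, one_mul] at h3
    exact h3.mono_left nhdsWithin_le_nhds
  rw [inner_gradient_left]
  exact le_of_tendsto hlim (Filter.mem_of_superset
    (Ioo_mem_nhdsLT (zero_lt_one (α := ℝ))) hr)

lemma le_dirFunctional_comp_kelvin {n : ℕ} (hn : 3 ≤ n) {x : EuclideanSpace ℝ (Fin n)}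
    (hx : ‖x‖ < 1) (ℓ : EuclideanSpace ℝ (Fin n)) {ε : ℝ} (hε : 0 < ε) :
    dirBound n x ℓ - (1 - ‖x‖ ^ 2)⁻¹ * ε ≤ dirFunctional n x ℓ fun η =>
      (((n : ℝ) - 2) * ⟪x, ℓ⟫ - n * ⟪kelvin x η, ℓ⟫) /
        (|((n : ℝ) - 2) * ⟪x, ℓ⟫ - n * ⟪kelvin x η, ℓ⟫| + ε) := by
  have hs : 0 < 1 - ‖x‖ ^ 2 := by nlinarith [norm_nonneg x]
  have hc := continuousOn_norm_sub_rpow hx (-(((n : ℝ) - 2) / 2))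
  have hc1 : ContinuousOn (fun η : EuclideanSpace ℝ (Fin n) =>
      (‖η - x‖ ^ 2) ^ (-(((n : ℝ) - 2) / 2)) * |((n : ℝ) - 2) * ⟪x, ℓ⟫ - n * ⟪η, ℓ⟫|)
      (Metric.sphere 0 1) := hc.mul (by fun_prop)
  have hc2 : ContinuousOn (fun η : EuclideanSpace ℝ (Fin n) =>
      ε * (‖η - x‖ ^ 2) ^ (-(((n : ℝ) - 2) / 2))) (Metric.sphere 0 1) := continuousOn_const.mul hc
  have hc3 : ContinuousOn (fun η : EuclideanSpace ℝ (Fin n) =>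
      (((n : ℝ) - 2) * ⟪x, ℓ⟫ - n * ⟪η, ℓ⟫) / (|((n : ℝ) - 2) * ⟪x, ℓ⟫ - n * ⟪η, ℓ⟫| + ε))
      (Metric.sphere 0 1) :=
    ContinuousOn.div₀ (by fun_prop) (by fun_prop) fun η _ => by positivity
  have h1 : sphMean n (fun η => ε * (‖η - x‖ ^ 2) ^ (-(((n : ℝ) - 2) / 2))) = ε := by
    rw [sphMean_const_mul, sphMean_norm_sub_rpow hn hx, mul_one]
  have h2 : dirBound n x ℓ - (1 - ‖x‖ ^ 2)⁻¹ * ε = (1 - ‖x‖ ^ 2)⁻¹ * sphMean n (fun η =>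
      (‖η - x‖ ^ 2) ^ (-(((n : ℝ) - 2) / 2)) * |((n : ℝ) - 2) * ⟪x, ℓ⟫ - n * ⟪η, ℓ⟫| -
        ε * (‖η - x‖ ^ 2) ^ (-(((n : ℝ) - 2) / 2))) := by
    rw [sphMean_sub hc1 hc2, h1, mul_sub, dirBound]
  rw [h2, dirFunctional]
  refine mul_le_mul_of_nonneg_left (sphMean_mono (hc1.sub hc2)
    (continuousOn_dirKernel_mul hx ℓ (continuousOn_comp_kelvin hx hc3)) fun η hη => ?_)
    (inv_pos.2 hs).le
  rw [kelvin_kelvin (ne_of_mem_sphere_of_norm_lt hη hx) hx, mul_comm ε, ← mul_sub, mul_assoc]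
  refine mul_le_mul_of_nonneg_left ?_ (by positivity)
  generalize ((n : ℝ) - 2) * ⟪x, ℓ⟫ - n * ⟪η, ℓ⟫ = b
  rw [mul_div_assoc', le_div_iff₀ (by positivity)]
  nlinarith [abs_mul_abs_self b]

lemma dirBound_le_of_forall {n : ℕ} (hn : 3 ≤ n) {x : EuclideanSpace ℝ (Fin n)} (hx : ‖x‖ < 1)
    (ℓ : EuclideanSpace ℝ (Fin n)) {c : ℝ}
    (h : ∀ u : EuclideanSpace ℝ (Fin n) → ℝ, IsHarmonicOnBall n u →
      (∃ M : ℝ, ∀ y ∈ Metric.ball (0 : EuclideanSpace ℝ (Fin n)) 1, |u y| ≤ M) →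
      |⟪gradient u x, ℓ⟫| ≤ c * supAbs n u) : dirBound n x ℓ ≤ c := by
  have hs : 0 < 1 - ‖x‖ ^ 2 := by nlinarith [norm_nonneg x]
  have hB := dirBound_nonneg hx ℓ
  have hc : 0 ≤ c := by
    have h1 := h (fun _ => 1) (isHarmonicOnBall_const n 1) ⟨1, by simp⟩
    have h2 : (1 : ℝ) ≤ supAbs n fun _ => 1 := by
      simpa using abs_le_supAbs (n := n) (u := fun _ => 1) (M := 1) (by simp)
        (Metric.mem_ball_self one_pos)
    exact nonneg_of_mul_nonneg_left ((abs_nonneg _).trans h1) (by linarith)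
  have key : ∀ ε > 0, dirBound n x ℓ ≤
      c + ε * ((1 - ‖x‖ ^ 2)⁻¹ + dirBound n x ℓ + c) := by
    intro ε hε
    set φ : EuclideanSpace ℝ (Fin n) → ℝ := fun η =>
      (((n : ℝ) - 2) * ⟪x, ℓ⟫ - n * ⟪kelvin x η, ℓ⟫) /
        (|((n : ℝ) - 2) * ⟪x, ℓ⟫ - n * ⟪kelvin x η, ℓ⟫| + ε) with hφ
    have h1 : dirBound n x ℓ - (1 - ‖x‖ ^ 2)⁻¹ * ε ≤ dirFunctional n x ℓ φ :=
      le_dirFunctional_comp_kelvin hn hx ℓ hε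
    have hφc : ContinuousOn φ (Metric.sphere 0 1) := by
      have hk := continuousOn_kelvin hx
      exact ContinuousOn.div₀ (by fun_prop) (by fun_prop) fun η _ => by positivity
    have hφ1 : ∀ η, |φ η| ≤ 1 := by
      intro η
      simp only [hφ]
      rw [abs_div, abs_of_pos (a := _ + ε) (by positivity), div_le_one (by positivity)]
      linarith
    obtain ⟨v, hv, hvφ⟩ := mem_newtonClosure_of_continuousOn hn hφc ε hε
    have hvc := continuousOn_of_mem_newtonSpan hv
    have hvS := hvc.mono Metric.sphere_subset_closedBall
    have hvb : ∀ y ∈ Metric.ball (0 : EuclideanSpace ℝ (Fin n)) 1, |v y| ≤ 1 + ε := by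
      intro y hy
      have := abs_sub_le_of_forall_sphere (m := 1 + ε) (by omega)
        (isHarmonicOnBall_of_mem_newtonSpan hv) hvc (isHarmonicOnBall_const n 0)
        continuousOn_const (fun η hη => by
          rw [sub_zero]
          have := abs_add_le (v η - φ η) (φ η)
          rw [sub_add_cancel] at this
          linarith [hvφ η hη, hφ1 η]) (Metric.ball_subset_closedBall hy)
      rwa [sub_zero] at this
    have h2 := h v (isHarmonicOnBall_of_mem_newtonSpan hv) ⟨1 + ε, hvb⟩
    rw [inner_gradient_of_mem_newtonSpan hn hv hx] at h2
    have h3 := abs_dirFunctional_le hx ℓ (hvS.sub hφc) hvφ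
    rw [dirFunctional_sub hx ℓ hvS hφc] at h3
    have h4 := mul_le_mul_of_nonneg_left (supAbs_le hvb) hc
    linarith [le_abs_self (dirFunctional n x ℓ v),
      neg_abs_le (dirFunctional n x ℓ v - dirFunctional n x ℓ φ)]
  refine le_of_forall_pos_le_add fun δ hδ => ?_
  have hK : 0 < (1 - ‖x‖ ^ 2)⁻¹ + dirBound n x ℓ + c := by
    have := inv_pos.2 hs
    linarith
  simpa [div_mul_cancel₀ _ hK.ne'] using key (δ / _) (div_pos hδ hK)

lemma dirConst_eq_dirBound {n : ℕ} (hn : 3 ≤ n) {x : EuclideanSpace ℝ (Fin n)} (hx : ‖x‖ < 1)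
    (ℓ : EuclideanSpace ℝ (Fin n)) : dirConst n x ℓ = dirBound n x ℓ :=
  IsLeast.csInf_eq ⟨fun _ hu ⟨_, hM⟩ =>
    abs_inner_gradient_le hn hu (fun _ hy => abs_le_supAbs hM hy) hx ℓ,
    fun _ hc => dirBound_le_of_forall hn hx ℓ hc⟩

lemma two_mul_gegenRatio_div_gegen_one {ν : ℝ} (hν : 2 < ν) (k : ℕ) :
    2 * (gegenRatio ((ν - 2) / 2) (k + 1) * gegenRatio ((ν - 2) / 2 + 1) k) /
      gegen ((ν - 2) / 2) (k + 2) 1 =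
      2 / (ν ^ 2 - 1) * ((Nat.factorial k : ℝ) / poch (ν + 2) k) := by
  have h1 : poch (ν - 2) (k + 2) * ((ν + k) * (ν + k + 1)) =
      (ν - 2) * ((ν - 1) * (ν * ((ν + 1) * poch (ν + 2) k))) := by
    have h2 : poch (ν - 2) (k + 2 + 1 + 1) =
        (ν - 2) * ((ν - 1) * (ν * ((ν + 1) * poch (ν + 2) k))) := by
      rw [poch_succ_left, poch_succ_left, poch_succ_left, poch_succ_left,
        show ν - 2 + 1 + 1 + 1 + 1 = ν + 2 by ring, show ν - 2 + 1 + 1 + 1 = ν + 1 by ring,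
        show ν - 2 + 1 + 1 = ν by ring, show ν - 2 + 1 = ν - 1 by ring]
    rw [← h2, poch_succ (ν - 2) (k + 2 + 1), poch_succ (ν - 2) (k + 2)]
    push_cast
    ring
  have hp : 0 < poch (ν + 2) k := poch_pos (by linarith) k
  have hp' : 0 < poch (ν - 2) (k + 2) := poch_pos (by linarith) _
  rw [gegen_one_right (by linarith), gegenRatio, gegenRatio,
    show 2 * ((ν - 2) / 2) = ν - 2 by ring, show 2 * ((ν - 2) / 2 + 1) = ν by ring,
    Nat.factorial_succ, Nat.factorial_succ]
  push_cast
  have hk : (0 : ℝ) ≤ k := k.cast_nonneg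
  have e1 : ν ^ 2 - 1 = (ν - 1) * (ν + 1) := by ring
  have e2 : (k : ℝ) + 1 + 1 + (ν - 2) = ν + k := by ring
  have e3 : (k : ℝ) + 1 + ν = ν + k + 1 := by ring
  rw [e1, e2, e3]
  have n1 : ν - 1 ≠ 0 := by linarith
  have n2 : ν + 1 ≠ 0 := by linarith
  have n3 : ν + k ≠ 0 := by linarith
  have n4 : ν + k + 1 ≠ 0 := by linarith
  have n5 : (k : ℝ) + 1 ≠ 0 := by linarith
  have n6 : (k : ℝ) + 1 + 1 ≠ 0 := by linarith
  have n7 := hp.ne'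
  have n8 := hp'.ne'
  have n9 : (Nat.factorial k : ℝ) ≠ 0 := by positivity
  generalize (Nat.factorial k : ℝ) = F at *
  generalize poch (ν + 2) k = P at *
  generalize poch (ν - 2) (k + 2) = Q at *
  field_simp
  linear_combination (-1 : ℝ) * h1

lemma nat_mul_sphKappa_zero {n : ℕ} (hn : 3 ≤ n) : n * sphKappa n 0 =
    2 * Real.Gamma (((n : ℝ) + 2) / 2) / (Real.Gamma (1 / 2) * Real.Gamma (((n : ℝ) - 1) / 2)) := by
  have hn' : (3 : ℝ) ≤ n := by exact_mod_cast hn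
  rw [sphKappa_zero, show ((n : ℝ) + 2) / 2 = n / 2 + 1 by ring,
    Real.Gamma_add_one (by linarith)]
  ring

lemma sphMean_abs_sub_inner_mul_norm_sub_rpow {n : ℕ} (hn : 3 ≤ n)
    {e ℓ f : EuclideanSpace ℝ (Fin n)} (hℓ : ‖ℓ‖ = 1) (hf : ‖f‖ = 1)
    (hℓf : ⟪ℓ, f⟫ = 0) {c s : ℝ} (hcs : c ^ 2 + s ^ 2 = 1) (he : e = c • ℓ + s • f)
    (he1 : ‖e‖ = 1) {ρ a : ℝ} (hρ : |ρ| < 1) (ha : a ∈ Set.Ioo (-1) 1) :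
    sphMean n (fun η => |a - ⟪ℓ, η⟫| * (‖η - ρ • e‖ ^ 2) ^ (-(((n : ℝ) - 2) / 2))) =
      sphKappa n 0 * ((∫ t in (-1 : ℝ)..1, |a - t| * gegenWeight (((n : ℝ) - 2) / 2) t) +
        ((n : ℝ) - 2) * ρ * c *
          (∫ t in (-1 : ℝ)..1, |a - t| * gegenWeight (((n : ℝ) - 2) / 2) t * t) +
        2 / ((n : ℝ) ^ 2 - 1) * gegenWeight (((n : ℝ) - 2) / 2 + 2) a *
          ∑' k : ℕ, (Nat.factorial k : ℝ) / poch ((n : ℝ) + 2) k *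
            gegen (((n : ℝ) - 2) / 2 + 2) k a * gegen (((n : ℝ) - 2) / 2) (k + 2) c *
              ρ ^ (k + 2)) := by
  have hn' : (3 : ℝ) ≤ n := by exact_mod_cast hn
  have hs := hasSum_sphMean_mul_gegen hn he1 hρ (h := fun η => |a - ⟪ℓ, η⟫|) (by fun_prop)
  have hterm : ∀ k, sphMean n (fun η => |a - ⟪ℓ, η⟫| * gegen (((n : ℝ) - 2) / 2) k ⟪e, η⟫) =
      sphKappa n 0 * (gegen (((n : ℝ) - 2) / 2) k c / gegen (((n : ℝ) - 2) / 2) k 1) *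
        ∫ t in (-1 : ℝ)..1, |a - t| *
          (gegen (((n : ℝ) - 2) / 2) k t * gegenWeight (((n : ℝ) - 2) / 2) t) := fun k => by
    rw [he]
    exact sphMean_comp_inner_mul_gegen hn hℓ hf hℓf hcs k (g := fun t => |a - t|) (by fun_prop)
  simp only [hterm] at hs
  rw [← hs.tsum_eq, ← hs.summable.sum_add_tsum_nat_add 2, Finset.sum_range_succ,
    Finset.sum_range_one]
  have htail : ∀ k : ℕ, sphKappa n 0 * (gegen (((n : ℝ) - 2) / 2) (k + 2) c /
      gegen (((n : ℝ) - 2) / 2) (k + 2) 1) * (∫ t in (-1 : ℝ)..1, |a - t| *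
        (gegen (((n : ℝ) - 2) / 2) (k + 2) t * gegenWeight (((n : ℝ) - 2) / 2) t)) * ρ ^ (k + 2) =
      sphKappa n 0 * (2 / ((n : ℝ) ^ 2 - 1) * gegenWeight (((n : ℝ) - 2) / 2 + 2) a) *
        ((Nat.factorial k : ℝ) / poch ((n : ℝ) + 2) k * gegen (((n : ℝ) - 2) / 2 + 2) k a *
          gegen (((n : ℝ) - 2) / 2) (k + 2) c * ρ ^ (k + 2)) := fun k => by
    have h1 := integral_abs_sub_mul_gegen (μ := ((n : ℝ) - 2) / 2) (by linarith) k ha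
    simp only [mul_assoc] at h1
    have h2 := two_mul_gegenRatio_div_gegen_one (ν := n) (by linarith) k
    rw [h1]
    linear_combination sphKappa n 0 * gegen (((n : ℝ) - 2) / 2) (k + 2) c *
      gegenWeight (((n : ℝ) - 2) / 2 + 2) a * gegen (((n : ℝ) - 2) / 2 + 2) k a * ρ ^ (k + 2) * h2
  simp only [htail, tsum_mul_left]
  have g1 : ∀ t, gegen (((n : ℝ) - 2) / 2) 1 t = ((n : ℝ) - 2) * t := fun t => by
    rw [← eval_gegenPoly, gegenPoly_one]
    simp only [Polynomial.eval_mul, Polynomial.eval_C, Polynomial.eval_X]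
    ring
  have g0 : ∀ t, gegen (((n : ℝ) - 2) / 2) 0 t = 1 := fun t => by
    rw [← eval_gegenPoly, gegenPoly_zero]
    simp
  have i1 : (∫ t in (-1 : ℝ)..1, |a - t| * (((n : ℝ) - 2) * t *
      gegenWeight (((n : ℝ) - 2) / 2) t)) = ((n : ℝ) - 2) *
        ∫ t in (-1 : ℝ)..1, |a - t| * gegenWeight (((n : ℝ) - 2) / 2) t * t := by
    rw [← intervalIntegral.integral_const_mul]
    congr 1
    ext t
    ring
  have hn2 : (n : ℝ) - 2 ≠ 0 := by linarith
  simp only [g0, g1, one_mul, i1, pow_zero, pow_one, mul_one, div_one]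
  rw [mul_div_cancel_left₀ _ hn2]
  ring

theorem dirConst_representation (n : ℕ) (hn : 3 ≤ n) (ρ α : ℝ)
    (hρ : 0 ≤ ρ) (hρ' : ρ < 1) (hα : α ∈ Set.Icc (0:ℝ) Real.pi) :
    dirConst n (ρ • EuclideanSpace.single (⟨0, by omega⟩ : Fin n) 1)
        (Real.cos α • EuclideanSpace.single (⟨0, by omega⟩ : Fin n) 1
          + Real.sin α • EuclideanSpace.single (⟨1, by omega⟩ : Fin n) 1)
      = (2 * Real.Gamma (((n:ℝ) + 2)/2) / (Real.Gamma (1/2) * Real.Gamma (((n:ℝ) - 1)/2)))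
          / (1 - ρ^2)
        * ((∫ x in (-1:ℝ)..1,
              |((n:ℝ) - 2)/(n:ℝ) * ρ * Real.cos α - x| * (1 - x^2) ^ (((n:ℝ) - 3)/2))
          + ((n:ℝ) - 2) * ρ * Real.cos α
            * (∫ x in (-1:ℝ)..1,
                |((n:ℝ) - 2)/(n:ℝ) * ρ * Real.cos α - x| * (1 - x^2) ^ (((n:ℝ) - 3)/2) * x)
          + 2/((n:ℝ)^2 - 1)
            * (1 - ((n:ℝ) - 2)^2/(n:ℝ)^2 * ρ^2 * Real.cos α ^ 2) ^ (((n:ℝ) + 1)/2)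
            * ∑' k : ℕ, (Nat.factorial k : ℝ) / poch ((n:ℝ) + 2) k
                * gegen (((n:ℝ) + 2)/2) k (((n:ℝ) - 2)/(n:ℝ) * ρ * Real.cos α)
                * gegen (((n:ℝ) - 2)/2) (k + 2) (Real.cos α) * ρ^(k + 2)) := by
  have hn' : (3 : ℝ) ≤ n := by exact_mod_cast hn
  have hn0 : (n : ℝ) ≠ 0 := by linarith
  set e₁ : EuclideanSpace ℝ (Fin n) := EuclideanSpace.single ⟨0, by omega⟩ 1 with he₁
  set e₂ : EuclideanSpace ℝ (Fin n) := EuclideanSpace.single ⟨1, by omega⟩ 1 with he₂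
  have h11 : ⟪e₁, e₁⟫ = 1 := by simp [he₁]
  have h22 : ⟪e₂, e₂⟫ = 1 := by simp [he₂]
  have h12 : ⟪e₁, e₂⟫ = 0 := by simp [he₁, he₂, EuclideanSpace.inner_single_left]
  have h21 : ⟪e₂, e₁⟫ = 0 := by rw [real_inner_comm, h12]
  have hn1 : ‖e₁‖ = 1 := by simp [he₁]
  have hcs := Real.cos_sq_add_sin_sq α
  set ℓ := Real.cos α • e₁ + Real.sin α • e₂ with hℓ
  set f := Real.sin α • e₁ - Real.cos α • e₂ with hf
  have norm_eq_one : ∀ v : EuclideanSpace ℝ (Fin n), ⟪v, v⟫ = 1 → ‖v‖ = 1 := fun v hv => by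
    rw [real_inner_self_eq_norm_sq] at hv
    exact (pow_eq_one_iff_of_nonneg (norm_nonneg _) two_ne_zero).1 hv
  have hℓ1 : ‖ℓ‖ = 1 := norm_eq_one _ (by
    simp only [hℓ, inner_add_left, inner_add_right, inner_smul_left, inner_smul_right, h11, h22,
      h12, h21, conj_trivial]
    linear_combination hcs)
  have hf1 : ‖f‖ = 1 := norm_eq_one _ (by
    simp only [hf, inner_sub_left, inner_sub_right, inner_smul_left, inner_smul_right, h11, h22,
      h12, h21, conj_trivial]
    linear_combination hcs)
  have hℓf : ⟪ℓ, f⟫ = 0 := by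
    simp only [hℓ, hf, inner_add_left, inner_sub_right, inner_smul_left, inner_smul_right, h11, h22,
      h12, h21, conj_trivial]
    ring
  have hef : e₁ = Real.cos α • ℓ + Real.sin α • f := by
    have : Real.cos α • ℓ + Real.sin α • f = (Real.cos α ^ 2 + Real.sin α ^ 2) • e₁ := by
      rw [hℓ, hf]
      module
    rw [this, hcs, one_smul]
  have heℓ : ⟪e₁, ℓ⟫ = Real.cos α := by
    rw [hℓ, inner_add_right, inner_smul_right, inner_smul_right, h11, h12]
    ring
  have hxn : ‖ρ • e₁‖ = ρ := by rw [norm_smul, hn1, mul_one, Real.norm_of_nonneg hρ]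
  set a := ((n : ℝ) - 2) / n * ρ * Real.cos α with ha
  have haI : a ∈ Set.Ioo (-1 : ℝ) 1 := by
    rw [Set.mem_Ioo, ← abs_lt, ha, abs_mul, abs_of_nonneg (mul_nonneg (div_nonneg (by linarith)
      (by linarith)) hρ)]
    have h1 : ((n : ℝ) - 2) / n ≤ 1 := (div_le_one (by linarith)).2 (by linarith)
    have h2 : ((n : ℝ) - 2) / n * ρ ≤ ρ := mul_le_of_le_one_left hρ h1
    exact (mul_le_of_le_one_right (mul_nonneg (div_nonneg (by linarith) (by linarith)) hρ)
      (Real.abs_cos_le_one α)).trans_lt (h2.trans_lt hρ')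
  have hmean : sphMean n (fun η => (‖η - ρ • e₁‖ ^ 2) ^ (-(((n : ℝ) - 2) / 2)) *
      |((n : ℝ) - 2) * ⟪ρ • e₁, ℓ⟫ - n * ⟪η, ℓ⟫|) =
      n * sphMean n (fun η => |a - ⟪ℓ, η⟫| * (‖η - ρ • e₁‖ ^ 2) ^ (-(((n : ℝ) - 2) / 2))) := by
    rw [← sphMean_const_mul]
    refine sphMean_congr fun η _ => ?_
    have h1 : ((n : ℝ) - 2) * ⟪ρ • e₁, ℓ⟫ - n * ⟪η, ℓ⟫ = n * (a - ⟪ℓ, η⟫) := by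
      rw [inner_smul_left, heℓ, real_inner_comm, conj_trivial, ha]
      field_simp
    rw [h1, abs_mul, abs_of_nonneg (by linarith : (0 : ℝ) ≤ n)]
    ring
  rw [dirConst_eq_dirBound hn (by rw [hxn]; exact hρ'), dirBound, hmean, hxn,
    sphMean_abs_sub_inner_mul_norm_sub_rpow hn hℓ1 hf1 hℓf hcs hef hn1
      (by rwa [abs_of_nonneg hρ]) haI, ← nat_mul_sphKappa_zero hn]
  have hw : ∀ t, gegenWeight (((n : ℝ) - 2) / 2) t = (1 - t ^ 2) ^ (((n : ℝ) - 3) / 2) := fun t => by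
    rw [gegenWeight]; congr 1; ring
  have hwa : gegenWeight (((n : ℝ) - 2) / 2 + 2) a =
      (1 - ((n : ℝ) - 2) ^ 2 / (n : ℝ) ^ 2 * ρ ^ 2 * Real.cos α ^ 2) ^ (((n : ℝ) + 1) / 2) := by
    rw [gegenWeight, ha]
    congr 1 <;> ring
  have hμ : ((n : ℝ) - 2) / 2 + 2 = ((n : ℝ) + 2) / 2 := by ring
  simp only [hw, ← hwa]
  rw [hμ]
  ring
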